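/- arXiv:2012.08346 — 4 statements merged into one kernel-verified Lean document; each statement's English description precedes it below -/
import Mathlib

section
/- Let k, m ∈ ℕ, let a = ⌈2√m⌉, and let θ > 0 satisfy (2θ/√(2πk))^m · C(ak, k) = 1, where C(ak,k) is the binomial coefficient. Let Y₁, …, Y_{ak} ∈ ℝ^m be i.i.d. random vectors with independent coordinates such that for some k₀ ∈ ℕ, γ ≥ 0, M > 0, each coordinate Y_{1,i} (i ∈ [m]) is a (γ, k₀)-Gaussian convergent continuous random variable with maximum density at most M. If k ≥ max{(4√m + 2)·k₀, 144·m^{3/2}·(log M + 3), 150000·(γ + 1)·m^{7/4}}, then for every vector D ∈ ℝ^m with ‖D‖₂ ≤ √k, the probability that there exists a subset K ⊆ [ak] with |K| = k and ‖(Σ_{j∈K} Y_j) − D‖_∞ ≤ θ is at least 1/25. -/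
open MeasureTheory ProbabilityTheory

/-- A real random variable (given by its law `μ`, a measure on `ℝ`) is
`(γ, k₀)`-Gaussian convergent if for every `n ≥ k₀` the density `f_n` of
`(Σ_{i=1}^n X_i)/√n` (for `X₁, …, Xₙ` i.i.d. with law `μ`) satisfies
`|f_n(x) − φ(x)| ≤ γ/n` for all `x ∈ ℝ`, where `φ` is the standard Gaussian density. -/
def IsGaussianConvergent (μ : Measure ℝ) (γ : ℝ) (k₀ : ℕ) : Prop :=
  ∀ n : ℕ, k₀ ≤ n → ∃ f : ℝ → ℝ,
    Measure.map (fun y : Fin n → ℝ => (∑ i, y i) / Real.sqrt n)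
        (Measure.pi fun _ : Fin n => μ)
      = MeasureTheory.volume.withDensity (fun x => ENNReal.ofReal (f x)) ∧
    ∀ x : ℝ, |f x - Real.exp (-x ^ 2 / 2) / Real.sqrt (2 * Real.pi)| ≤ γ / n

/-- A real random variable (with law `μ`) is continuous with maximum density at most `M`
if its law has a density `f` w.r.t. Lebesgue measure with `0 ≤ f ≤ M` pointwise. -/
def HasMaxDensityLE (μ : Measure ℝ) (M : ℝ) : Prop :=
  ∃ f : ℝ → ℝ, μ = MeasureTheory.volume.withDensity (fun x => ENNReal.ofReal (f x)) ∧
    ∀ x, 0 ≤ f x ∧ f x ≤ M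

/-- law of a sum of n iid variables -/
noncomputable def sumLaw (μ : Measure ℝ) (n : ℕ) : Measure ℝ :=
  Measure.map (fun y : Fin n → ℝ => ∑ i, y i) (Measure.pi fun _ : Fin n => μ)

instance sumLaw_prob (μ : Measure ℝ) [IsProbabilityMeasure μ] (n : ℕ) :
    IsProbabilityMeasure (sumLaw μ n) :=
  Measure.isProbabilityMeasure_map (by fun_prop)

lemma indep_coord {N : ℕ} (μ : Measure ℝ) [IsProbabilityMeasure μ] :
    iIndepFun (fun (j : Fin N) (y : Fin N → ℝ) => y j) (Measure.pi fun _ : Fin N => μ) :=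
  iIndepFun_pi (X := fun _ x => x) (fun _ => aemeasurable_id)

lemma map_coord {N : ℕ} (μ : Measure ℝ) [IsProbabilityMeasure μ] (j : Fin N) :
    Measure.map (fun y : Fin N → ℝ => y j) (Measure.pi fun _ : Fin N => μ) = μ :=
  (measurePreserving_eval (fun _ : Fin N => μ) j).map_eq

lemma sumLaw_finset {N : ℕ} (μ : Measure ℝ) [IsProbabilityMeasure μ] (K : Finset (Fin N)) :
    Measure.map (fun y : Fin N → ℝ => ∑ j ∈ K, y j) (Measure.pi fun _ : Fin N => μ)
      = sumLaw μ K.card := by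
  have h1 : iIndepFun (fun (i : Fin K.card) (y : Fin N → ℝ) => y (K.equivFin.symm i : Fin N))
      (Measure.pi fun _ : Fin N => μ) :=
    (indep_coord (N := N) μ).precomp
      (g := fun i : Fin K.card => (K.equivFin.symm i : Fin N))
      (fun a b h => K.equivFin.symm.injective (Subtype.ext h))
  have h2 := (iIndepFun_iff_map_fun_eq_pi_map (fun i => (measurable_pi_apply _).aemeasurable)).1 h1
  simp only [map_coord] at h2
  rw [sumLaw, ← h2, Measure.map_map (by fun_prop) (by fun_prop)]
  congr 1
  ext y
  simp only [Function.comp]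
  rw [← Finset.sum_coe_sort K, ← K.equivFin.symm.sum_comp]

lemma meas_pair {N : ℕ} (S B C : Finset (Fin N)) :
    Measurable (fun v : S → ℝ => ((∑ i : S, (if (i : Fin N) ∈ B then v i else 0),
        ∑ i : S, (if (i : Fin N) ∈ C then v i else 0)) : ℝ × ℝ)) := by
  refine Measurable.prodMk ?_ ?_ <;>
  · refine Finset.measurable_sum _ (fun i _ => ?_)
    split_ifs <;> fun_prop

lemma indep_sums {N : ℕ} (μ : Measure ℝ) [IsProbabilityMeasure μ] (A B : Finset (Fin N))
    (h : Disjoint A B) :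
    IndepFun (fun (y : Fin N → ℝ) (i : A) => y i) (fun (y : Fin N → ℝ) (i : B) => y i)
     (Measure.pi fun _ : Fin N => μ) :=
  (indep_coord (N := N) μ).indepFun_finset A B h (fun i => by fun_prop)

/-- joint law of disjoint sums -/
lemma joint_three {N : ℕ} (μ : Measure ℝ) [IsProbabilityMeasure μ] (A B C : Finset (Fin N))
    (hAB : Disjoint A B) (hAC : Disjoint A C) (hBC : Disjoint B C) :
    Measure.map (fun y : Fin N → ℝ => (∑ j ∈ A, y j, (∑ j ∈ B, y j, ∑ j ∈ C, y j)))
      (Measure.pi fun _ : Fin N => μ)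
      = (sumLaw μ A.card).prod ((sumLaw μ B.card).prod (sumLaw μ C.card)) := by
  have hs : ∀ (A B C : Finset (Fin N)) (y : Fin N → ℝ), C ⊆ A → ∑ j ∈ C, y j =
      ∑ j : A, if (j : Fin N) ∈ C then y j else 0 := by
    intro A B C y h
    rw [Finset.sum_coe_sort A (fun j => if j ∈ C then y j else 0), ← Finset.sum_filter]
    congr 1
    ext j; simp; exact fun hj => h hj
  have h1 := (indep_sums μ B C hBC).comp (φ := fun v => ∑ i, v i) (ψ := fun v => ∑ i, v i)
    (by fun_prop) (by fun_prop)
  have h2 := (indep_sums μ A (B ∪ C) (by simp [hAB, hAC])).comp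
    (φ := fun v => ∑ i, v i)
    (ψ := fun v => (∑ i : (B ∪ C : Finset (Fin N)), (if (i : Fin N) ∈ B then v i else 0),
        ∑ i : (B ∪ C : Finset (Fin N)), (if (i : Fin N) ∈ C then v i else 0)))
    (by fun_prop) (meas_pair (B ∪ C) B C)
  simp only [Function.comp_def] at h1 h2
  have e1 : ∀ (K : Finset (Fin N)) (y : Fin N → ℝ), ∑ j : K, y j = ∑ j ∈ K, y j :=
    fun K y => Finset.sum_coe_sort K y
  simp only [e1] at h1 h2
  have e2 : ∀ y : Fin N → ℝ, ∑ i : (B ∪ C : Finset (Fin N)), (if (i : Fin N) ∈ B then y i else 0)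
      = ∑ j ∈ B, y j := fun y => (hs (B ∪ C) C B y Finset.subset_union_left).symm
  have e3 : ∀ y : Fin N → ℝ, ∑ i : (B ∪ C : Finset (Fin N)), (if (i : Fin N) ∈ C then y i else 0)
      = ∑ j ∈ C, y j := fun y => (hs (B ∪ C) C C y Finset.subset_union_right).symm
  simp only [e2, e3] at h2
  rw [(indepFun_iff_map_prod_eq_prod_map_map (by fun_prop) (by fun_prop)).1 h2,
    (indepFun_iff_map_prod_eq_prod_map_map (by fun_prop) (by fun_prop)).1 h1,
    sumLaw_finset, sumLaw_finset, sumLaw_finset]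

lemma joint_two {N : ℕ} (μ : Measure ℝ) [IsProbabilityMeasure μ] (K K' : Finset (Fin N))
    (D θ : ℝ) (hc : K.card = K'.card) :
    (Measure.pi fun _ : Fin N => μ)
      ({y | |(∑ j ∈ K, y j) - D| ≤ θ} ∩ {y | |(∑ j ∈ K', y j) - D| ≤ θ})
      = ∫⁻ u, (sumLaw μ (K.card - (K ∩ K').card) (Metric.closedBall (D - u) θ)) ^ 2
          ∂(sumLaw μ (K ∩ K').card) := by
  have h := joint_three μ (K ∩ K') (K \ K') (K' \ K)
    (Finset.disjoint_left.2 (by intro a; simp; tauto))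
    (Finset.disjoint_left.2 (by intro a; simp; tauto))
    (Finset.disjoint_left.2 (by intro a; simp; tauto))
  have c1 : (K \ K').card = K.card - (K ∩ K').card := by
    rw [Finset.card_sdiff, Finset.inter_comm]
  have c2 : (K' \ K).card = K.card - (K ∩ K').card := by
    rw [Finset.card_sdiff, hc]
  rw [c1, c2] at h
  have s1 : ∀ y : Fin N → ℝ, ∑ j ∈ K, y j = ∑ j ∈ K ∩ K', y j + ∑ j ∈ K \ K', y j := by
    intro y; rw [Finset.sum_inter_add_sum_sdiff]
  have s2 : ∀ y : Fin N → ℝ, ∑ j ∈ K', y j = ∑ j ∈ K ∩ K', y j + ∑ j ∈ K' \ K, y j := by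
    intro y; rw [Finset.inter_comm, Finset.sum_inter_add_sum_sdiff]
  have hset : ({y : Fin N → ℝ | |(∑ j ∈ K, y j) - D| ≤ θ} ∩ {y | |(∑ j ∈ K', y j) - D| ≤ θ})
    = (fun y : Fin N → ℝ => (∑ j ∈ K ∩ K', y j, (∑ j ∈ K \ K', y j, ∑ j ∈ K' \ K, y j))) ⁻¹'
      {p : ℝ × ℝ × ℝ | |p.1 + p.2.1 - D| ≤ θ ∧ |p.1 + p.2.2 - D| ≤ θ} := by
    ext y
    simp only [Set.mem_inter_iff, Set.mem_ofPred_eq, Set.mem_preimage, s1, s2]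
  have hmeas : MeasurableSet {p : ℝ × ℝ × ℝ | |p.1 + p.2.1 - D| ≤ θ ∧ |p.1 + p.2.2 - D| ≤ θ} := by
    have h1 : MeasurableSet {p : ℝ × ℝ × ℝ | |p.1 + p.2.1 - D| ≤ θ} :=
      measurableSet_le (by fun_prop) (by fun_prop)
    have h2 : MeasurableSet {p : ℝ × ℝ × ℝ | |p.1 + p.2.2 - D| ≤ θ} :=
      measurableSet_le (by fun_prop) (by fun_prop)
    exact h1.inter h2
  rw [hset, ← Measure.map_apply (by fun_prop) hmeas, h, Measure.prod_apply hmeas]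
  congr 1
  ext u
  have : (Prod.mk u ⁻¹' {p : ℝ × ℝ × ℝ | |p.1 + p.2.1 - D| ≤ θ ∧ |p.1 + p.2.2 - D| ≤ θ})
    = Metric.closedBall (D - u) θ ×ˢ Metric.closedBall (D - u) θ := by
    ext ⟨v, w⟩
    simp only [Set.mem_preimage, Set.mem_ofPred_eq, Set.mem_prod, Metric.mem_closedBall,
      Real.dist_eq]
    rw [show v - (D - u) = u + v - D by ring, show w - (D - u) = u + w - D by ring]
  rw [this, Measure.prod_prod, sq]

lemma single_law {N : ℕ} (μ : Measure ℝ) [IsProbabilityMeasure μ] (K : Finset (Fin N))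
    (D θ : ℝ) :
    (Measure.pi fun _ : Fin N => μ) {y | |(∑ j ∈ K, y j) - D| ≤ θ}
     = sumLaw μ K.card (Metric.closedBall D θ) := by
  rw [← sumLaw_finset, Measure.map_apply (by fun_prop) Metric.isClosed_closedBall.measurableSet]
  congr 1

/-- the crude bound through the density bound `M` -/
lemma joint_crude {N : ℕ} (μ : Measure ℝ) [IsProbabilityMeasure μ] (K K' : Finset (Fin N))
    (D θ : ℝ) (c : ENNReal) (hμ : ∀ x, μ (Metric.closedBall x θ) ≤ c) (e : Fin N) (he : e ∈ K')
    (he' : e ∉ K) :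
    (Measure.pi fun _ : Fin N => μ)
      ({y | |(∑ j ∈ K, y j) - D| ≤ θ} ∩ {y | |(∑ j ∈ K', y j) - D| ≤ θ})
      ≤ (Measure.pi fun _ : Fin N => μ) {y | |(∑ j ∈ K, y j) - D| ≤ θ} * c := by
  have hme : Measurable (fun v : ({e} : Finset (Fin N)) → ℝ =>
      v ⟨e, Finset.mem_singleton_self e⟩) := by fun_prop
  have h0 := (indep_sums μ (Finset.univ.erase e) {e} (by simp)).comp
    (φ := fun v => (∑ i : (Finset.univ.erase e : Finset (Fin N)), (if (i : Fin N) ∈ K then v i else 0),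
        ∑ i : (Finset.univ.erase e : Finset (Fin N)), (if (i : Fin N) ∈ K' then v i else 0)))
    (ψ := fun v : ({e} : Finset (Fin N)) → ℝ => v ⟨e, Finset.mem_singleton_self e⟩)
    (meas_pair (Finset.univ.erase e) K K') hme
  simp only [Function.comp_def] at h0
  have hs : ∀ (C : Finset (Fin N)) (y : Fin N → ℝ),
      (∑ i : (Finset.univ.erase e : Finset (Fin N)), (if (i : Fin N) ∈ C then y i else 0))
       = ∑ j ∈ C.erase e, y j := by
    intro C y
    rw [Finset.sum_coe_sort (Finset.univ.erase e) (fun j => if j ∈ C then y j else 0),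
      ← Finset.sum_filter]
    congr 1
    ext j; simp
  simp only [hs, Finset.erase_eq_of_notMem he'] at h0
  have h1 := (indepFun_iff_map_prod_eq_prod_map_map (by fun_prop)
    (measurable_pi_apply e).aemeasurable).1 h0
  rw [map_coord] at h1
  have hmeas : MeasurableSet {p : (ℝ × ℝ) × ℝ | |p.1.1 - D| ≤ θ ∧ |p.1.2 + p.2 - D| ≤ θ} := by
    have h1 : MeasurableSet {p : (ℝ × ℝ) × ℝ | |p.1.1 - D| ≤ θ} :=
      measurableSet_le (by fun_prop) (by fun_prop)
    have h2 : MeasurableSet {p : (ℝ × ℝ) × ℝ | |p.1.2 + p.2 - D| ≤ θ} :=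
      measurableSet_le (by fun_prop) (by fun_prop)
    exact h1.inter h2
  have hmeas2 : MeasurableSet {p : (ℝ × ℝ) | |p.1 - D| ≤ θ} := by
    exact measurableSet_le (by fun_prop) (by fun_prop)
  have hset : ({y : Fin N → ℝ | |(∑ j ∈ K, y j) - D| ≤ θ} ∩ {y | |(∑ j ∈ K', y j) - D| ≤ θ})
    = (fun y : Fin N → ℝ => ((∑ j ∈ K, y j, ∑ j ∈ K'.erase e, y j), y e)) ⁻¹'
      {p : (ℝ × ℝ) × ℝ | |p.1.1 - D| ≤ θ ∧ |p.1.2 + p.2 - D| ≤ θ} := by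
    ext y
    simp only [Set.mem_inter_iff, Set.mem_ofPred_eq, Set.mem_preimage, Finset.sum_erase_add _ _ he]
  have hset2 : {y : Fin N → ℝ | |(∑ j ∈ K, y j) - D| ≤ θ}
    = (fun y : Fin N → ℝ => (∑ j ∈ K, y j, ∑ j ∈ K'.erase e, y j)) ⁻¹'
      {p : (ℝ × ℝ) | |p.1 - D| ≤ θ} := by
    ext y
    simp only [Set.mem_ofPred_eq, Set.mem_preimage]
  rw [hset, hset2, ← Measure.map_apply (by fun_prop) hmeas, h1, Measure.prod_apply hmeas,
    ← Measure.map_apply (by fun_prop) hmeas2, mul_comm, ← setLIntegral_const,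
    ← lintegral_indicator hmeas2]
  refine lintegral_mono (fun p => ?_)
  by_cases hp : |p.1 - D| ≤ θ
  · rw [Set.indicator_of_mem (show p ∈ {p : (ℝ × ℝ) | |p.1 - D| ≤ θ} from hp)]
    refine le_trans (measure_mono ?_) (hμ (D - p.2))
    intro x hx
    simp only [Set.mem_preimage, Set.mem_ofPred_eq] at hx
    rw [Metric.mem_closedBall, Real.dist_eq, show x - (D - p.2) = p.2 + x - D by ring]
    exact hx.2
  · rw [Set.indicator_of_notMem (show p ∉ {p : (ℝ × ℝ) | |p.1 - D| ≤ θ} from hp)]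
    simp [hp]

lemma pi_swap {N m : ℕ} (μ : Fin m → Measure ℝ) [∀ i, IsProbabilityMeasure (μ i)] :
    Measure.map (fun (Y : Fin N → Fin m → ℝ) i j => Y j i)
      (Measure.pi fun _ : Fin N => Measure.pi fun i : Fin m => μ i)
      = Measure.pi fun i : Fin m => Measure.pi fun _ : Fin N => μ i := by
  symm
  refine Measure.pi_eq_generateFrom
    (C := fun i => (Set.univ.pi '' Set.univ.pi fun _ : Fin N => {s : Set ℝ | MeasurableSet s}))
    (fun i => generateFrom_pi) (fun i => isPiSystem_pi)
    (fun i => ⟨fun _ => Set.univ, fun _ => ⟨fun _ => Set.univ, by simp, by simp⟩, by simp, by simp [Set.iUnion_const]⟩) ?_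
  intro s hs
  choose t ht hts using hs
  have hmt : ∀ i j, MeasurableSet (t i j) := fun i j => ht i j trivial
  have : s = fun i => Set.univ.pi (t i) := by ext1 i; exact (hts i).symm
  subst this
  rw [Measure.map_apply (by fun_prop) (MeasurableSet.univ_pi fun i => MeasurableSet.univ_pi (hmt i))]
  have : (fun (Y : Fin N → Fin m → ℝ) i j => Y j i) ⁻¹' (Set.univ.pi fun i => Set.univ.pi (t i))
    = Set.univ.pi (fun j => Set.univ.pi fun i => t i j) := by
    ext Y; simp only [Set.mem_preimage, Set.mem_univ_pi]; exact forall_comm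
  rw [this]
  simp only [Measure.pi_pi]
  exact Finset.prod_comm

lemma prob_prod {N m : ℕ} (μ : Fin m → Measure ℝ) [∀ i, IsProbabilityMeasure (μ i)]
    (E : Fin m → Set (Fin N → ℝ)) (hE : ∀ i, MeasurableSet (E i)) :
    (Measure.pi fun _ : Fin N => Measure.pi fun i : Fin m => μ i)
      {Y | ∀ i, (fun j => Y j i) ∈ E i} = ∏ i, (Measure.pi fun _ : Fin N => μ i) (E i) := by
  rw [← Measure.pi_pi, ← pi_swap, Measure.map_apply (by fun_prop) (MeasurableSet.univ_pi hE)]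
  congr 1
  ext Y; simp

lemma density_ball_le (μ : Measure ℝ) (M : ℝ) (h : HasMaxDensityLE μ M) (x θ : ℝ) (hM : 0 < M) :
    μ (Metric.closedBall x θ) ≤ ENNReal.ofReal (2 * θ * M) := by
  obtain ⟨f, hf, hb⟩ := h
  rw [hf, withDensity_apply _ Metric.isClosed_closedBall.measurableSet]
  calc _ ≤ ∫⁻ y in Metric.closedBall x θ, ENNReal.ofReal M :=
        lintegral_mono (fun y => ENNReal.ofReal_le_ofReal (hb y).2)
    _ = _ := by
      rw [setLIntegral_const, Real.volume_closedBall, ← ENNReal.ofReal_mul hM.le]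
      congr 1; ring

lemma gauss_ball_le (c : ℝ) (v : NNReal) (hv : v ≠ 0) (x θ : ℝ) :
    gaussianReal c v (Metric.closedBall x θ) ≤ ENNReal.ofReal (2 * θ / √(2 * Real.pi * v)) := by
  rw [gaussianReal_apply _ hv]
  calc _ ≤ ∫⁻ y in Metric.closedBall x θ, ENNReal.ofReal ((√(2 * Real.pi * v))⁻¹) := by
        refine lintegral_mono (fun y => ?_)
        rw [gaussianPDF_def]
        refine ENNReal.ofReal_le_ofReal ?_
        rw [gaussianPDFReal_def]
        refine mul_le_of_le_one_right (by positivity) (Real.exp_le_one_iff.2 ?_)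
        rw [neg_div]
        exact neg_nonpos.2 (by positivity)
    _ = _ := by
      rw [setLIntegral_const, Real.volume_closedBall, ← ENNReal.ofReal_mul (by positivity)]
      congr 1; ring

lemma gauss_ball_ge (v : NNReal) (hv : v ≠ 0) (x θ : ℝ) (hθ : 0 ≤ θ) :
    ENNReal.ofReal (2 * θ / √(2 * Real.pi * v) * Real.exp (-(|x| + θ) ^ 2 / (2 * v)))
      ≤ gaussianReal 0 v (Metric.closedBall x θ) := by
  rw [gaussianReal_apply _ hv]
  calc _ = ∫⁻ y in Metric.closedBall x θ,
        ENNReal.ofReal ((√(2 * Real.pi * v))⁻¹ * Real.exp (-(|x| + θ) ^ 2 / (2 * v))) := by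
        rw [setLIntegral_const, Real.volume_closedBall, ← ENNReal.ofReal_mul (by positivity)]
        congr 1; ring
    _ ≤ _ := by
        refine setLIntegral_mono' Metric.isClosed_closedBall.measurableSet (fun y hy => ?_)
        rw [gaussianPDF_def]
        refine ENNReal.ofReal_le_ofReal ?_
        rw [gaussianPDFReal_def]
        rw [Metric.mem_closedBall, Real.dist_eq] at hy
        have h1 : |y| ≤ |x| + θ := by
          have := abs_add_le x (y - x)
          rw [add_sub_cancel] at this
          linarith
        have h2 : (y - 0) ^ 2 ≤ (|x| + θ) ^ 2 := by
          rw [sub_zero, ← sq_abs y]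
          exact pow_le_pow_left₀ (abs_nonneg _) h1 2
        refine mul_le_mul_of_nonneg_left (Real.exp_le_exp.2 ?_) (by positivity)
        exact div_le_div_of_nonneg_right (neg_le_neg h2) (by positivity)

lemma gauss_sq (l : NNReal) (hl : l ≠ 0) (x θ : ℝ) (hθ : 0 ≤ θ) :
    (gaussianReal 0 l (Metric.closedBall x θ)) ^ 2 ≤
      ENNReal.ofReal (2 * θ / √(4 * Real.pi * l)) *
        gaussianReal 0 (l / 2) (Metric.closedBall x θ) := by
  have hl0 : (0 : ℝ) < l := by positivity
  have hl2 : l / 2 ≠ 0 := by positivity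
  rw [gaussianReal_apply _ hl, gaussianReal_apply _ hl2]
  have hcs := ENNReal.lintegral_mul_le_Lp_mul_Lq
    (volume.restrict (Metric.closedBall x θ)) (p := 2) (q := 2) Real.HolderConjugate.two_two
    (f := gaussianPDF 0 l) (g := fun _ => 1) (by fun_prop) (by fun_prop)
  simp only [Pi.mul_apply, mul_one, ENNReal.one_rpow, lintegral_const, one_mul,
    Measure.restrict_apply MeasurableSet.univ, Set.univ_inter, Real.volume_closedBall] at hcs
  have h2 := pow_le_pow_left₀ (zero_le) hcs 2
  refine h2.trans (le_of_eq ?_)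
  have hr : ∀ z : ENNReal, (z ^ ((1 : ℝ) / 2)) ^ 2 = z := by
    intro z
    rw [← ENNReal.rpow_natCast, ← ENNReal.rpow_mul]
    norm_num
  rw [mul_pow, hr, hr]
  have hp : ∀ y, gaussianPDF 0 l y ^ (2:ℕ) =
      ENNReal.ofReal ((√(4 * Real.pi * l))⁻¹) * gaussianPDF 0 (l / 2) y := by
    intro y
    rw [gaussianPDF_def, gaussianPDF_def, ← ENNReal.ofReal_pow (gaussianPDFReal_nonneg _ _ _),
      ← ENNReal.ofReal_mul (by positivity)]
    congr 1
    rw [gaussianPDFReal_def, gaussianPDFReal_def]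
    simp only [sub_zero, NNReal.coe_div, NNReal.coe_ofNat]
    rw [mul_pow, ← Real.exp_nat_mul, ← mul_assoc, ← mul_inv, inv_pow, Real.sq_sqrt (by positivity),
      ← Real.sqrt_mul (by positivity)]
    congr 2
    · rw [show 4 * Real.pi * l * (2 * Real.pi * (l / 2)) = (2 * Real.pi * l) ^ 2 by ring,
        Real.sqrt_sq (by positivity)]
    · push_cast; field_simp
  have hp' : ∀ y, gaussianPDF 0 l y ^ (2:ℝ) =
      ENNReal.ofReal ((√(4 * Real.pi * l))⁻¹) * gaussianPDF 0 (l / 2) y := by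
    intro y
    rw [← hp y, ← ENNReal.rpow_natCast]
    norm_num
  simp only [hp']
  rw [lintegral_const_mul _ (by fun_prop), mul_right_comm, ← ENNReal.ofReal_mul (by positivity)]
  congr 2
  ring

lemma gauss_main (l j : NNReal) (hl : l ≠ 0) (D θ : ℝ) (hθ : 0 ≤ θ) :
    ∫⁻ u, (gaussianReal 0 l (Metric.closedBall (D - u) θ)) ^ 2 ∂(gaussianReal 0 j)
     ≤ ENNReal.ofReal (2 * θ / √(4 * Real.pi * l) * (2 * θ / √(2 * Real.pi * (l / 2 + j)))) := by
  have hl2 : l / 2 ≠ 0 := by positivity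
  calc _ ≤ ∫⁻ u, ENNReal.ofReal (2 * θ / √(4 * Real.pi * l)) *
        gaussianReal 0 (l / 2) (Metric.closedBall (D - u) θ) ∂(gaussianReal 0 j) :=
        lintegral_mono (fun u => gauss_sq l hl _ θ hθ)
    _ = ENNReal.ofReal (2 * θ / √(4 * Real.pi * l)) *
        (gaussianReal 0 j ∗ gaussianReal 0 (l / 2)) (Metric.closedBall D θ) := by
      rw [lintegral_const_mul' _ _ ENNReal.ofReal_ne_top]
      congr 1
      rw [← lintegral_indicator_one Metric.isClosed_closedBall.measurableSet,
        Measure.lintegral_conv (measurable_one.indicator Metric.isClosed_closedBall.measurableSet)]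
      congr 1; ext u
      rw [← lintegral_indicator_one Metric.isClosed_closedBall.measurableSet]
      congr 1; ext v
      simp only [Set.indicator, Metric.mem_closedBall, Real.dist_eq, Pi.one_apply]
      rw [show v - (D - u) = u + v - D by ring]
    _ ≤ _ := by
      rw [gaussianReal_conv_gaussianReal, ENNReal.ofReal_mul (by positivity)]
      gcongr
      refine (gauss_ball_le _ (j + l / 2) (by positivity) D θ).trans (le_of_eq ?_)
      push_cast
      rw [add_comm (j : ℝ)]

lemma lintegral_ball (ν : Measure ℝ) [IsProbabilityMeasure ν] (D θ : ℝ) :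
    ∫⁻ u, ν (Metric.closedBall (D - u) θ) = ENNReal.ofReal (2 * θ) := by
  have hmeas : MeasurableSet {p : ℝ × ℝ | |p.1 + p.2 - D| ≤ θ} :=
      measurableSet_le (by fun_prop) (by fun_prop)
  have h1 := Measure.prod_apply (μ := volume) (ν := ν) hmeas
  rw [Measure.prod_apply_symm hmeas] at h1
  have e1 : ∀ u : ℝ, Prod.mk u ⁻¹' {p : ℝ × ℝ | |p.1 + p.2 - D| ≤ θ} =
     Metric.closedBall (D - u) θ := by
    intro u; ext v
    simp only [Set.mem_preimage, Set.mem_ofPred_eq, Metric.mem_closedBall, Real.dist_eq]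
    rw [show v - (D - u) = u + v - D by ring]
  have e2 : ∀ v : ℝ, (fun u => (u, v)) ⁻¹' {p : ℝ × ℝ | |p.1 + p.2 - D| ≤ θ} =
     Metric.closedBall (D - v) θ := by
    intro u; ext v
    simp only [Set.mem_preimage, Set.mem_ofPred_eq, Metric.mem_closedBall, Real.dist_eq]
    rw [show v - (D - u) = v + u - D by ring]
  simp only [e1, e2, Real.volume_closedBall, lintegral_const, measure_univ, mul_one] at h1
  exact h1.symm

lemma joint_bound (ν σ : Measure ℝ) [IsProbabilityMeasure ν] (l j : NNReal) (hl : l ≠ 0)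
    (c d D θ : ℝ) (hθ : 0 ≤ θ) (hc : 0 ≤ c) (hd : 0 ≤ d)
    (hν : ν ≤ gaussianReal 0 l + ENNReal.ofReal c • volume)
    (hσ : σ ≤ gaussianReal 0 j + ENNReal.ofReal d • volume) :
    ∫⁻ u, (ν (Metric.closedBall (D - u) θ)) ^ 2 ∂σ
     ≤ ENNReal.ofReal (2 * θ / √(4 * Real.pi * l) * (2 * θ / √(2 * Real.pi * (l / 2 + j)))
        + (2 * (2 * θ * c) * (2 * θ / √(2 * Real.pi * l)) + (2 * θ * c) ^ 2)
        + d * ((2 * θ / √(2 * Real.pi * l) + 2 * θ * c) * (2 * θ))) := by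
  have hb : ∀ x, ν (Metric.closedBall x θ) ≤
      gaussianReal 0 l (Metric.closedBall x θ) + ENNReal.ofReal (2 * θ * c) := by
    intro x
    refine (hν _).trans (le_of_eq ?_)
    simp only [Measure.add_apply, Measure.smul_apply, Real.volume_closedBall, smul_eq_mul]
    rw [← ENNReal.ofReal_mul hc, mul_comm c]
  have hs : ∀ x, ν (Metric.closedBall x θ) ≤
      ENNReal.ofReal (2 * θ / √(2 * Real.pi * l) + 2 * θ * c) := by
    intro x
    refine (hb x).trans ?_
    rw [ENNReal.ofReal_add (by positivity) (by positivity)]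
    gcongr
    exact gauss_ball_le _ _ hl _ _
  refine (lintegral_mono' hσ le_rfl).trans ?_
  rw [lintegral_add_measure, lintegral_smul_measure, ENNReal.ofReal_add (by positivity) (by positivity)]
  gcongr ?_ + ?_
  · calc _ ≤ ∫⁻ u, ((gaussianReal 0 l (Metric.closedBall (D - u) θ)) ^ 2 +
          ENNReal.ofReal (2 * (2 * θ * c) * (2 * θ / √(2 * Real.pi * l)) + (2 * θ * c) ^ 2))
            ∂(gaussianReal 0 j) := by
          refine lintegral_mono (fun u => ?_)
          refine (pow_le_pow_left₀ zero_le (hb _) 2).trans ?_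
          rw [add_sq, add_assoc]
          refine add_le_add le_rfl ?_
          have e0 : 0 ≤ 2 * θ * c := by positivity
          have e1 : 0 ≤ 2 * θ / √(2 * Real.pi * l) := by positivity
          have e2 : ENNReal.ofReal (2 * (2 * θ * c) * (2 * θ / √(2 * Real.pi * l)) + (2 * θ * c) ^ 2)
            = 2 * ENNReal.ofReal (2 * θ / √(2 * Real.pi * l)) * ENNReal.ofReal (2 * θ * c)
              + ENNReal.ofReal (2 * θ * c) ^ 2 := by
            rw [ENNReal.ofReal_add (by positivity) (by positivity),
              ENNReal.ofReal_pow e0, mul_right_comm, ENNReal.ofReal_mul (by positivity),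
              ENNReal.ofReal_mul (by norm_num), ENNReal.ofReal_ofNat]
          rw [e2]
          gcongr
          exact gauss_ball_le _ _ hl _ _
      _ ≤ _ := by
        rw [lintegral_add_right _ measurable_const, lintegral_const, measure_univ, mul_one,
          ENNReal.ofReal_add (p := 2 * θ / √(4 * Real.pi * l) * _) (by positivity) (by positivity)]
        exact add_le_add (gauss_main l j hl D θ hθ) le_rfl
  · rw [ENNReal.ofReal_mul hd, ENNReal.ofReal_mul (by positivity), ← lintegral_ball ν D θ,
      ← lintegral_const_mul' _ _ ENNReal.ofReal_ne_top, smul_eq_mul]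
    gcongr with u
    rw [sq]
    gcongr
    exact hs _

lemma sumLaw_close (μ : Measure ℝ) [IsProbabilityMeasure μ] (γ : ℝ) (hγ : 0 ≤ γ) (k₀ n : ℕ)
    (hn : 1 ≤ n) (hkn : k₀ ≤ n) (h : IsGaussianConvergent μ γ k₀) :
    sumLaw μ n ≤ gaussianReal 0 n + ENNReal.ofReal (γ / (n * √n)) • volume ∧
    gaussianReal 0 n ≤ sumLaw μ n + ENNReal.ofReal (γ / (n * √n)) • volume := by
  obtain ⟨f, hf, hb⟩ := h n hkn
  have hn0 : (0 : ℝ) < n := by exact_mod_cast hn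
  have hs : (0 : ℝ) < √n := Real.sqrt_pos.2 hn0
  have hφ : ∀ x, gaussianPDF 0 1 x = ENNReal.ofReal (Real.exp (-x ^ 2 / 2) / Real.sqrt (2 * Real.pi)) := by
    intro x
    rw [gaussianPDF_def, gaussianPDFReal_def]
    simp only [NNReal.coe_one, mul_one, sub_zero]
    congr 1; ring
  have hcst : volume.withDensity (fun _ : ℝ => ENNReal.ofReal (γ / n)) =
      ENNReal.ofReal (γ / n) • volume := withDensity_const _
  have h1 : volume.withDensity (fun x => ENNReal.ofReal (f x)) ≤
      gaussianReal 0 1 + ENNReal.ofReal (γ / n) • volume := by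
    rw [gaussianReal_of_var_ne_zero _ one_ne_zero, ← hcst, ← withDensity_add_right _ measurable_const]
    refine withDensity_mono (Filter.Eventually.of_forall fun x => ?_)
    simp only [Pi.add_apply, hφ]
    rw [← ENNReal.ofReal_add (by positivity) (by positivity)]
    refine ENNReal.ofReal_le_ofReal ?_
    linarith [(abs_le.1 (hb x)).2]
  have h2 : gaussianReal 0 1 ≤ volume.withDensity (fun x => ENNReal.ofReal (f x)) +
      ENNReal.ofReal (γ / n) • volume := by
    rw [gaussianReal_of_var_ne_zero _ one_ne_zero, ← hcst, ← withDensity_add_right _ measurable_const]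
    refine withDensity_mono (Filter.Eventually.of_forall fun x => ?_)
    simp only [Pi.add_apply, hφ]
    refine le_trans (ENNReal.ofReal_le_ofReal ?_) ENNReal.ofReal_add_le
    linarith [(abs_le.1 (hb x)).1]
  rw [← hf] at h1 h2
  have hm : Measurable (fun x : ℝ => √n * x) := by fun_prop
  have e1 : Measure.map (fun x : ℝ => √n * x) (Measure.map (fun y : Fin n → ℝ => (∑ i, y i) / Real.sqrt n)
        (Measure.pi fun _ : Fin n => μ)) = sumLaw μ n := by
    rw [Measure.map_map hm (by fun_prop), sumLaw]
    congr 1; ext y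
    simp only [Function.comp]
    field_simp
  have e2 : Measure.map (fun x : ℝ => √n * x) (gaussianReal 0 1) = gaussianReal 0 n := by
    rw [gaussianReal_map_const_mul]
    congr 1
    · simp
    · ext; simp
  have e3 : Measure.map (fun x : ℝ => √n * x) (ENNReal.ofReal (γ / n) • volume) =
      ENNReal.ofReal (γ / (n * √n)) • volume := by
    rw [Measure.map_smul, Real.map_volume_mul_left hs.ne', smul_smul,
      ← ENNReal.ofReal_mul (by positivity), abs_of_pos (by positivity)]
    congr 2; field_simp
  constructor
  · have := Measure.map_mono h1 hm
    rwa [Measure.map_add _ _ hm, e1, e2, e3] at this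
  · have := Measure.map_mono h2 hm
    rwa [Measure.map_add _ _ hm, e1, e2, e3] at this

lemma choose_step_up (a n r : ℕ) (h : a * (r + 1) ≤ n + 1) :
    a * n.choose r ≤ (n + 1).choose (r + 1) := by
  have h1 := Nat.add_one_mul_choose_eq n r
  have h2 : (r + 1) * (a * n.choose r) ≤ (r + 1) * (n + 1).choose (r + 1) := by
    calc (r + 1) * (a * n.choose r) = (a * (r + 1)) * n.choose r := by ring
      _ ≤ (n + 1) * n.choose r := Nat.mul_le_mul_right _ h
      _ = (n + 1).choose (r + 1) * (r + 1) := h1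
      _ = _ := by ring
  exact Nat.le_of_mul_le_mul_left h2 (Nat.succ_pos r)

lemma choose_up (a k i : ℕ) (ha : 1 ≤ a) (hi : i ≤ k) :
    a ^ i * (a * k - i).choose (k - i) ≤ (a * k).choose k := by
  induction i with
  | zero => simp
  | succ i ih =>
    refine le_trans ?_ (ih (by omega))
    obtain ⟨r, rfl⟩ : ∃ r, k = i + 1 + r := ⟨k - (i + 1), by omega⟩
    have hge : i + 1 + r ≤ a * (i + 1 + r) := Nat.le_mul_of_pos_left _ ha
    obtain ⟨n, hn⟩ : ∃ n, a * (i + 1 + r) = i + 1 + n := ⟨a * (i + 1 + r) - (i + 1), by omega⟩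
    rw [hn, show i + 1 + n - (i + 1) = n by omega, show i + 1 + r - (i + 1) = r by omega,
      show i + 1 + n - i = n + 1 by omega, show i + 1 + r - i = r + 1 by omega, pow_succ, mul_assoc]
    refine Nat.mul_le_mul_left _ (choose_step_up a n r ?_)
    have : i ≤ a * i := Nat.le_mul_of_pos_left _ ha
    have : a * (i + 1 + r) = a * i + a * (r + 1) := by ring
    omega

lemma choose_step_down (b n k : ℕ) (hk : k ≤ n + 1) (h : n + 1 ≤ (b + 1) * k) :
    (b + 1) * n.choose k ≤ b * (n + 1).choose k := by
  have h1 := Nat.choose_mul_succ_eq n k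
  obtain ⟨t, ht⟩ : ∃ t, n + 1 = k + t := ⟨n + 1 - k, by omega⟩
  have h2 : (n + 1) * ((b + 1) * n.choose k) ≤ (n + 1) * (b * (n + 1).choose k) := by
    calc (n + 1) * ((b + 1) * n.choose k) = (b + 1) * (n.choose k * (n + 1)) := by ring
      _ = (b + 1) * t * (n + 1).choose k := by
        rw [h1, show n + 1 - k = t by omega]; ring
      _ ≤ (b * (n + 1)) * (n + 1).choose k := by
        refine Nat.mul_le_mul_right _ ?_
        rw [ht] at h ⊢
        nlinarith
      _ = _ := by ring
  exact Nat.le_of_mul_le_mul_left h2 (Nat.succ_pos n)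

lemma choose_down (b k i : ℕ) (hi : i ≤ b * k) :
    (b + 1) ^ i * ((b + 1) * k - i).choose k ≤ b ^ i * ((b + 1) * k).choose k := by
  induction i with
  | zero => simp
  | succ i ih =>
    have h := ih (by omega)
    have e : (b + 1) * k = b * k + k := by ring
    obtain ⟨n, hn⟩ : ∃ n, (b + 1) * k = i + 1 + n := ⟨(b + 1) * k - (i + 1), by omega⟩
    rw [show (b + 1) * k - i = n + 1 by omega] at h
    rw [show (b + 1) * k - (i + 1) = n by omega]
    calc (b + 1) ^ (i + 1) * n.choose k = (b + 1) ^ i * ((b + 1) * n.choose k) := by ring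
      _ ≤ (b + 1) ^ i * (b * (n + 1).choose k) :=
        Nat.mul_le_mul_left _ (choose_step_down b n k (by omega) (by omega))
      _ = b * ((b + 1) ^ i * (n + 1).choose k) := by ring
      _ ≤ b * (b ^ i * ((b + 1) * k).choose k) := Nat.mul_le_mul_left _ h
      _ = _ := by ring

lemma count_sup {N : ℕ} (k : ℕ) (I : Finset (Fin N)) :
    ((Finset.univ.powersetCard k).filter (fun K' => I ⊆ K')).card ≤
      (N - I.card).choose (k - I.card) := by
  have h : ((Finset.univ \ I).powersetCard (k - I.card)).card
      = (N - I.card).choose (k - I.card) := by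
    rw [Finset.card_powersetCard, Finset.card_sdiff]; simp
  rw [← h]
  refine Finset.card_le_card_of_injOn (fun K' => K' \ I) ?_ ?_
  · intro K' hK'
    simp only [Finset.coe_filter, Finset.mem_powersetCard, Set.mem_ofPred_eq, Finset.subset_univ,
      true_and] at hK'
    simp only [Finset.mem_coe, Finset.mem_powersetCard]
    refine ⟨Finset.sdiff_subset_sdiff (Finset.subset_univ _) le_rfl, ?_⟩
    rw [Finset.card_sdiff, Finset.inter_eq_left.2 hK'.2, hK'.1]
  · intro A hA B hB hAB
    simp only [Finset.coe_filter, Finset.mem_powersetCard, Set.mem_ofPred_eq, Finset.subset_univ,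
      true_and] at hA hB
    rw [← Finset.sdiff_union_of_subset hA.2, ← Finset.sdiff_union_of_subset hB.2]
    simp only at hAB
    rw [hAB]

lemma count_disj {N : ℕ} (k : ℕ) (I : Finset (Fin N)) :
    ((Finset.univ.powersetCard k).filter (fun K' => Disjoint I K')).card ≤
      (N - I.card).choose k := by
  have h : ((Finset.univ \ I).powersetCard k).card = (N - I.card).choose k := by
    rw [Finset.card_powersetCard, Finset.card_sdiff]; simp
  rw [← h]
  refine Finset.card_le_card ?_
  intro K' hK'
  simp only [Finset.mem_filter, Finset.mem_powersetCard, Finset.subset_univ, true_and] at hK' ⊢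
  refine ⟨?_, hK'.1⟩
  intro x hx
  simp only [Finset.mem_sdiff, Finset.mem_univ, true_and]
  exact fun h => Finset.disjoint_left.1 hK'.2 h hx

lemma pow_card_expand {N : ℕ} (y : ℝ) (S : Finset (Fin N)) :
    (1 + y) ^ S.card = ∑ I ∈ S.powerset, y ^ I.card := by
  rw [add_comm, ← Finset.sum_pow_mul_eq_add_pow]; simp

lemma mgf_up (a k : ℕ) (ha : 1 ≤ a) (K : Finset (Fin (a * k))) (hK : K.card = k) (y : ℝ)
    (hy : 0 ≤ y) :
    ∑ K' ∈ Finset.univ.powersetCard k, (1 + y) ^ (K ∩ K').card ≤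
      ((a * k).choose k : ℝ) * (1 + y / a) ^ k := by
  have ha0 : (0 : ℝ) < a := by exact_mod_cast ha
  calc _ = ∑ K' ∈ Finset.univ.powersetCard k, ∑ I ∈ K.powerset,
        if I ⊆ K' then y ^ I.card else 0 := by
        refine Finset.sum_congr rfl (fun K' _ => ?_)
        rw [pow_card_expand, ← Finset.sum_filter]
        congr 1
        ext I; simp only [Finset.mem_powerset, Finset.mem_filter, Finset.subset_inter_iff]
    _ = ∑ I ∈ K.powerset, ((Finset.univ.powersetCard k).filter (fun K' => I ⊆ K')).card * y ^ I.card := by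
        rw [Finset.sum_comm]
        refine Finset.sum_congr rfl (fun I _ => ?_)
        rw [← Finset.sum_filter, Finset.sum_const, nsmul_eq_mul]
    _ ≤ ∑ I ∈ K.powerset, ((a * k).choose k : ℝ) * (y / a) ^ I.card := by
        refine Finset.sum_le_sum (fun I hI => ?_)
        have hIc : I.card ≤ k := (Finset.card_le_card (Finset.mem_powerset.1 hI)).trans hK.le
        have h1 := (Nat.mul_le_mul_left (a ^ I.card) (count_sup k I)).trans
          (choose_up a k I.card ha hIc)
        have h2 : (a : ℝ) ^ I.card * ((Finset.univ.powersetCard k).filter (fun K' => I ⊆ K')).card ≤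
          ((a * k).choose k : ℝ) := by exact_mod_cast h1
        rw [div_pow, mul_div_assoc', le_div_iff₀ (by positivity)]
        nlinarith [pow_nonneg hy I.card]
    _ = _ := by
        rw [← Finset.mul_sum, ← pow_card_expand, hK]

lemma mgf_down (a k : ℕ) (ha : 2 ≤ a) (K : Finset (Fin (a * k))) (hK : K.card = k) (y : ℝ)
    (hy : 0 ≤ y) :
    ∑ K' ∈ Finset.univ.powersetCard k, (1 + y) ^ (K \ K').card ≤
      ((a * k).choose k : ℝ) * (1 + y * (1 - 1 / a)) ^ k := by
  have ha0 : (0 : ℝ) < a := by positivity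
  obtain ⟨b, rfl⟩ : ∃ b, a = b + 1 := ⟨a - 1, by omega⟩
  calc _ = ∑ K' ∈ Finset.univ.powersetCard k, ∑ I ∈ K.powerset,
        if Disjoint I K' then y ^ I.card else 0 := by
        refine Finset.sum_congr rfl (fun K' _ => ?_)
        rw [pow_card_expand, ← Finset.sum_filter]
        congr 1
        ext I; simp [Finset.subset_sdiff]
    _ = ∑ I ∈ K.powerset, ((Finset.univ.powersetCard k).filter (fun K' => Disjoint I K')).card * y ^ I.card := by
        rw [Finset.sum_comm]
        refine Finset.sum_congr rfl (fun I _ => ?_)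
        rw [← Finset.sum_filter, Finset.sum_const, nsmul_eq_mul]
    _ ≤ ∑ I ∈ K.powerset, (((b + 1) * k).choose k : ℝ) * (y * (1 - 1 / ((b + 1 : ℕ) : ℝ))) ^ I.card := by
        refine Finset.sum_le_sum (fun I hI => ?_)
        have hIc : I.card ≤ k := (Finset.card_le_card (Finset.mem_powerset.1 hI)).trans hK.le
        have h1 := (Nat.mul_le_mul_left ((b + 1) ^ I.card) (count_disj k I)).trans
          (choose_down b k I.card (hIc.trans (Nat.le_mul_of_pos_left _ (by omega))))
        have h2 : ((b : ℝ) + 1) ^ I.card * ((Finset.univ.powersetCard k).filter (fun K' => Disjoint I K')).card ≤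
          (b : ℝ) ^ I.card * (((b + 1) * k).choose k : ℝ) := by exact_mod_cast h1
        have e : y * (1 - 1 / ((b + 1 : ℕ) : ℝ)) = y * b / (b + 1) := by
          push_cast; field_simp; ring
        rw [e, div_pow, mul_div_assoc', le_div_iff₀ (by positivity), mul_pow]
        nlinarith [mul_le_mul_of_nonneg_left h2 (pow_nonneg hy I.card)]
    _ = _ := by
        rw [← Finset.mul_sum, ← pow_card_expand, hK]

lemma tail_count (a k : ℕ) (ha : 2 ≤ a) (K : Finset (Fin (a * k))) (hK : K.card = k) :
    (((Finset.univ.powersetCard k).filter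
      (fun K' => 2 * a * (K ∩ K').card ≤ k ∨ 3 * k ≤ 2 * a * (K ∩ K').card)).card : ℝ)
      ≤ 2 * ((a * k).choose k : ℝ) * Real.exp (-(k / (10 * a))) := by
  have ha0 : (0 : ℝ) < a := by positivity
  set P := (Finset.univ : Finset (Fin (a * k))).powersetCard k with hP
  have hexp : Real.exp (2 / 5) ≤ 3 / 2 := by
    by_contra! hlt
    have h1 := pow_lt_pow_left₀ hlt (by norm_num) (n := 5) (by norm_num)
    rw [← Real.exp_nat_mul] at h1
    have h2 : Real.exp ((5 : ℕ) * (2 / 5)) = Real.exp 1 ^ 2 := by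
      rw [← Real.exp_nat_mul]; norm_num
    rw [h2] at h1
    have h3 := Real.exp_one_lt_d9
    have h4 := Real.exp_pos 1
    nlinarith
  have hexp2 : 2 ≤ Real.exp (7 / 10) := by
    rw [← Real.log_le_iff_le_exp (by norm_num)]
    linarith [Real.log_two_lt_d9]
  have up : ((P.filter (fun K' => 3 * k ≤ 2 * a * (K ∩ K').card)).card : ℝ) ≤
      ((a * k).choose k : ℝ) * Real.exp (-(k / (10 * a))) := by
    have h := mgf_up a k (by omega) K hK (1 / 2) (by norm_num)
    have h1 : (1 + 1 / 2 / (a : ℝ)) ^ k ≤ Real.exp (k / (2 * a)) := by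
      have := Real.add_one_le_exp (1 / 2 / (a : ℝ))
      calc _ ≤ Real.exp (1 / 2 / (a : ℝ)) ^ k := by gcongr; linarith
        _ = _ := by rw [← Real.exp_nat_mul]; congr 1; field_simp
    have h2 : ((P.filter (fun K' => 3 * k ≤ 2 * a * (K ∩ K').card)).card : ℝ) *
        Real.exp (3 / 5 * (k / a)) ≤ ∑ K' ∈ P, (1 + 1 / 2 : ℝ) ^ (K ∩ K').card := by
      rw [← nsmul_eq_mul, ← Finset.sum_const]
      refine le_trans (Finset.sum_le_sum (fun K' hK' => ?_))
        (Finset.sum_le_sum_of_subset_of_nonneg (Finset.filter_subset _ _)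
          (fun _ _ _ => by positivity))
      have h3 : 3 * (k : ℝ) ≤ 2 * a * (K ∩ K').card := by
        exact_mod_cast (Finset.mem_filter.1 hK').2
      calc Real.exp (3 / 5 * (k / a)) ≤ Real.exp ((K ∩ K').card * (2 / 5)) := by
            refine Real.exp_le_exp.2 ?_
            rw [mul_div_assoc', div_le_iff₀ ha0]
            linarith
        _ = Real.exp (2 / 5) ^ (K ∩ K').card := by rw [Real.exp_nat_mul]
        _ ≤ _ := by gcongr; linarith
    have h3 : ((a * k).choose k : ℝ) * Real.exp (-(k / (10 * a))) * Real.exp (3 / 5 * (k / a))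
        = ((a * k).choose k : ℝ) * Real.exp (k / (2 * a)) := by
      rw [mul_assoc, ← Real.exp_add]; congr 2; field_simp; ring
    refine le_of_mul_le_mul_right ?_ (Real.exp_pos (3 / 5 * (k / a)))
    rw [h3]
    refine h2.trans (h.trans ?_)
    gcongr
  have down : ((P.filter (fun K' => 2 * a * (K ∩ K').card ≤ k)).card : ℝ) ≤
      ((a * k).choose k : ℝ) * Real.exp (-(k / (10 * a))) := by
    have h := mgf_down a k ha K hK 1 (by norm_num)
    have h1 : (1 + 1 * (1 - 1 / (a : ℝ))) ^ k ≤ 2 ^ k * Real.exp (-(k / (2 * a))) := by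
      have := Real.add_one_le_exp (-(1 / (2 * (a : ℝ))))
      have hle : 1 / (a : ℝ) ≤ 1 := by
        rw [div_le_one ha0]; exact_mod_cast (by omega : 1 ≤ a)
      calc _ = 2 ^ k * (-(1 / (2 * (a : ℝ))) + 1) ^ k := by
            rw [← mul_pow]; congr 1; field_simp; ring
        _ ≤ 2 ^ k * Real.exp (-(1 / (2 * (a : ℝ)))) ^ k := by
            have : 0 ≤ -(1 / (2 * (a : ℝ))) + 1 := by
              have : 1 / (2 * (a : ℝ)) = 1 / a / 2 := by field_simp
              linarith
            gcongr
        _ = _ := by rw [← Real.exp_nat_mul]; congr 2; field_simp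
    have h2 : ((P.filter (fun K' => 2 * a * (K ∩ K').card ≤ k)).card : ℝ) *
        (2 ^ k * Real.exp (-(7 / 20 * (k / a)))) ≤ ∑ K' ∈ P, (1 + 1 : ℝ) ^ (K \ K').card := by
      rw [← nsmul_eq_mul, ← Finset.sum_const]
      refine le_trans (Finset.sum_le_sum (fun K' hK' => ?_))
        (Finset.sum_le_sum_of_subset_of_nonneg (Finset.filter_subset _ _)
          (fun _ _ _ => by positivity))
      have h3 : 2 * a * ((K ∩ K').card : ℝ) ≤ k := by
        exact_mod_cast (Finset.mem_filter.1 hK').2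
      have h4 : (K ∩ K').card + (K \ K').card = k := by
        exact (Finset.card_inter_add_card_sdiff K K').trans hK
      have h5 : (2 : ℝ) ^ (K ∩ K').card ≤ Real.exp (7 / 20 * (k / a)) := by
        calc (2 : ℝ) ^ (K ∩ K').card ≤ Real.exp (7 / 10) ^ (K ∩ K').card := by gcongr
          _ = Real.exp ((K ∩ K').card * (7 / 10)) := by rw [Real.exp_nat_mul]
          _ ≤ _ := by
            refine Real.exp_le_exp.2 ?_
            rw [mul_div_assoc' (7 / 20 : ℝ), le_div_iff₀ ha0]
            linarith
      rw [Real.exp_neg, ← div_eq_mul_inv, div_le_iff₀ (Real.exp_pos _)]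
      calc (2 : ℝ) ^ k = 2 ^ (K \ K').card * 2 ^ (K ∩ K').card := by
            rw [← pow_add, add_comm, h4]
        _ ≤ _ := by
          norm_num
          exact h5
    have h3 : ((a * k).choose k : ℝ) * Real.exp (-(k / (10 * a))) *
        (2 ^ k * Real.exp (-(7 / 20 * (k / a)))) =
        ((a * k).choose k : ℝ) * (2 ^ k * Real.exp (-(9 / 20 * (k / a)))) := by
      rw [mul_assoc, mul_left_comm (Real.exp _), ← Real.exp_add]; congr 3; field_simp; ring
    refine le_of_mul_le_mul_right ?_ (by positivity : 0 < 2 ^ k * Real.exp (-(7 / 20 * (k / a))))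
    rw [h3]
    refine h2.trans (h.trans ?_)
    gcongr
    refine h1.trans ?_
    gcongr
    have : (k : ℝ) / (2 * a) = 1 / 2 * (k / a) := by field_simp
    rw [this]
    have : (0 : ℝ) ≤ k / a := by positivity
    linarith
  rw [Finset.filter_or]
  have := Finset.card_union_le (P.filter (fun K' => 2 * a * (K ∩ K').card ≤ k))
    (P.filter (fun K' => 3 * k ≤ 2 * a * (K ∩ K').card))
  have h' : (((P.filter (fun K' => 2 * a * (K ∩ K').card ≤ k)) ∪
    (P.filter (fun K' => 3 * k ≤ 2 * a * (K ∩ K').card))).card : ℝ) ≤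
    ((P.filter (fun K' => 2 * a * (K ∩ K').card ≤ k)).card : ℝ) +
    ((P.filter (fun K' => 3 * k ≤ 2 * a * (K ∩ K').card)).card : ℝ) := by exact_mod_cast this
  linarith

lemma second_moment {Ω ι : Type*} [MeasurableSpace Ω] (P : Measure Ω) [IsProbabilityMeasure P]
    (S : Finset ι) (A : ι → Set Ω) (hA : ∀ i, MeasurableSet (A i)) (lam : ℝ) :
    2 * lam * (∑ i ∈ S, P.real (A i)) - lam ^ 2 * (∑ i ∈ S, ∑ j ∈ S, P.real (A i ∩ A j))
      ≤ P.real (⋃ i ∈ S, A i) := by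
  have hU : MeasurableSet (⋃ i ∈ S, A i) := S.measurableSet_biUnion (fun i _ => hA i)
  have hintg : ∀ B : Set Ω, MeasurableSet B → Integrable (B.indicator (fun _ => (1 : ℝ))) P :=
    fun B hB => (integrable_const 1).indicator hB
  have hI : ∀ B : Set Ω, MeasurableSet B → ∫ x, B.indicator (fun _ => (1 : ℝ)) x ∂P = P.real B := by
    intro B hB
    rw [integral_indicator_const _ hB]; simp
  have h1 : ∫ x, (2 * lam * (∑ i ∈ S, (A i).indicator (fun _ => (1 : ℝ)) x)
      - lam ^ 2 * (∑ i ∈ S, ∑ j ∈ S, (A i ∩ A j).indicator (fun _ => (1 : ℝ)) x)) ∂P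
      = 2 * lam * (∑ i ∈ S, P.real (A i)) - lam ^ 2 * (∑ i ∈ S, ∑ j ∈ S, P.real (A i ∩ A j)) := by
    rw [integral_sub, integral_const_mul, integral_const_mul, integral_finsetSum,
      integral_finsetSum]
    · congr 2
      · exact Finset.sum_congr rfl (fun i _ => hI _ (hA i))
      · refine Finset.sum_congr rfl (fun i _ => ?_)
        rw [integral_finsetSum _ (fun j _ => hintg _ ((hA i).inter (hA j)))]
        exact Finset.sum_congr rfl (fun j _ => hI _ ((hA i).inter (hA j)))
    · exact fun i _ => integrable_finsetSum _ (fun j _ => hintg _ ((hA i).inter (hA j)))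
    · exact fun i _ => hintg _ (hA i)
    · exact (integrable_finsetSum _ (fun i _ => hintg _ (hA i))).const_mul _
    · exact (integrable_finsetSum _ (fun i _ => integrable_finsetSum _
        (fun j _ => hintg _ ((hA i).inter (hA j))))).const_mul _
  rw [← h1, ← hI _ hU]
  refine integral_mono ?_ (hintg _ hU) ?_
  · exact ((integrable_finsetSum _ (fun i _ => hintg _ (hA i))).const_mul _).sub
      ((integrable_finsetSum _ (fun i _ => integrable_finsetSum _
        (fun j _ => hintg _ ((hA i).inter (hA j))))).const_mul _)
  · intro x
    simp only
    have h2 : ∑ i ∈ S, ∑ j ∈ S, (A i ∩ A j).indicator (fun _ => (1 : ℝ)) x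
      = (∑ i ∈ S, (A i).indicator (fun _ => (1 : ℝ)) x) ^ 2 := by
      rw [sq, Finset.sum_mul_sum]
      refine Finset.sum_congr rfl (fun i _ => Finset.sum_congr rfl (fun j _ => ?_))
      by_cases hi : x ∈ A i <;> by_cases hj : x ∈ A j <;> simp [hi, hj]
    rw [h2]
    by_cases hx : x ∈ ⋃ i ∈ S, A i
    · rw [Set.indicator_of_mem hx]
      nlinarith [sq_nonneg (lam * (∑ i ∈ S, (A i).indicator (fun _ => (1 : ℝ)) x) - 1)]
    · rw [Set.indicator_of_notMem hx]
      have h3 : ∑ i ∈ S, (A i).indicator (fun _ => (1 : ℝ)) x = 0 := by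
        refine Finset.sum_eq_zero (fun i hi => Set.indicator_of_notMem ?_ _)
        exact fun h => hx (Set.mem_biUnion hi h)
      rw [h3]; simp

/-- bound on `q` -/
lemma num_q (m k C : ℕ) (hm : 1 ≤ m) (r q : ℝ) (hr : 1 ≤ r) (hmr : (m : ℝ) = r ^ 4)
    (hk : 150000 * r ^ 7 ≤ (k : ℝ)) (hC : 2 ^ k ≤ C) (hq0 : 0 ≤ q) (hq : q ^ m * C = 1) :
    q ≤ 1 / (100 * m) := by
  by_contra! hlt
  have hm0 : (0 : ℝ) < m := by exact_mod_cast hm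
  have h1 := pow_lt_pow_left₀ hlt (by positivity) (n := m) (by omega)
  have h2 : (100 * (m : ℝ)) ≤ Real.exp (20 * r ^ 2) := by
    have h3 : 10 * r ^ 2 ≤ Real.exp (10 * r ^ 2) := by
      linarith [Real.add_one_le_exp (10 * r ^ 2)]
    calc 100 * (m : ℝ) = (10 * r ^ 2) ^ 2 := by rw [hmr]; ring
      _ ≤ Real.exp (10 * r ^ 2) ^ 2 := by gcongr
      _ = _ := by rw [← Real.exp_nat_mul]; congr 1; push_cast; ring
  have h3 : (100 * (m : ℝ)) ^ m ≤ Real.exp (k / 2) := by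
    calc _ ≤ Real.exp (20 * r ^ 2) ^ m := by gcongr
      _ = Real.exp (m * (20 * r ^ 2)) := by rw [Real.exp_nat_mul]
      _ ≤ _ := by
        refine Real.exp_le_exp.2 ?_
        rw [hmr]
        have : r ^ 6 ≤ r ^ 7 := pow_le_pow_right₀ hr (by norm_num)
        have : 0 < r ^ 6 := by positivity
        nlinarith
  have h4 : Real.exp ((k : ℝ) / 2) ≤ 2 ^ k := by
    have : Real.exp ((k : ℝ) / 2) ≤ Real.exp (k * Real.log 2) := by
      refine Real.exp_le_exp.2 ?_
      have := Real.log_two_gt_d9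
      have hk0 : (0 : ℝ) ≤ k := by positivity
      nlinarith
    rwa [Real.exp_nat_mul, Real.exp_log (by norm_num)] at this
  have h5 : (2 : ℝ) ^ k ≤ C := by exact_mod_cast hC
  have h6 : (1 / (100 * (m : ℝ))) ^ m * (100 * (m : ℝ)) ^ m = 1 := by
    rw [← mul_pow, one_div, inv_mul_cancel₀ (by positivity), one_pow]
  have h7 : (0 : ℝ) < (100 * (m : ℝ)) ^ m := by positivity
  have h8 : (0 : ℝ) ≤ (1 / (100 * (m : ℝ))) ^ m := by positivity
  nlinarith

lemma num_bad (m k a : ℕ) (r M : ℝ) (hr : 1 ≤ r) (hM : 0 < M) (hmr : (m : ℝ) = r ^ 4)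
    (hk : 150000 * r ^ 7 ≤ (k : ℝ)) (hk2 : 144 * r ^ 6 * (Real.log M + 3) ≤ k)
    (ha : (a : ℝ) ≤ 3 * r ^ 2) (ha0 : 0 < a) :
    2 * (√(2 * Real.pi * k) * M) ^ m * Real.exp (-(k / (10 * a))) ≤ 1 := by
  have hr0 : 0 < r := by linarith
  have hk0 : (0 : ℝ) < k := lt_of_lt_of_le (by positivity) hk
  have ha0' : (0 : ℝ) < a := by exact_mod_cast ha0
  obtain ⟨X, hX⟩ : ∃ X, X = (k : ℝ) / r ^ 6 := ⟨_, rfl⟩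
  have hkX : (k : ℝ) = X * r ^ 6 := by rw [hX]; field_simp
  have hXr : 150000 * r ≤ X := by
    rw [hX, le_div_iff₀ (by positivity)]; linarith [hk, show 150000 * r * r ^ 6 = 150000 * r ^ 7 by ring]
  have hX0 : 0 < X := by linarith
  have hpi : Real.log (2 * Real.pi) ≤ 2 := by
    rw [Real.log_le_iff_le_exp (by positivity)]
    have h1 := Real.pi_lt_d2
    have h2 : Real.exp 2 = Real.exp 1 ^ 2 := by rw [← Real.exp_nat_mul]; norm_num
    have h3 := Real.exp_one_gt_d9
    rw [h2]; nlinarith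
  have hlogX : Real.log X ≤ X / 1000 + 10 := by
    have h1 := Real.log_le_sub_one_of_pos (show 0 < X / 1000 by positivity)
    rw [Real.log_div (by positivity) (by norm_num)] at h1
    have h2 : Real.log 1000 ≤ 10 := by
      have : (1000 : ℝ) ≤ 2 ^ 10 := by norm_num
      have h3 := Real.log_le_log (by norm_num) this
      rw [Real.log_pow] at h3
      push_cast at h3
      linarith [Real.log_two_lt_d9]
    linarith
  have hlogr : Real.log r ≤ r := by linarith [Real.log_le_sub_one_of_pos hr0]
  have hlog : Real.log (2 * Real.pi * k) ≤ X / 100 := by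
    rw [hkX, Real.log_mul (x := 2 * Real.pi) (by positivity) (by positivity),
      Real.log_mul (x := X) (y := r ^ 6) hX0.ne' (by positivity), Real.log_pow]
    push_cast
    linarith
  have hsq : √(2 * Real.pi * k) ≤ Real.exp (X / 200) := by
    rw [Real.sqrt_le_left (Real.exp_pos _).le]
    rw [← Real.exp_nat_mul, ← Real.log_le_iff_le_exp (by positivity)]
    push_cast; linarith
  have hlM : Real.log M ≤ X / 144 := by
    have : 144 * (Real.log M + 3) ≤ X := by
      rw [hX, le_div_iff₀ (by positivity)]; linarith
    linarith
  have hM' : M ≤ Real.exp (X / 144) := by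
    rwa [← Real.log_le_iff_le_exp hM]
  have h2 : (2 : ℝ) ≤ Real.exp 1 := by linarith [Real.exp_one_gt_d9]
  calc _ ≤ Real.exp 1 * (Real.exp (X / 200) * Real.exp (X / 144)) ^ m *
        Real.exp (-(k / (10 * a))) := by gcongr
    _ = Real.exp (1 + m * (X / 200 + X / 144) - k / (10 * a)) := by
      rw [← Real.exp_add, ← Real.exp_nat_mul, ← Real.exp_add, ← Real.exp_add, sub_eq_add_neg]
    _ ≤ 1 := by
      rw [Real.exp_le_one_iff]
      have h3 : (k : ℝ) / (30 * r ^ 2) ≤ k / (10 * a) := by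
        refine div_le_div_of_nonneg_left hk0.le (by positivity) (by linarith)
      have h4 : (k : ℝ) / (30 * r ^ 2) = X * r ^ 4 / 30 := by rw [hkX]; field_simp
      rw [h4] at h3
      rw [hmr]
      have h5 : 1 ≤ r ^ 4 := one_le_pow₀ hr
      have h6 : 150000 ≤ X := by linarith
      nlinarith [mul_le_mul h5 h6 (by norm_num) (by positivity)]

lemma num_first (m k : ℕ) (hm : 1 ≤ m) (r γ θ q : ℝ) (hγ : 0 ≤ γ) (hθ : 0 < θ) (hr : 1 ≤ r)
    (hmr : (m : ℝ) = r ^ 4) (hk : 150000 * (γ + 1) * r ^ 7 ≤ (k : ℝ))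
    (hq : q = 2 * θ / √(2 * Real.pi * k)) (hqm : q ≤ 1 / (100 * m))
    (D : Fin m → ℝ) (hD : ∑ i, D i ^ 2 ≤ k) :
    (∀ i, 0 ≤ Real.exp (-(|D i| + θ) ^ 2 / (2 * k)) - √(2 * Real.pi) * γ / k) ∧
    1 / 2 ≤ ∏ i, (Real.exp (-(|D i| + θ) ^ 2 / (2 * k)) - √(2 * Real.pi) * γ / k) := by
  have hr0 : 0 < r := by linarith
  have hk0 : (0 : ℝ) < k := lt_of_lt_of_le (by positivity) hk
  have hm0 : (0 : ℝ) < m := by exact_mod_cast hm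
  have hm1 : (1 : ℝ) ≤ m := by exact_mod_cast hm
  have hpi := Real.pi_lt_d2
  have hpi3 := Real.pi_gt_three
  have hs0 : 0 < √(2 * Real.pi * k) := Real.sqrt_pos.2 (by positivity)
  -- θ bound
  have hθk : m * θ ^ 2 ≤ k / 1000 := by
    have h1 : 2 * θ = q * √(2 * Real.pi * k) := by rw [hq]; field_simp
    have h2 : 4 * θ ^ 2 = q ^ 2 * (2 * Real.pi * k) := by
      rw [← Real.sq_sqrt (show 0 ≤ 2 * Real.pi * (k : ℝ) by positivity), ← mul_pow, ← h1]; ring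
    have hq0 : 0 < q := by rw [hq]; positivity
    have h3 : m * q ≤ 1 / 100 := by
      calc m * q ≤ m * (1 / (100 * m)) := by gcongr
        _ = _ := by field_simp
    have h4 : m * q ^ 2 ≤ 1 / 10000 := by nlinarith
    have h5 : m * q ^ 2 * (2 * Real.pi * k) ≤ 1 / 10000 * (2 * Real.pi * k) := by gcongr
    nlinarith
  have hexp6 : Real.exp (3 / 5) ≤ 183 / 100 := by
    by_contra! hlt
    have h1 := pow_lt_pow_left₀ hlt (by norm_num) (n := 5) (by norm_num)
    rw [← Real.exp_nat_mul] at h1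
    have h2 : Real.exp ((5 : ℕ) * (3 / 5)) = Real.exp 1 ^ 3 := by
      rw [← Real.exp_nat_mul]; norm_num
    rw [h2] at h1
    have h3 : Real.exp 1 ^ 3 ≤ 2.7182818286 ^ 3 :=
      pow_le_pow_left₀ (Real.exp_pos 1).le Real.exp_one_lt_d9.le 3
    norm_num at h1 h3
    linarith
  set t : Fin m → ℝ := fun i => (|D i| + θ) ^ 2 / (2 * k) with ht
  have ht0 : ∀ i, 0 ≤ t i := fun i => by positivity
  have hsum : ∑ i, t i ≤ 3 / 5 := by
    have h1 : ∀ i, t i ≤ (11 / 10 * D i ^ 2 + 11 * θ ^ 2) / (2 * k) := by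
      intro i
      refine div_le_div_of_nonneg_right ?_ (by positivity)
      rw [← sq_abs (D i)]
      nlinarith [sq_nonneg (|D i| - 10 * θ)]
    calc _ ≤ ∑ i, (11 / 10 * D i ^ 2 + 11 * θ ^ 2) / (2 * k) := Finset.sum_le_sum (fun i _ => h1 i)
      _ = (11 / 10 * ∑ i, D i ^ 2 + 11 * (m * θ ^ 2)) / (2 * k) := by
        rw [← Finset.sum_div, Finset.sum_add_distrib, ← Finset.mul_sum]
        simp; ring
      _ ≤ _ := by
        rw [div_le_iff₀ (by positivity)]
        linarith
  have hε0 : 0 ≤ √(2 * Real.pi) * γ / k := by positivity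
  have hs3 : √(2 * Real.pi) ≤ 3 := by
    rw [Real.sqrt_le_left (by norm_num)]; linarith
  have hε : m * (√(2 * Real.pi) * γ / k) ≤ 1 / 10000 := by
    rw [mul_div_assoc', div_le_iff₀ hk0, hmr]
    have h1 : r ^ 4 ≤ r ^ 7 := pow_le_pow_right₀ hr (by norm_num)
    have h2 : γ * r ^ 4 ≤ (γ + 1) * r ^ 7 := by
      have : 0 ≤ r ^ 4 := by positivity
      nlinarith
    have h3 : √(2 * Real.pi) * (γ * r ^ 4) ≤ 3 * (γ * r ^ 4) := by gcongr
    nlinarith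
  set ε := √(2 * Real.pi) * γ / k with hεdef
  have hε1 : ε ≤ 1 / 10000 := by nlinarith
  have key : ∀ i, Real.exp (-(t i)) * (1 - 2 * ε) ≤
      Real.exp (-(|D i| + θ) ^ 2 / (2 * k)) - ε := by
    intro i
    have h1 : t i ≤ 3 / 5 := (Finset.single_le_sum (fun i _ => ht0 i) (Finset.mem_univ i)).trans hsum
    have h2 : Real.exp (t i) ≤ 2 := (Real.exp_le_exp.2 h1).trans (by linarith)
    have h3 : 1 ≤ 2 * Real.exp (-(t i)) := by
      have : Real.exp (t i) * Real.exp (-(t i)) = 1 := by rw [← Real.exp_add]; simp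
      nlinarith [Real.exp_pos (-(t i))]
    have h4 : -(|D i| + θ) ^ 2 / (2 * k) = -(t i) := by rw [ht]; ring
    rw [h4]
    nlinarith
  have hpos : ∀ i, 0 ≤ Real.exp (-(t i)) * (1 - 2 * ε) :=
    fun i => mul_nonneg (Real.exp_pos _).le (by linarith)
  refine ⟨fun i => (hpos i).trans (key i), ?_⟩
  refine le_trans ?_ (Finset.prod_le_prod (fun i _ => hpos i) (fun i _ => key i))
  rw [Finset.prod_mul_distrib, ← Real.exp_sum, Finset.prod_const, Finset.card_univ, Fintype.card_fin,
    Finset.sum_neg_distrib]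
  have b1 : 1 - 2 / 10000 ≤ (1 - 2 * ε) ^ m := by
    have := one_add_mul_le_pow (show -2 ≤ -(2 * ε) by linarith) m
    rw [← sub_eq_add_neg] at this
    linarith
  have b2 : 100 / 183 ≤ Real.exp (-∑ i, t i) := by
    have h1 : Real.exp (∑ i, t i) ≤ 183 / 100 := (Real.exp_le_exp.2 hsum).trans hexp6
    have : Real.exp (∑ i, t i) * Real.exp (-∑ i, t i) = 1 := by rw [← Real.exp_add]; simp
    nlinarith [Real.exp_pos (-∑ i, t i)]
  calc (1 : ℝ) / 2 ≤ 100 / 183 * (1 - 2 / 10000) := by norm_num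
    _ ≤ _ := by gcongr

lemma num_E (r γ k j l : ℝ) (hr : 1 ≤ r) (hγ : 0 ≤ γ) (hk : 150000 * (γ + 1) * r ^ 7 ≤ k)
    (hl : k / 4 ≤ l) (hj : k / (6 * r ^ 2) ≤ j) (hlk : l ≤ k) :
    k * √(2 * Real.pi) * (2 * (γ / (l * √l)) / √l) + 2 * Real.pi * k * (γ / (l * √l)) ^ 2
      + 2 * Real.pi * k * (γ / (j * √j)) * (1 / √(2 * Real.pi * l) + γ / (l * √l))
      ≤ 1 / (100 * r ^ 4) := by
  have hr0 : 0 < r := by linarith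
  have hk0 : (0 : ℝ) < k := lt_of_lt_of_le (by positivity) hk
  have hl0 : 0 < l := by linarith
  have hj0 : 0 < j := lt_of_lt_of_le (by positivity) hj
  have hpi1 := Real.pi_lt_d2
  have hpi0 := Real.pi_gt_three
  have hr7 : 1 ≤ r ^ 7 := one_le_pow₀ hr
  have hγk : 150000 * (γ + 1) ≤ k := le_trans (by nlinarith) hk
  set sk := √k with hsk
  have hsk0 : 0 < sk := Real.sqrt_pos.mpr hk0
  have hskk : sk * sk = k := Real.mul_self_sqrt hk0.le
  have hsl : sk / 2 ≤ √l := by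
    apply Real.le_sqrt_of_sq_le
    nlinarith
  have hsj : sk / (3 * r) ≤ √j := by
    apply Real.le_sqrt_of_sq_le
    refine le_trans ?_ hj
    rw [div_pow, div_le_div_iff₀ (by positivity) (by positivity)]
    have : sk ^ 2 = k := by rw [sq]; exact hskk
    rw [this]; nlinarith [mul_pos hk0 (pow_pos hr0 2)]
  have hs2 : √(2 * Real.pi) ≤ 3 := by
    rw [Real.sqrt_le_left (by norm_num)]; nlinarith
  have hs2l : 2 ≤ √(2 * Real.pi) := by
    apply Real.le_sqrt_of_sq_le; nlinarith
  obtain ⟨c, hc⟩ : ∃ c, c = γ / (l * √l) := ⟨_, rfl⟩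
  obtain ⟨d, hd⟩ : ∃ d, d = γ / (j * √j) := ⟨_, rfl⟩
  rw [← hc, ← hd]
  have hc0 : 0 ≤ c := by rw [hc]; positivity
  have hd0 : 0 ≤ d := by rw [hd]; positivity
  have hc1 : c ≤ 8 * γ / (k * sk) := by
    rw [hc]
    calc γ / (l * √l) ≤ γ / (k / 4 * (sk / 2)) := by gcongr
      _ = _ := by field_simp; try ring
  have hd1 : d ≤ 18 * r ^ 3 * γ / (k * sk) := by
    rw [hd]
    calc γ / (j * √j) ≤ γ / (k / (6 * r ^ 2) * (sk / (3 * r))) := by gcongr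
      _ = _ := by field_simp; try ring
  have hg : γ / k ≤ 1 := by rw [div_le_one hk0]; linarith
  have hg0 : 0 ≤ γ / k := by positivity
  have t1 : k * √(2 * Real.pi) * (2 * c / √l) ≤ 96 * (γ / k) := by
    calc k * √(2 * Real.pi) * (2 * c / √l) ≤ k * 3 * (2 * (8 * γ / (k * sk)) / (sk / 2)) := by gcongr
      _ = 96 * γ / (sk * sk) := by field_simp; try ring
      _ = _ := by rw [hskk]; ring
  have t2 : 2 * Real.pi * k * c ^ 2 ≤ 448 * (γ / k) := by
    calc 2 * Real.pi * k * c ^ 2 ≤ 7 * k * (8 * γ / (k * sk)) ^ 2 := by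
          gcongr; linarith
      _ = 448 * (γ * γ) / (k * (sk * sk)) := by field_simp; try ring
      _ = 448 * ((γ / k) * (γ / k)) := by rw [hskk]; field_simp
      _ ≤ 448 * (γ / k) := by nlinarith
  have t3 : 1 / √(2 * Real.pi * l) + c ≤ 2 / sk := by
    have h1 : 1 / √(2 * Real.pi * l) ≤ 1 / sk := by
      rw [Real.sqrt_mul (by positivity)]
      apply one_div_le_one_div_of_le hsk0
      nlinarith
    have h2 : 8 * γ / (k * sk) ≤ 1 / sk := by
      rw [div_le_div_iff₀ (by positivity) hsk0]
      nlinarith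
    have : 2 / sk = 1 / sk + 1 / sk := by ring
    linarith
  have t4 : 2 * Real.pi * k * d * (1 / √(2 * Real.pi * l) + c) ≤ 252 * r ^ 3 * (γ / k) := by
    calc _ ≤ 7 * k * (18 * r ^ 3 * γ / (k * sk)) * (2 / sk) := by
          gcongr; linarith
      _ = 252 * r ^ 3 * γ / (sk * sk) := by field_simp; try ring
      _ = _ := by rw [hskk]; ring
  have hr3 : 1 ≤ r ^ 3 := one_le_pow₀ hr
  have t5 : 1500 * r ^ 3 * (γ / k) ≤ 1 / (100 * r ^ 4) := by
    rw [mul_div_assoc', div_le_div_iff₀ hk0 (by positivity)]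
    nlinarith
  have t6 : γ / k ≤ r ^ 3 * (γ / k) := le_mul_of_one_le_left hg0 hr3
  linarith [mul_assoc 252 (r ^ 3) (γ / k), mul_assoc 1500 (r ^ 3) (γ / k)]

lemma exp_small_sq : Real.exp (1 / 100) ^ 2 ≤ 7 / 4 := by
  rw [← Real.exp_nat_mul]
  have h1 : Real.exp (((2 : ℕ) : ℝ) * (1 / 100)) ≤ Real.exp (1 / 2) := by
    apply Real.exp_le_exp.mpr; norm_num
  have h2 : Real.exp (1 / 2) ^ 2 = Real.exp 1 := by rw [← Real.exp_nat_mul]; norm_num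
  have h3 := Real.exp_one_lt_d9
  nlinarith [Real.exp_pos (1 / 2)]

set_option maxHeartbeats 1000000 in
lemma num_good (m : ℕ) (hm : 1 ≤ m) (r γ θ k j l : ℝ) (hr : 1 ≤ r) (hmr : (m : ℝ) = r ^ 4) (hγ : 0 ≤ γ)
    (hθ : 0 < θ)
    (hk : 150000 * (γ + 1) * r ^ 7 ≤ k)
    (hl : k / 4 ≤ l) (hj : k / (6 * r ^ 2) ≤ j) (hj2 : j ≤ 3 * k / (4 * r ^ 2)) (hlk : l = k - j) :
    (2*θ/√(4*Real.pi*l) * (2*θ/√(2*Real.pi*(l/2+j)))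
      + (2*(2*θ*(γ/(l*√l)))*(2*θ/√(2*Real.pi*l)) + (2*θ*(γ/(l*√l)))^2)
      + (γ/(j*√j))*((2*θ/√(2*Real.pi*l) + 2*θ*(γ/(l*√l)))*(2*θ))) ^ m
      ≤ 2 * ((2 * θ / √(2 * Real.pi * k)) ^ m) ^ 2 := by
  have hr0 : 0 < r := by linarith
  have hk0 : (0 : ℝ) < k := lt_of_lt_of_le (by positivity) hk
  have hl0 : 0 < l := by linarith
  have hj0 : 0 < j := lt_of_lt_of_le (by positivity) hj
  have hE := num_E r γ k j l hr hγ hk hl hj (by linarith)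
  have hpi := Real.pi_pos
  have hm0 : (0 : ℝ) < m := by exact_mod_cast hm
  set c := γ / (l * √l) with hc
  set d := γ / (j * √j) with hd
  have hc0 : 0 ≤ c := by positivity
  have hd0 : 0 ≤ d := by positivity
  set E := k * √(2 * Real.pi) * (2 * c / √l) + 2 * Real.pi * k * c ^ 2
      + 2 * Real.pi * k * d * (1 / √(2 * Real.pi * l) + c) with hEdef
  have hE0 : 0 ≤ E := by positivity
  have hkj : 0 < k ^ 2 - j ^ 2 := by nlinarith
  set A := k / √(k ^ 2 - j ^ 2) with hA
  have hA0 : 0 ≤ A := by positivity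
  have hA1 : 1 ≤ A := by
    rw [hA, one_le_div (Real.sqrt_pos.mpr hkj), Real.sqrt_le_left hk0.le]
    nlinarith
  set q := 2 * θ / √(2 * Real.pi * k) with hq
  have hq2 : q ^ 2 * (2 * Real.pi * k) = (2 * θ) ^ 2 := by
    rw [hq, div_pow, Real.sq_sqrt (by positivity)]; field_simp
  have hs : √(4 * Real.pi * l) * √(2 * Real.pi * (l / 2 + j)) = 2 * Real.pi * √(k ^ 2 - j ^ 2) := by
    rw [← Real.sqrt_mul (by positivity)]
    rw [show 4 * Real.pi * l * (2 * Real.pi * (l / 2 + j)) = (2 * Real.pi) ^ 2 * (k ^ 2 - j ^ 2) by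
      rw [hlk]; ring]
    rw [Real.sqrt_mul (by positivity), Real.sqrt_sq (by positivity)]
  have hB : (2*θ/√(4*Real.pi*l) * (2*θ/√(2*Real.pi*(l/2+j)))
      + (2*(2*θ*c)*(2*θ/√(2*Real.pi*l)) + (2*θ*c)^2)
      + d*((2*θ/√(2*Real.pi*l) + 2*θ*c)*(2*θ))) = q ^ 2 * (A + E) := by
    have e1 : 2*θ/√(4*Real.pi*l) * (2*θ/√(2*Real.pi*(l/2+j))) = q ^ 2 * A := by
      rw [div_mul_div_comm, hs, hA, ← sq, ← hq2]
      field_simp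
    have hsp : √(2 * Real.pi * l) = √(2 * Real.pi) * √l := Real.sqrt_mul (by positivity) _
    have h2p : √(2 * Real.pi) ^ 2 = 2 * Real.pi := Real.sq_sqrt (by positivity)
    have hp0 : 0 < √(2 * Real.pi) := Real.sqrt_pos.mpr (by positivity)
    have hsl0 : 0 < √l := Real.sqrt_pos.mpr hl0
    rw [e1, mul_add, add_assoc]
    congr 1
    calc _ = (2 * θ) ^ 2 * (2 * c / √(2 * Real.pi * l) + c ^ 2 + d * (1 / √(2 * Real.pi * l) + c)) := by
          ring
      _ = q ^ 2 * (2 * Real.pi * k * (2 * c / √(2 * Real.pi * l)) + 2 * Real.pi * k * c ^ 2 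
            + 2 * Real.pi * k * d * (1 / √(2 * Real.pi * l) + c)) := by rw [← hq2]; ring
      _ = q ^ 2 * E := by
          rw [hEdef]
          congr 3
          rw [hsp]
          nth_rewrite 1 [← h2p]
          field_simp
  rw [hB, mul_pow, ← pow_mul, ← pow_mul, mul_comm 2 m, mul_comm]
  apply mul_le_mul_of_nonneg_right _ (by positivity)
  refine le_trans (le_abs_self _) (abs_le_of_sq_le_sq ?_ (by norm_num))
  have hAE : A + E ≤ A * (1 + 1 / (100 * m)) := by
    have h1 : E ≤ 1 / (100 * (m : ℝ)) := by rw [hmr]; exact hE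
    have h2 : (0 : ℝ) ≤ 1 / (100 * (m : ℝ)) := by positivity
    nlinarith
  have hA2 : A ^ 2 * (1 - j ^ 2 / k ^ 2) = 1 := by
    rw [hA, div_pow, Real.sq_sqrt hkj.le]; field_simp
  have hρ : j ^ 2 / k ^ 2 ≤ 9 / (16 * m) := by
    rw [div_le_div_iff₀ (by positivity) (by positivity), hmr]
    rw [le_div_iff₀ (by positivity)] at hj2
    have : (j * (4 * r ^ 2)) ^ 2 ≤ (3 * k) ^ 2 := by gcongr
    linarith [show (j * (4 * r ^ 2)) ^ 2 = j ^ 2 * (16 * r ^ 4) by ring]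
  have hρ1 : j ^ 2 / k ^ 2 ≤ 1 := by
    rw [div_le_one (by positivity)]; linarith
  have hbern : 7 / 16 ≤ (1 - j ^ 2 / k ^ 2) ^ m := by
    have h := one_add_mul_le_pow (show (-2 : ℝ) ≤ -(j ^ 2 / k ^ 2) by linarith) m
    have h2 : (m : ℝ) * (j ^ 2 / k ^ 2) ≤ 9 / 16 := by
      calc (m : ℝ) * (j ^ 2 / k ^ 2) ≤ m * (9 / (16 * m)) := by gcongr
        _ = 9 / 16 := by field_simp
    rw [← sub_eq_add_neg] at h
    linarith
  have hAm : (A ^ m) ^ 2 * (7 / 16) ≤ 1 := by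
    calc (A ^ m) ^ 2 * (7 / 16) ≤ (A ^ m) ^ 2 * (1 - j ^ 2 / k ^ 2) ^ m := by gcongr
      _ = (A ^ 2 * (1 - j ^ 2 / k ^ 2)) ^ m := by rw [mul_pow, ← pow_mul, ← pow_mul, mul_comm m 2]
      _ = 1 := by rw [hA2, one_pow]
  have hexp : (1 + 1 / (100 * (m : ℝ))) ^ m ≤ Real.exp (1 / 100) := by
    calc (1 + 1 / (100 * (m : ℝ))) ^ m ≤ (Real.exp (1 / (100 * m))) ^ m := by
          gcongr
          linarith [Real.add_one_le_exp (1 / (100 * (m : ℝ)))]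
      _ = Real.exp (1 / 100) := by
          rw [← Real.exp_nat_mul]; congr 1; field_simp
  have hexp2 := exp_small_sq
  calc ((A + E) ^ m) ^ 2 ≤ ((A * (1 + 1 / (100 * m))) ^ m) ^ 2 := by gcongr
    _ = (A ^ m) ^ 2 * ((1 + 1 / (100 * (m : ℝ))) ^ m) ^ 2 := by rw [mul_pow, mul_pow]
    _ ≤ (16 / 7) * (Real.exp (1 / 100)) ^ 2 := by
        gcongr; linarith
    _ ≤ 2 ^ 2 := by linarith

lemma single_lb (μ : Measure ℝ) [IsProbabilityMeasure μ] (γ : ℝ) (hγ : 0 ≤ γ) (k₀ k : ℕ)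
    (hk : 1 ≤ k) (hkk : k₀ ≤ k) (h : IsGaussianConvergent μ γ k₀) (D θ : ℝ) (hθ : 0 < θ) :
    ENNReal.ofReal (2 * θ / √(2 * Real.pi * k) *
      (Real.exp (-(|D| + θ) ^ 2 / (2 * k)) - √(2 * Real.pi) * γ / k))
      ≤ sumLaw μ k (Metric.closedBall D θ) := by
  have hk0 : (0 : ℝ) < k := by exact_mod_cast hk
  have h1 := gauss_ball_ge (k : NNReal) (by positivity) D θ hθ.le
  have h2 := (sumLaw_close μ γ hγ k₀ k hk hkk h).2 (Metric.closedBall D θ)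
  simp only [Measure.add_apply, Measure.smul_apply, Real.volume_closedBall, smul_eq_mul,
    NNReal.coe_natCast] at h1 h2
  rw [← ENNReal.ofReal_mul (by positivity)] at h2
  have h3 := h1.trans h2
  rw [← tsub_le_iff_right, ← ENNReal.ofReal_sub _ (by positivity)] at h3
  refine le_trans (le_of_eq ?_) h3
  congr 1
  rw [mul_sub]
  congr 1
  rw [Real.sqrt_mul (by positivity)]
  have : 0 < √(2 * Real.pi) := Real.sqrt_pos.mpr (by positivity)
  field_simp

lemma pair_good (m : ℕ) (hm : 1 ≤ m) (μ : Fin m → Measure ℝ) [∀ i, IsProbabilityMeasure (μ i)]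
    (r γ θ : ℝ) (k₀ k N : ℕ) (hr : 1 ≤ r) (hmr : (m : ℝ) = r ^ 4) (hγ : 0 ≤ γ) (hθ : 0 < θ)
    (hk : 150000 * (γ + 1) * r ^ 7 ≤ (k : ℝ)) (h : ∀ i, IsGaussianConvergent (μ i) γ k₀)
    (K K' : Finset (Fin N)) (hK : K.card = k) (hK' : K'.card = k) (D : Fin m → ℝ)
    (hl : (k : ℝ) / 4 ≤ (k : ℝ) - (K ∩ K').card)
    (hj : (k : ℝ) / (6 * r ^ 2) ≤ (K ∩ K').card)
    (hj2 : ((K ∩ K').card : ℝ) ≤ 3 * k / (4 * r ^ 2))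
    (hk₀j : k₀ ≤ (K ∩ K').card) (hk₀l : k₀ ≤ k - (K ∩ K').card) :
    ∏ i, (Measure.pi fun _ : Fin N => μ i)
      ({y | |(∑ j ∈ K, y j) - D i| ≤ θ} ∩ {y | |(∑ j ∈ K', y j) - D i| ≤ θ})
      ≤ ENNReal.ofReal (2 * ((2 * θ / √(2 * Real.pi * k)) ^ m) ^ 2) := by
  have hr0 : 0 < r := by linarith
  have hk0 : (0 : ℝ) < k := lt_of_lt_of_le (by positivity) hk
  set j := (K ∩ K').card with hjdef
  have hj0 : (0 : ℝ) < j := lt_of_lt_of_le (by positivity) hj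
  have hj1 : 1 ≤ j := by exact_mod_cast hj0
  have hjk : j ≤ k := hK ▸ Finset.card_le_card Finset.inter_subset_left
  have hlc : ((k - j : ℕ) : ℝ) = (k : ℝ) - j := by push_cast [hjk]; ring
  have hl0 : (0 : ℝ) < ((k - j : ℕ) : ℝ) := by rw [hlc]; linarith
  have hl1 : 1 ≤ k - j := by exact_mod_cast hl0
  have hnum := num_good m hm r γ θ k j ((k - j : ℕ) : ℝ) hr hmr hγ hθ hk (by rw [hlc]; exact hl) hj hj2 hlc
  refine le_trans ?_ (ENNReal.ofReal_le_ofReal hnum)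
  rw [ENNReal.ofReal_pow (by positivity)]
  calc _ ≤ ∏ _i : Fin m, _ := Finset.prod_le_prod' (fun i _ => ?_)
    _ = _ := by rw [Finset.prod_const, Finset.card_univ, Fintype.card_fin]
  rw [joint_two (μ i) K K' (D i) θ (by rw [hK, hK']), hK, ← hjdef]
  have hb := joint_bound (sumLaw (μ i) (k - j)) (sumLaw (μ i) j) ((k - j : ℕ) : NNReal) (j : NNReal)
    (by exact_mod_cast hl0.ne') _ _ (D i) θ hθ.le (by positivity) (by positivity)
    (sumLaw_close (μ i) γ hγ k₀ (k - j) hl1 hk₀l (h i)).1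
    (sumLaw_close (μ i) γ hγ k₀ j hj1 hk₀j (h i)).1
  simpa only [NNReal.coe_natCast] using hb

lemma pair_bad (m N : ℕ) (μ : Fin m → Measure ℝ) [∀ i, IsProbabilityMeasure (μ i)]
    (M θ : ℝ) (hM : 0 < M) (h : ∀ i, HasMaxDensityLE (μ i) M) (K K' : Finset (Fin N))
    (hc : K.card = K'.card) (hne : K ≠ K') (D : Fin m → ℝ) :
    ∏ i, (Measure.pi fun _ : Fin N => μ i)
      ({y | |(∑ j ∈ K, y j) - D i| ≤ θ} ∩ {y | |(∑ j ∈ K', y j) - D i| ≤ θ})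
      ≤ (∏ i, (Measure.pi fun _ : Fin N => μ i) {y | |(∑ j ∈ K, y j) - D i| ≤ θ})
        * (ENNReal.ofReal (2 * θ * M)) ^ m := by
  obtain ⟨e, he, he'⟩ : ∃ e ∈ K', e ∉ K := by
    by_contra! hcon
    exact hne (Finset.eq_of_subset_of_card_le hcon hc.le).symm
  calc _ ≤ ∏ i, ((Measure.pi fun _ : Fin N => μ i) {y | |(∑ j ∈ K, y j) - D i| ≤ θ}
        * ENNReal.ofReal (2 * θ * M)) :=
        Finset.prod_le_prod' (fun i _ => joint_crude (μ i) K K' (D i) θ _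
          (fun x => density_ball_le (μ i) M (h i) x θ hM) e he he')
    _ = _ := by rw [Finset.prod_mul_distrib, Finset.prod_const, Finset.card_univ, Fintype.card_fin]

/-- the purely abstract second moment conclusion -/
lemma moment_concl {Ω ι : Type*} [MeasurableSpace Ω] [DecidableEq ι] (P : Measure Ω) [IsProbabilityMeasure P]
    (S : Finset ι) (A : ι → Set Ω) (hA : ∀ i, MeasurableSet (A i)) (bad : ι → ι → Prop)
    [∀ i, DecidablePred (bad i)] (Q T : ℝ) (B : ℝ) (hQ : 0 ≤ Q) (hQS : Q * S.card = 1) (hT : 0 ≤ T)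
    (h1 : 1 / 2 ≤ ∑ i ∈ S, P.real (A i))
    (hgood : ∀ i ∈ S, ∀ j ∈ S, i ≠ j → ¬ bad i j → P.real (A i ∩ A j) ≤ 2 * Q ^ 2)
    (hbad : ∀ i ∈ S, ∀ j ∈ S, i ≠ j → bad i j → P.real (A i ∩ A j) ≤ P.real (A i) * T)
    (hcount : ∀ i ∈ S, ((S.filter (bad i)).card : ℝ) ≤ B) (hBT : B * T ≤ 1) :
    1 / 25 ≤ P.real (⋃ i ∈ S, A i) := by
  set e := ∑ i ∈ S, P.real (A i) with he
  have h2 : ∑ i ∈ S, ∑ j ∈ S, P.real (A i ∩ A j) ≤ 2 * e + 2 := by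
    have hrow : ∀ i ∈ S, ∑ j ∈ S, P.real (A i ∩ A j) ≤ 2 * P.real (A i) + 2 * Q := by
      intro i hi
      have hpt : ∀ j ∈ S, P.real (A i ∩ A j) ≤
          (if j = i then P.real (A i) else 0) + (if bad i j then P.real (A i) * T else 0)
            + 2 * Q ^ 2 := by
        intro j hj
        have hp : 0 ≤ P.real (A i) := measureReal_nonneg
        have hpT : 0 ≤ P.real (A i) * T := mul_nonneg hp hT
        have hq2 : 0 ≤ 2 * Q ^ 2 := by positivity
        by_cases hij : j = i
        · subst hij
          rw [Set.inter_self]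
          split_ifs <;> first | linarith | (exfalso; tauto)
        · rw [if_neg hij]
          by_cases hb : bad i j
          · rw [if_pos hb]; linarith [hbad i hi j hj (Ne.symm hij) hb]
          · rw [if_neg hb]; linarith [hgood i hi j hj (Ne.symm hij) hb]
      refine (Finset.sum_le_sum hpt).trans ?_
      rw [Finset.sum_add_distrib, Finset.sum_add_distrib, Finset.sum_ite_eq' S i, if_pos hi,
        ← Finset.sum_filter, Finset.sum_const, Finset.sum_const, nsmul_eq_mul, nsmul_eq_mul]
      have hp : 0 ≤ P.real (A i) := measureReal_nonneg
      have hc : ((S.filter (bad i)).card : ℝ) * (P.real (A i) * T) ≤ P.real (A i) := by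
        calc _ ≤ B * (P.real (A i) * T) := by
              apply mul_le_mul_of_nonneg_right (hcount i hi) (by positivity)
          _ = P.real (A i) * (B * T) := by ring
          _ ≤ P.real (A i) * 1 := by gcongr
          _ = _ := mul_one _
      have hq : (S.card : ℝ) * (2 * Q ^ 2) = 2 * Q := by
        calc _ = 2 * Q * (Q * S.card) := by ring
          _ = _ := by rw [hQS, mul_one]
      linarith
    refine (Finset.sum_le_sum hrow).trans (le_of_eq ?_)
    rw [Finset.sum_add_distrib, ← Finset.mul_sum, Finset.sum_const, nsmul_eq_mul]
    linear_combination 2 * hQS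
  have hsm := second_moment P S A hA (e / (2 * e + 2))
  rw [← he] at hsm
  have he0 : 0 < 2 * e + 2 := by linarith
  have h3 : (e / (2 * e + 2)) ^ 2 * (∑ i ∈ S, ∑ j ∈ S, P.real (A i ∩ A j))
      ≤ (e / (2 * e + 2)) ^ 2 * (2 * e + 2) := by gcongr
  have h4 : 2 * (e / (2 * e + 2)) * e - (e / (2 * e + 2)) ^ 2 * (2 * e + 2) = e ^ 2 / (2 * e + 2) := by
    field_simp; ring
  have h5 : 1 / 25 ≤ e ^ 2 / (2 * e + 2) := by
    rw [div_le_div_iff₀ (by norm_num) he0]; nlinarith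
  linarith

set_option maxHeartbeats 1000000 in
/-- improved discrepancy lemma: with `a = ⌈2√m⌉` and `θ > 0` calibrated so
that `(2θ/√(2πk))^m · C(ak,k) = 1`, for i.i.d. random vectors `Y₁, …, Y_{ak} ∈ ℝ^m` whose
coordinates are independent `(γ,k₀)`-Gaussian convergent variables with maximum density at
most `M`, if `k ≥ max{(4√m+2)k₀, 144 m^{3/2}(log M + 3), 150000(γ+1)m^{7/4}}` then for any
`D` with `‖D‖₂ ≤ √k`, with probability at least `1/25` some `k`-subset `K` of the vectors has
`‖(Σ_{j∈K} Y_j) − D‖_∞ ≤ θ`. -/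
theorem stmt_1 (k m k₀ : ℕ) (hm : 1 ≤ m) (hk : 1 ≤ k) (γ M θ : ℝ) (hγ : 0 ≤ γ) (hM : 0 < M)
    (hθpos : 0 < θ) (a : ℕ) (ha : a = ⌈2 * Real.sqrt m⌉₊)
    (hθ : (2 * θ / Real.sqrt (2 * Real.pi * k)) ^ m * ((a * k).choose k : ℝ) = 1)
    (μ : Fin m → Measure ℝ) [hprob : ∀ i, IsProbabilityMeasure (μ i)]
    (hconv : ∀ i, IsGaussianConvergent (μ i) γ k₀)
    (hdens : ∀ i, HasMaxDensityLE (μ i) M)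
    (hk1 : (4 * Real.sqrt m + 2) * k₀ ≤ (k : ℝ))
    (hk2 : 144 * (m : ℝ) ^ ((3 : ℝ) / 2) * (Real.log M + 3) ≤ (k : ℝ))
    (hk3 : 150000 * (γ + 1) * (m : ℝ) ^ ((7 : ℝ) / 4) ≤ (k : ℝ))
    (D : Fin m → ℝ) (hD : Real.sqrt (∑ i, D i ^ 2) ≤ Real.sqrt k) :
    (Measure.pi fun _ : Fin (a * k) => Measure.pi fun i : Fin m => μ i)
      {Y | ∃ K : Finset (Fin (a * k)), K.card = k ∧
        ∀ i : Fin m, |(∑ j ∈ K, Y j i) - D i| ≤ θ}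
      ≥ ENNReal.ofReal (1 / 25) := by
  obtain ⟨r, hrdef⟩ : ∃ r : ℝ, r = (m : ℝ) ^ ((1 : ℝ) / 4) := ⟨_, rfl⟩
  have hm0 : (0 : ℝ) ≤ m := by positivity
  have hm1 : (1 : ℝ) ≤ m := by exact_mod_cast hm
  have hr : 1 ≤ r := by rw [hrdef]; exact Real.one_le_rpow hm1 (by norm_num)
  have hr0 : 0 < r := by linarith
  have hrp : ∀ n : ℕ, r ^ n = (m : ℝ) ^ ((n : ℝ) / 4) := by
    intro n
    rw [hrdef, ← Real.rpow_natCast, ← Real.rpow_mul hm0]; congr 1; ring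
  have hmr : (m : ℝ) = r ^ 4 := by rw [hrp 4]; norm_num
  have hsm : √(m : ℝ) = r ^ 2 := by
    rw [hmr, show r ^ 4 = (r ^ 2) ^ 2 by ring, Real.sqrt_sq (by positivity)]
  have h32 : (m : ℝ) ^ ((3 : ℝ) / 2) = r ^ 6 := by rw [hrp 6]; norm_num
  have h74 : (m : ℝ) ^ ((7 : ℝ) / 4) = r ^ 7 := by rw [hrp 7]; norm_num
  rw [h32] at hk2
  rw [h74] at hk3
  rw [hsm] at hk1 ha
  have hr2 : 1 ≤ r ^ 2 := one_le_pow₀ hr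
  have ha1 : 2 * r ^ 2 ≤ (a : ℝ) := by rw [ha]; exact Nat.le_ceil _
  have ha2 : (a : ℝ) < 2 * r ^ 2 + 1 := by rw [ha]; exact Nat.ceil_lt_add_one (by positivity)
  have ha3 : (a : ℝ) ≤ 3 * r ^ 2 := by linarith
  have ha4 : 2 ≤ a := by
    have : (2 : ℝ) ≤ a := by linarith
    exact_mod_cast this
  have hk0 : (0 : ℝ) < k := by exact_mod_cast hk
  have hkr : 150000 * r ^ 7 ≤ (k : ℝ) := by
    refine le_trans ?_ hk3
    have : 0 ≤ γ * r ^ 7 := by positivity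
    linarith
  have hk₀ : 2 * a * k₀ ≤ k := by
    have h0 : (0 : ℝ) ≤ k₀ := by positivity
    have : (2 * a * k₀ : ℝ) ≤ k := by
      refine le_trans ?_ hk1
      gcongr; linarith
    exact_mod_cast this
  have hk₀k : k₀ ≤ k := by nlinarith
  obtain ⟨q, hq⟩ : ∃ q, q = 2 * θ / √(2 * Real.pi * k) := ⟨_, rfl⟩
  have hs0 : 0 < √(2 * Real.pi * k) := Real.sqrt_pos.mpr (by positivity)
  have hq0 : 0 < q := by rw [hq]; positivity
  rw [← hq] at hθ
  have hCk : 2 ^ k ≤ (a * k).choose k := by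
    have h1 := choose_up a k k (by omega) le_rfl
    simp only [Nat.sub_self, Nat.choose_zero_right, mul_one] at h1
    exact le_trans (Nat.pow_le_pow_left ha4 k) h1
  have hqm := num_q m k _ hm r q hr hmr hkr hCk hq0.le hθ
  have hD2 : ∑ i, D i ^ 2 ≤ (k : ℝ) := (Real.sqrt_le_sqrt_iff hk0.le).1 hD
  obtain ⟨hf0, hf⟩ := num_first m k hm r γ θ q hγ hθpos hr hmr hk3 hq hqm D hD2
  have hbadnum := num_bad m k a r M hr hM hmr hkr hk2 ha3 (by omega)
  set P := (Measure.pi fun _ : Fin (a * k) => Measure.pi fun i : Fin m => μ i) with hP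
  let E : Finset (Fin (a * k)) → Fin m → Set (Fin (a * k) → ℝ) :=
    fun K i => {y | |(∑ j ∈ K, y j) - D i| ≤ θ}
  have hEm : ∀ K i, MeasurableSet (E K i) := by
    intro K i
    have : Measurable fun y : Fin (a * k) → ℝ => |(∑ j ∈ K, y j) - D i| := by fun_prop
    exact measurableSet_le this measurable_const
  let A : Finset (Fin (a * k)) → Set (Fin (a * k) → Fin m → ℝ) :=
    fun K => {Y | ∀ i, (fun j => Y j i) ∈ E K i}
  have hAm : ∀ K, MeasurableSet (A K) := by
    intro K
    have : A K = ⋂ i, (fun (Y : Fin (a * k) → Fin m → ℝ) j => Y j i) ⁻¹' (E K i) := by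
      ext Y; simp [A]
    rw [this]
    refine MeasurableSet.iInter (fun i => ?_)
    exact (measurable_pi_lambda _ fun j => by fun_prop) (hEm K i)
  have hPA : ∀ K, P (A K) = ∏ i, (Measure.pi fun _ : Fin (a * k) => μ i) (E K i) :=
    fun K => prob_prod μ (E K) (hEm K)
  have hPAA : ∀ K K', P (A K ∩ A K') =
      ∏ i, (Measure.pi fun _ : Fin (a * k) => μ i) (E K i ∩ E K' i) := by
    intro K K'
    rw [← prob_prod μ (fun i => E K i ∩ E K' i) (fun i => (hEm K i).inter (hEm K' i))]
    congr 1
    ext Y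
    simp only [A, Set.mem_inter_iff, Set.mem_ofPred_eq]
    exact forall_and.symm
  set S := (Finset.univ : Finset (Fin (a * k))).powersetCard k with hS
  have hcard : ∀ K ∈ S, K.card = k := fun K hK => (Finset.mem_powersetCard.1 hK).2
  have hScard : S.card = (a * k).choose k := by
    rw [hS, Finset.card_powersetCard, Finset.card_univ, Fintype.card_fin]
  have hlow : ∀ K ∈ S, q ^ m * (1 / 2) ≤ P.real (A K) := by
    intro K hK
    have h1 : ENNReal.ofReal (q ^ m * (1 / 2)) ≤ P (A K) := by
      rw [hPA]
      calc _ ≤ ENNReal.ofReal (∏ i, (q * (Real.exp (-(|D i| + θ) ^ 2 / (2 * k))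
            - √(2 * Real.pi) * γ / k))) := by
            apply ENNReal.ofReal_le_ofReal
            rw [Finset.prod_mul_distrib, Finset.prod_const, Finset.card_univ, Fintype.card_fin]
            gcongr
        _ = ∏ i, ENNReal.ofReal (q * (Real.exp (-(|D i| + θ) ^ 2 / (2 * k))
            - √(2 * Real.pi) * γ / k)) :=
            ENNReal.ofReal_prod_of_nonneg (fun i _ => mul_nonneg hq0.le (hf0 i))
        _ ≤ _ := by
            refine Finset.prod_le_prod' (fun i _ => ?_)
            have h2 := single_lb (μ i) γ hγ k₀ k hk hk₀k (hconv i) (D i) θ hθpos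
            rw [hq]
            have h3 := single_law (μ i) K (D i) θ
            rw [hcard K hK] at h3
            exact h2.trans h3.ge
    exact (ENNReal.ofReal_le_iff_le_toReal (measure_ne_top _ _)).1 h1
  have hmain : 1 / 25 ≤ P.real (⋃ K ∈ S, A K) := by
    refine moment_concl P S A hAm
      (fun K K' => 2 * a * (K ∩ K').card ≤ k ∨ 3 * k ≤ 2 * a * (K ∩ K').card)
      (q ^ m) ((2 * θ * M) ^ m) (2 * ((a * k).choose k : ℝ) * Real.exp (-(k / (10 * a))))
      (by positivity) (by rw [hScard]; exact hθ) (by positivity) ?_ ?_ ?_ ?_ ?_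
    · calc (1 : ℝ) / 2 = ∑ _K ∈ S, q ^ m * (1 / 2) := by
            rw [Finset.sum_const, nsmul_eq_mul, hScard]; linear_combination (-1 / 2) * hθ
        _ ≤ _ := Finset.sum_le_sum hlow
    · intro K hK K' hK' _ hb
      push Not at hb
      obtain ⟨hb1, hb2⟩ := hb
      have hjk : (K ∩ K').card ≤ k := 
        (Finset.card_le_card Finset.inter_subset_left).trans_eq (hcard K hK)
      obtain ⟨j, hj⟩ : ∃ j, j = (K ∩ K').card := ⟨_, rfl⟩
      rw [← hj] at hb1 hb2 hjk
      have hb1' : (k : ℝ) < 2 * a * j := by exact_mod_cast hb1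
      have hb2' : (2 * a * j : ℝ) < 3 * k := by exact_mod_cast hb2
      have hj0 : (0 : ℝ) ≤ j := by positivity
      have hm3 := mul_le_mul_of_nonneg_right ha3 hj0
      have hm1' := mul_le_mul_of_nonneg_right ha1 hj0
      have hkj : k₀ ≤ j := by
        have : 2 * a * k₀ < 2 * a * j := by omega
        exact (Nat.lt_of_mul_lt_mul_left this).le
      have h4j : 4 * j ≤ 3 * k := by
        have := Nat.mul_le_mul_right j ha4
        linarith
      have h4j' : (4 * j : ℝ) ≤ 3 * k := by exact_mod_cast h4j
      have hkl : k₀ ≤ k - j := by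
        have : 4 * k₀ ≤ k := by
          have := Nat.mul_le_mul_right k₀ ha4
          linarith
        omega
      have hg := pair_good m hm μ r γ θ k₀ k (a * k) hr hmr hγ hθpos hk3 hconv K K' (hcard K hK)
        (hcard K' hK') D (by rw [← hj]; linarith)
        (by rw [← hj, div_le_iff₀ (by positivity)]; linarith)
        (by rw [← hj, le_div_iff₀ (by positivity)]; linarith) (hj ▸ hkj) (hj ▸ hkl)
      rw [← hq] at hg
      refine ENNReal.toReal_le_of_le_ofReal (by positivity) ?_
      rw [hPAA]
      exact hg
    · intro K hK K' hK' hne _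
      have hb := pair_bad m (a * k) μ M θ hM hdens K K' (by rw [hcard K hK, hcard K' hK']) hne D
      have hb' : P (A K ∩ A K') ≤ P (A K) * (ENNReal.ofReal (2 * θ * M)) ^ m := by
        rw [hPAA, hPA]; exact hb
      have h3 := ENNReal.toReal_mono (by finiteness) hb'
      rw [ENNReal.toReal_mul, ENNReal.toReal_pow, ENNReal.toReal_ofReal (by positivity)] at h3
      exact h3
    · intro K hK
      exact tail_count a k ha4 K (hcard K hK)
    · have h2 : 2 * θ * M = q * (√(2 * Real.pi * k) * M) := by
        rw [hq]; field_simp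
      rw [h2, mul_pow]
      calc _ = (q ^ m * ((a * k).choose k : ℝ)) *
            (2 * (√(2 * Real.pi * k) * M) ^ m * Real.exp (-(k / (10 * a)))) := by ring
        _ ≤ 1 := by rw [hθ, one_mul]; exact hbadnum
  have hset : (⋃ K ∈ S, A K) = {Y | ∃ K : Finset (Fin (a * k)), K.card = k ∧
        ∀ i : Fin m, |(∑ j ∈ K, Y j i) - D i| ≤ θ} := by
    ext Y
    simp only [Set.mem_iUnion, Set.mem_ofPred_eq, A, E, hS, Finset.mem_powersetCard,
      Finset.subset_univ, true_and, exists_prop]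
  rw [← hset]
  exact (ENNReal.ofReal_le_iff_le_toReal (measure_ne_top _ _)).2 hmain
end

section
/- Let r, k ∈ ℕ with r < k and set α := k/(k−r); assume α ≥ 4/3. Let Y₁, …, Y_{k+r} be i.i.d. copies of a (γ, k₀)-Gaussian convergent random variable, and set U = Σ_{j=1}^r Y_j, V = Σ_{j=r+1}^k Y_j, W = Σ_{j=k+1}^{k+r} Y_j. Assume k ≥ 280·(γ+1)·α^{7/2}, min{r, k−r} ≥ k₀, and θ ∈ [0, 1/√k]. Then for any D ∈ ℝ, the probability that both U+V ∈ [D−θ, D+θ] and W+V ∈ [D−θ, D+θ] is at most (4θ²/(2πk))·(1 + 16/(9α²)). -/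
open MeasureTheory ProbabilityTheory

lemma split_mp (μ : Measure ℝ) [IsProbabilityMeasure μ] (m n : ℕ) :
    MeasurePreserving (fun Y : Fin (m + n) → ℝ =>
      ((fun i => Y (Fin.castAdd n i), fun j => Y (Fin.natAdd m j)) : (Fin m → ℝ) × (Fin n → ℝ)))
      (Measure.pi fun _ => μ) ((Measure.pi fun _ => μ).prod (Measure.pi fun _ => μ)) := by
  have h1 := measurePreserving_sumPiEquivProdPi (ι := Fin m) (ι' := Fin n)
    (X := fun _ => ℝ) (fun _ => μ)
  have h2 := measurePreserving_piCongrLeft (fun _ : Fin (m + n) => μ)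
    (finSumFinEquiv (m := m) (n := n))
  have h3 := h1.comp (h2.symm _)
  convert h3 using 1
  funext Y
  rfl

lemma phi_lip (x y : ℝ) :
    Real.exp (-x ^ 2 / 2) / Real.sqrt (2 * Real.pi)
      ≤ Real.exp (-y ^ 2 / 2) / Real.sqrt (2 * Real.pi) + |x - y| := by
  have hs : 1 ≤ Real.sqrt (2 * Real.pi) := by
    rw [Real.one_le_sqrt]; linarith [Real.pi_gt_three]
  have hd : ∀ z : ℝ, HasDerivAt (fun x : ℝ => Real.exp (-x ^ 2 / 2)) (-z * Real.exp (-z ^ 2 / 2)) z := by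
    intro z
    have h : HasDerivAt (fun x : ℝ => -x ^ 2 / 2) (-z) z := by
      have h0 : HasDerivAt (fun x : ℝ => -x ^ 2 / 2) (-(((2 : ℕ) : ℝ) * z ^ (2 - 1)) / 2) z :=
        (hasDerivAt_pow 2 z).neg.div_const 2
      have e : (-(((2 : ℕ) : ℝ) * z ^ (2 - 1)) / 2) = -z := by norm_num; ring
      rwa [e] at h0
    convert h.exp using 1
    ring
  have hb : ∀ z : ℝ, ‖-z * Real.exp (-z ^ 2 / 2)‖ ≤ 1 := by
    intro z
    rw [Real.norm_eq_abs, abs_mul, abs_neg, abs_of_pos (Real.exp_pos _), neg_div, Real.exp_neg,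
      ← div_eq_mul_inv, div_le_one (Real.exp_pos _)]
    have := Real.add_one_le_exp (z ^ 2 / 2)
    have h2 := sq_abs z
    nlinarith [sq_nonneg (|z| - 1)]
  have h := Convex.norm_image_sub_le_of_norm_hasDerivWithin_le (s := Set.univ)
    (fun z _ => (hd z).hasDerivWithinAt) (fun z _ => hb z) convex_univ
    (Set.mem_univ y) (Set.mem_univ x)
  simp only [Real.norm_eq_abs, one_mul] at h
  rw [← sub_le_iff_le_add', ← sub_div, div_le_iff₀ (by positivity)]
  have := le_abs_self (Real.exp (-x ^ 2 / 2) - Real.exp (-y ^ 2 / 2))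
  nlinarith [abs_nonneg (x - y)]

/-- The law of the normalized sum. -/
noncomputable def lawN (μ : Measure ℝ) (n : ℕ) : Measure ℝ :=
  Measure.map (fun y : Fin n → ℝ => (∑ i, y i) / Real.sqrt n) (Measure.pi fun _ : Fin n => μ)

lemma lawN_mp (μ : Measure ℝ) (n : ℕ) :
    MeasurePreserving (fun y : Fin n → ℝ => (∑ i, y i) / Real.sqrt n)
      (Measure.pi fun _ : Fin n => μ) (lawN μ n) :=
  ⟨by fun_prop, rfl⟩

instance lawN_prob (μ : Measure ℝ) [IsProbabilityMeasure μ] (n : ℕ) :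
    IsProbabilityMeasure (lawN μ n) :=
  Measure.isProbabilityMeasure_map (by fun_prop)

lemma lawN_le (μ : Measure ℝ) (γ : ℝ) (k₀ n : ℕ)
    (h : IsGaussianConvergent μ γ k₀) (hn : k₀ ≤ n) :
    lawN μ n ≤ volume.withDensity (fun x => ENNReal.ofReal
      (Real.exp (-x ^ 2 / 2) / Real.sqrt (2 * Real.pi) + γ / n)) := by
  obtain ⟨f, hf, hb⟩ := h n hn
  unfold lawN
  rw [hf]
  apply withDensity_mono
  filter_upwards with x
  apply ENNReal.ofReal_le_ofReal
  have := (abs_le.1 (hb x)).2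
  linarith

lemma lint_gauss (b m : ℝ) (hb : 0 < b) :
    ∫⁻ x : ℝ, ENNReal.ofReal (Real.exp (-b * (x - m) ^ 2)) = ENNReal.ofReal (Real.sqrt (Real.pi / b)) := by
  rw [lintegral_sub_right_eq_self (fun x => ENNReal.ofReal (Real.exp (-b * x ^ 2))) m,
    ← integral_gaussian, ofReal_integral_eq_lintegral_ofReal]
  · exact integrable_exp_neg_mul_sq hb
  · filter_upwards with x using (Real.exp_pos _).le

lemma interval_bound (ρ : Measure ℝ) (δ θ q c D : ℝ) (hq : 0 < q)
    (hρ : ρ ≤ volume.withDensity (fun x => ENNReal.ofReal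
      (Real.exp (-x ^ 2 / 2) / Real.sqrt (2 * Real.pi) + δ))) :
    ρ {u | q * u + c ∈ Set.Icc (D - θ) (D + θ)} ≤ ENNReal.ofReal
      (2 * θ / q) * ENNReal.ofReal (Real.exp (-((D - c) / q) ^ 2 / 2) / Real.sqrt (2 * Real.pi) + (θ / q + δ)) := by
  have hset : {u | q * u + c ∈ Set.Icc (D - θ) (D + θ)}
      = Set.Icc ((D - c) / q - θ / q) ((D - c) / q + θ / q) := by
    ext u
    simp only [Set.mem_ofPred_eq, Set.mem_Icc]
    rw [← sub_div, ← add_div, div_le_iff₀ hq, le_div_iff₀ hq]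
    constructor <;> rintro ⟨h1, h2⟩ <;> constructor <;> linarith
  rw [hset]
  refine (hρ _).trans ?_
  rw [withDensity_apply _ measurableSet_Icc]
  have h1 : ∀ x ∈ Set.Icc ((D - c) / q - θ / q) ((D - c) / q + θ / q),
      ENNReal.ofReal (Real.exp (-x ^ 2 / 2) / Real.sqrt (2 * Real.pi) + δ) ≤
      ENNReal.ofReal (Real.exp (-((D - c) / q) ^ 2 / 2) / Real.sqrt (2 * Real.pi) + (θ / q + δ)) := by
    intro x hx
    apply ENNReal.ofReal_le_ofReal
    have := phi_lip x ((D - c) / q)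
    have h2 : |x - (D - c) / q| ≤ θ / q := by
      rw [abs_le]; constructor <;> linarith [hx.1, hx.2]
    linarith
  refine (setLIntegral_mono measurable_const h1).trans ?_
  rw [setLIntegral_const, Real.volume_Icc, mul_comm]
  apply le_of_eq
  congr 2
  ring

lemma event_eq (r s : ℕ) (μ : Measure ℝ) [IsProbabilityMeasure μ] (hr : 0 < r) (hs : 0 < s)
    (I : Set ℝ) (hI : MeasurableSet I) :
    (Measure.pi fun _ : Fin (r + s + r) => μ)
      {Y | (∑ j : Fin (r + s + r), if (j : ℕ) < r + s then Y j else 0) ∈ I ∧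
           (∑ j : Fin (r + s + r), if r ≤ (j : ℕ) then Y j else 0) ∈ I}
    = (((lawN μ r).prod (lawN μ s)).prod (lawN μ r))
      {p | Real.sqrt r * p.1.1 + Real.sqrt s * p.1.2 ∈ I ∧
        Real.sqrt r * p.2 + Real.sqrt s * p.1.2 ∈ I} := by
  have h1 := ((split_mp μ r s).prod (MeasurePreserving.id (Measure.pi fun _ : Fin r => μ))).comp
    (split_mp μ (r + s) r)
  have h2 := (((lawN_mp μ r).prod (lawN_mp μ s)).prod (lawN_mp μ r)).comp h1
  have hm : MeasurableSet {p : (ℝ × ℝ) × ℝ | Real.sqrt r * p.1.1 + Real.sqrt s * p.1.2 ∈ I ∧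
        Real.sqrt r * p.2 + Real.sqrt s * p.1.2 ∈ I} := by
    apply MeasurableSet.inter
    · exact (show Measurable fun p : (ℝ × ℝ) × ℝ => Real.sqrt r * p.1.1 + Real.sqrt s * p.1.2 by fun_prop) hI
    · exact (show Measurable fun p : (ℝ × ℝ) × ℝ => Real.sqrt r * p.2 + Real.sqrt s * p.1.2 by fun_prop) hI
  rw [← h2.measure_preimage hm.nullMeasurableSet]
  congr 1
  ext Y
  have hr' : Real.sqrt r ≠ 0 := by positivity
  have hs' : Real.sqrt s ≠ 0 := by positivity
  have e1 : (∑ j : Fin (r + s + r), if (j : ℕ) < r + s then Y j else 0)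
      = ∑ i : Fin r, Y (Fin.castAdd r (Fin.castAdd s i))
        + ∑ i : Fin s, Y (Fin.castAdd r (Fin.natAdd r i)) := by
    rw [Fin.sum_univ_add, Fin.sum_univ_add]
    have a1 : ∀ i : Fin r, (i : ℕ) < r + s := fun i => by omega
    simp [a1]
  have e2 : (∑ j : Fin (r + s + r), if r ≤ (j : ℕ) then Y j else 0)
      = ∑ i : Fin r, Y (Fin.natAdd (r + s) i)
        + ∑ i : Fin s, Y (Fin.castAdd r (Fin.natAdd r i)) := by
    rw [Fin.sum_univ_add, Fin.sum_univ_add]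
    have a1 : ∀ i : Fin r, ¬ r ≤ (i : ℕ) := fun i => by omega
    have a2 : ∀ i : Fin r, r ≤ r + s + (i : ℕ) := fun i => by omega
    simp only [Fin.val_castAdd, Fin.val_natAdd, a1, a2, if_true, if_false, Finset.sum_const_zero,
      le_add_iff_nonneg_right, Nat.zero_le]
    ring
  simp only [Set.mem_ofPred_eq, Set.mem_preimage, Function.comp, Prod.map, id, e1, e2,
    mul_div_cancel₀ _ hr', mul_div_cancel₀ _ hs']

lemma prod_bound (A B : Measure ℝ) [IsProbabilityMeasure A] [IsProbabilityMeasure B]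
    (q p : ℝ) (I : Set ℝ) (hI : MeasurableSet I) (C : ℝ → ENNReal)
    (hC : Measurable C) (h : ∀ v, A {u | q * u + p * v ∈ I} ≤ C v) :
    ((A.prod B).prod A) {x | q * x.1.1 + p * x.1.2 ∈ I ∧ q * x.2 + p * x.1.2 ∈ I}
      ≤ ∫⁻ v, C v ^ 2 ∂B := by
  have hm : MeasurableSet {x : (ℝ × ℝ) × ℝ | q * x.1.1 + p * x.1.2 ∈ I ∧
        q * x.2 + p * x.1.2 ∈ I} := by
    apply MeasurableSet.inter
    · exact (show Measurable fun x : (ℝ × ℝ) × ℝ => q * x.1.1 + p * x.1.2 by fun_prop) hI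
    · exact (show Measurable fun x : (ℝ × ℝ) × ℝ => q * x.2 + p * x.1.2 by fun_prop) hI
  have hm2 : MeasurableSet {x : ℝ × ℝ | q * x.1 + p * x.2 ∈ I} :=
    (show Measurable fun x : ℝ × ℝ => q * x.1 + p * x.2 by fun_prop) hI
  rw [Measure.prod_apply hm]
  have h1 : ∀ x : ℝ × ℝ, A (Prod.mk x ⁻¹' {x | q * x.1.1 + p * x.1.2 ∈ I ∧ q * x.2 + p * x.1.2 ∈ I})
      ≤ Set.indicator {x : ℝ × ℝ | q * x.1 + p * x.2 ∈ I} (fun x => C x.2) x := by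
    intro x
    by_cases hx : q * x.1 + p * x.2 ∈ I
    · rw [Set.indicator_of_mem (by exact hx)]
      refine le_trans (measure_mono ?_) (h x.2)
      intro w hw
      exact hw.2
    · rw [Set.indicator_of_notMem (by exact hx)]
      simp [hx]
  refine (lintegral_mono h1).trans ?_
  rw [lintegral_prod_symm _ (Measurable.indicator (show Measurable fun x : ℝ × ℝ => C x.2 by fun_prop) hm2).aemeasurable]
  apply lintegral_mono
  intro v
  have h2 : ∀ u, Set.indicator {x : ℝ × ℝ | q * x.1 + p * x.2 ∈ I} (fun x => C x.2) (u, v)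
      = Set.indicator {u | q * u + p * v ∈ I} (fun _ => C v) u := by
    intro u; simp [Set.indicator]
  have hm3 : MeasurableSet {u : ℝ | q * u + p * v ∈ I} :=
    (show Measurable fun u : ℝ => q * u + p * v by fun_prop) hI
  simp only [h2]
  rw [lintegral_indicator_const hm3, sq]
  gcongr
  exact h v

/-- Gaussian part of the second-moment integral. -/
lemma sq_int (B : Measure ℝ) (δ q p D : ℝ) (hq : 0 < q) (hp : 0 < p) (hδ : 0 ≤ δ)
    (hB : B ≤ volume.withDensity (fun x => ENNReal.ofReal
      (Real.exp (-x ^ 2 / 2) / Real.sqrt (2 * Real.pi) + δ))) :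
    ∫⁻ v, ENNReal.ofReal ((Real.exp (-((D - p * v) / q) ^ 2 / 2) / Real.sqrt (2 * Real.pi)) ^ 2) ∂B
      ≤ ENNReal.ofReal (1 / (2 * Real.pi) * (1 / Real.sqrt (2 * Real.pi) *
          Real.sqrt (Real.pi / (p ^ 2 / q ^ 2 + 1 / 2)) + δ * Real.sqrt (Real.pi / (p ^ 2 / q ^ 2)))) := by
  refine (lintegral_mono' hB le_rfl).trans ?_
  rw [lintegral_withDensity_eq_lintegral_mul _ (by fun_prop) (by fun_prop)]
  have hpi := Real.pi_pos
  set b := p ^ 2 / q ^ 2 with hbdef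
  have hb : 0 < b := by positivity
  set d := D / p
  set m := b * d / (b + 1 / 2)
  have hpt : ∀ v : ℝ, ((fun x => ENNReal.ofReal
      (Real.exp (-x ^ 2 / 2) / Real.sqrt (2 * Real.pi) + δ)) * fun v => ENNReal.ofReal ((Real.exp (-((D - p * v) / q) ^ 2 / 2) / Real.sqrt (2 * Real.pi)) ^ 2)) v
      ≤ ENNReal.ofReal (1 / (2 * Real.pi) * (1 / Real.sqrt (2 * Real.pi))) *
          ENNReal.ofReal (Real.exp (-(b + 1 / 2) * (v - m) ^ 2))
        + ENNReal.ofReal (1 / (2 * Real.pi) * δ) * ENNReal.ofReal (Real.exp (-b * (v - d) ^ 2)) := by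
    intro v
    simp only [Pi.mul_apply]
    rw [← ENNReal.ofReal_mul (by positivity), ← ENNReal.ofReal_mul (by positivity),
      ← ENNReal.ofReal_mul (by positivity), ← ENNReal.ofReal_add (by positivity) (by positivity)]
    apply ENNReal.ofReal_le_ofReal
    have e1 : (Real.exp (-((D - p * v) / q) ^ 2 / 2) / Real.sqrt (2 * Real.pi)) ^ 2
        = 1 / (2 * Real.pi) * Real.exp (-b * (v - d) ^ 2) := by
      rw [div_pow, Real.sq_sqrt (by positivity), ← Real.exp_nat_mul]
      have : ((2 : ℕ) : ℝ) * (-((D - p * v) / q) ^ 2 / 2) = -b * (v - d) ^ 2 := by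
        simp only [b, d]; push_cast; field_simp; ring
      rw [this]; ring
    have e2 : Real.exp (-v ^ 2 / 2) * Real.exp (-b * (v - d) ^ 2)
        ≤ Real.exp (-(b + 1 / 2) * (v - m) ^ 2) := by
      rw [← Real.exp_add]
      apply Real.exp_le_exp.2
      have : -(b + 1 / 2) * (v - m) ^ 2 - (-v ^ 2 / 2 + -b * (v - d) ^ 2)
          = b * d ^ 2 * (1 / 2) / (b + 1 / 2) := by
        simp only [m]; field_simp; ring
      have h0 : 0 ≤ b * d ^ 2 * (1 / 2) / (b + 1 / 2) := by positivity
      linarith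
    rw [e1]
    have h3 : 1 / (2 * Real.pi) * (1 / Real.sqrt (2 * Real.pi)) * (Real.exp (-v ^ 2 / 2) * Real.exp (-b * (v - d) ^ 2))
      ≤ 1 / (2 * Real.pi) * (1 / Real.sqrt (2 * Real.pi)) * Real.exp (-(b + 1 / 2) * (v - m) ^ 2) := by
      gcongr
    refine le_trans (le_of_eq ?_) (add_le_add h3 le_rfl)
    ring
  refine (lintegral_mono hpt).trans ?_
  rw [lintegral_add_left (by fun_prop), lintegral_const_mul _ (by fun_prop),
    lintegral_const_mul _ (by fun_prop), lint_gauss _ _ (by positivity), lint_gauss _ _ hb,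
    ← ENNReal.ofReal_mul (by positivity), ← ENNReal.ofReal_mul (by positivity),
    ← ENNReal.ofReal_add (by positivity) (by positivity)]
  apply le_of_eq
  congr 1
  ring

lemma final_num (r s k α a γ ε : ℝ) (hr : 0 < r) (hs : 0 < s) (hk : k = r + s)
    (hα : α = k / s) (hα43 : 4 / 3 ≤ α) (ha : 0 < a) (haα : a ^ 2 = α) (hγ : 0 ≤ γ)
    (hkb : 280 * (γ + 1) * a ^ 7 ≤ k) (hε0 : 0 ≤ ε) (hε : ε ≤ 4 * (γ + 1) / k) :
    1 / r * (1 / (2 * Real.pi) * (1 / Real.sqrt (2 * Real.pi) *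
          Real.sqrt (Real.pi / (s / r + 1 / 2)) + γ / s * Real.sqrt (Real.pi / (s / r))) + (ε + ε ^ 2))
      ≤ 1 / (2 * Real.pi * k) * (1 + 16 / (9 * α ^ 2)) := by
  have hpi := Real.pi_pos
  have hpi4 := Real.pi_lt_d2
  have hk0 : 0 < k := by linarith
  have hα0 : 0 < α := by linarith
  have hsk : α * s = k := by rw [hα]; field_simp
  have hr4 : k ≤ 4 * r := by nlinarith
  set x := 1 / α ^ 2 with hx
  have hx0 : 0 < x := by positivity
  have hx1 : x ≤ 9 / 16 := by
    rw [hx, div_le_iff₀ (by positivity)]; nlinarith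
  have hxs : x * k ^ 2 = s ^ 2 := by
    rw [hx, ← hsk]; field_simp
  -- main term
  have A : k / r * (1 / Real.sqrt (2 * Real.pi) * Real.sqrt (Real.pi / (s / r + 1 / 2))) ≤ 1 + x := by
    have e : k / r * (1 / Real.sqrt (2 * Real.pi) * Real.sqrt (Real.pi / (s / r + 1 / 2)))
        = Real.sqrt ((k / r) ^ 2 * (r / (2 * s + r))) := by
      rw [Real.sqrt_mul (show 0 ≤ (k / r) ^ 2 by positivity), Real.sqrt_sq (by positivity), one_div, ← Real.sqrt_inv,
        ← Real.sqrt_mul (by positivity)]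
      congr 2
      field_simp
    rw [e]
    apply Real.sqrt_le_iff.2 ⟨by positivity, ?_⟩
    have e2 : (k / r) ^ 2 * (r / (2 * s + r)) = 1 / (1 - x) := by
      have : 1 - x = r * (2 * s + r) / k ^ 2 := by
        rw [eq_div_iff (by positivity), sub_mul, hxs, hk]; ring
      rw [this]; field_simp
    rw [e2, div_le_iff₀ (by linarith)]
    nlinarith [mul_nonneg hx0.le (show 0 ≤ 1 - x - x ^ 2 by nlinarith)]
  have ha1 : 1 ≤ a := by nlinarith
  have hg : γ ≤ k / (280 * a ^ 7) := by
    rw [le_div_iff₀ (by positivity)]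
    nlinarith [pow_pos ha 7]
  have hxa : x = 1 / a ^ 4 := by rw [hx, ← haα]; ring
  have B : k / r * (γ / s * Real.sqrt (Real.pi / (s / r))) ≤ 1 / 35 * x := by
    have b1 : Real.sqrt (Real.pi / (s / r)) ≤ 2 * a := by
      apply Real.sqrt_le_iff.2 ⟨by positivity, ?_⟩
      have : r / s ≤ α := by rw [hα]; gcongr; linarith
      calc Real.pi / (s / r) = Real.pi * (r / s) := by field_simp
        _ ≤ 4 * α := by gcongr; linarith
        _ = (2 * a) ^ 2 := by rw [← haα]; ring
    have b2 : k / r ≤ 4 := by rw [div_le_iff₀ hr]; exact hr4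
    have b3 : γ / s ≤ 1 / (280 * a ^ 5) := by
      have hs2 : s = k / a ^ 2 := by rw [haα, ← hsk]; field_simp
      rw [div_le_iff₀ hs, hs2]
      refine hg.trans (le_of_eq ?_)
      field_simp
    calc _ ≤ 4 * (1 / (280 * a ^ 5) * (2 * a)) := by gcongr
      _ = 1 / 35 * x := by rw [hxa]; field_simp; norm_num
  have C : ε ≤ x / 70 := by
    refine hε.trans ?_
    rw [hxa, div_div, div_le_div_iff₀ hk0 (by positivity)]
    have h7 : a ^ 4 ≤ a ^ 7 := pow_le_pow_right₀ ha1 (by norm_num)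
    nlinarith [mul_le_mul_of_nonneg_left h7 (show 0 ≤ 280 * (γ + 1) by positivity)]
  have Dd : k / r * (2 * Real.pi * (ε + ε ^ 2)) ≤ 1 / 2 * x := by
    have b2 : k / r ≤ 4 := by rw [div_le_iff₀ hr]; exact hr4
    have d1 : ε + ε ^ 2 ≤ 71 / 70 * (x / 70) := by nlinarith
    calc _ ≤ 4 * (2 * 3.15 * (71 / 70 * (x / 70))) := by gcongr
      _ ≤ _ := by nlinarith
  have E : 16 / (9 * α ^ 2) = 16 / 9 * x := by rw [hx]; field_simp
  rw [E]
  have key : 1 / r * (1 / (2 * Real.pi) * (1 / Real.sqrt (2 * Real.pi) *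
          Real.sqrt (Real.pi / (s / r + 1 / 2)) + γ / s * Real.sqrt (Real.pi / (s / r))) + (ε + ε ^ 2))
     = 1 / (2 * Real.pi * k) * (k / r * (1 / Real.sqrt (2 * Real.pi) * Real.sqrt (Real.pi / (s / r + 1 / 2)))
       + k / r * (γ / s * Real.sqrt (Real.pi / (s / r))) + k / r * (2 * Real.pi * (ε + ε ^ 2))) := by
    generalize Real.sqrt (Real.pi / (s / r + 1 / 2)) = S1
    generalize Real.sqrt (Real.pi / (s / r)) = S2
    have : Real.sqrt (2 * Real.pi) ≠ 0 := by positivity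
    field_simp
  rw [key]
  apply mul_le_mul_of_nonneg_left _ (by positivity)
  linarith

/-- for `Y₁, …, Y_{k+r}` i.i.d. copies of a `(γ,k₀)`-Gaussian convergent
random variable, `U = Σ_{j=1}^r Y_j`, `V = Σ_{j=r+1}^k Y_j`, `W = Σ_{j=k+1}^{k+r} Y_j`
(so `U + V` is the sum over indices `< k` and `W + V` the sum over indices `≥ r`),
`α = k/(k−r) ≥ 4/3`, `k ≥ 280(γ+1)α^{7/2}`, `min{r, k−r} ≥ k₀`, `θ ∈ [0, 1/√k]`, one has
`P[U+V ∈ [D−θ, D+θ] ∧ W+V ∈ [D−θ, D+θ]] ≤ (4θ²/(2πk))(1 + 16/(9α²))`. -/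
theorem stmt_2 (r k k₀ : ℕ) (hrk : r < k) (γ : ℝ) (hγ : 0 ≤ γ)
    (α : ℝ) (hα : α = (k : ℝ) / ((k : ℝ) - (r : ℝ))) (hα43 : 4 / 3 ≤ α)
    (μ : Measure ℝ) [IsProbabilityMeasure μ]
    (hconv : IsGaussianConvergent μ γ k₀)
    (hk : 280 * (γ + 1) * α ^ ((7 : ℝ) / 2) ≤ (k : ℝ))
    (hmin : k₀ ≤ min r (k - r))
    (θ : ℝ) (hθ : θ ∈ Set.Icc (0 : ℝ) (1 / Real.sqrt k)) (D : ℝ) :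
    (Measure.pi fun _ : Fin (k + r) => μ)
      {Y | (∑ j : Fin (k + r), if (j : ℕ) < k then Y j else 0) ∈ Set.Icc (D - θ) (D + θ) ∧
           (∑ j : Fin (k + r), if r ≤ (j : ℕ) then Y j else 0) ∈ Set.Icc (D - θ) (D + θ)}
      ≤ ENNReal.ofReal (4 * θ ^ 2 / (2 * Real.pi * k) * (1 + 16 / (9 * α ^ 2))) := by
  obtain ⟨s, rfl⟩ : ∃ s, k = r + s := ⟨k - r, by omega⟩
  have hs : 0 < s := by omega
  have hsR : (0 : ℝ) < s := by exact_mod_cast hs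
  have hα0 : 0 < α := by linarith
  have hα' : α = ((r : ℝ) + s) / s := by rw [hα]; push_cast; ring_nf
  have hr : 0 < r := by
    rcases Nat.eq_zero_or_pos r with h | h
    · exfalso
      rw [h] at hα'
      have : α = 1 := by rw [hα']; simp [hsR.ne']
      linarith
    · exact h
  have hrR : (0 : ℝ) < r := by exact_mod_cast hr
  have hk0r : k₀ ≤ r := by omega
  have hk0s : k₀ ≤ s := by omega
  rw [event_eq r s μ hr hs _ measurableSet_Icc]
  have hθ0 := hθ.1
  set q := Real.sqrt r with hq
  set p := Real.sqrt s with hp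
  have hq0 : 0 < q := by positivity
  have hp0 : 0 < p := by positivity
  have hq2 : q ^ 2 = r := Real.sq_sqrt hrR.le
  have hp2 : p ^ 2 = s := Real.sq_sqrt hsR.le
  set ε := θ / q + γ / r with hεd
  have hε0 : 0 ≤ ε := by positivity
  have hkR : ((r + s : ℕ) : ℝ) = (r : ℝ) + s := by push_cast; ring
  rw [hkR] at hk hθ ⊢
  have hr4 : (r : ℝ) + s ≤ 4 * r := by
    have : 4 / 3 * (s : ℝ) ≤ r + s := by
      rw [hα', le_div_iff₀ hsR] at hα43; exact hα43
    linarith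
  have hε : ε ≤ 4 * (γ + 1) / ((r : ℝ) + s) := by
    have h1 : θ / q ≤ 2 / ((r : ℝ) + s) := by
      have hK : 0 < Real.sqrt ((r : ℝ) + s) := by positivity
      have hKq : Real.sqrt ((r : ℝ) + s) ≤ 2 * q := by
        apply Real.sqrt_le_iff.2 ⟨by positivity, ?_⟩
        rw [mul_pow, hq2]; linarith
      have hK2 : Real.sqrt ((r : ℝ) + s) ^ 2 = r + s := Real.sq_sqrt (by positivity)
      calc θ / q ≤ (1 / Real.sqrt ((r : ℝ) + s)) / (Real.sqrt ((r : ℝ) + s) / 2) := by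
            gcongr
            · exact hθ.2
            · linarith
        _ = 2 / (Real.sqrt ((r : ℝ) + s) ^ 2) := by field_simp
        _ = 2 / ((r : ℝ) + s) := by rw [hK2]
    have h2 : γ / r ≤ 4 * γ / ((r : ℝ) + s) := by
      rw [div_le_div_iff₀ hrR (by positivity)]; nlinarith
    calc ε ≤ 2 / ((r : ℝ) + s) + 4 * γ / ((r : ℝ) + s) := add_le_add h1 h2
      _ ≤ _ := by rw [← add_div]; gcongr; linarith
  have hpi := Real.pi_gt_three
  have hphi : ∀ z : ℝ, Real.exp (-z ^ 2 / 2) / Real.sqrt (2 * Real.pi) ≤ 1 / 2 := by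
    intro z
    have h1 : Real.exp (-z ^ 2 / 2) ≤ 1 := by
      rw [Real.exp_le_one_iff]; nlinarith [sq_nonneg z]
    have h2 : 2 ≤ Real.sqrt (2 * Real.pi) := by
      apply Real.le_sqrt_of_sq_le; linarith
    gcongr
  refine (prod_bound (lawN μ r) (lawN μ s) q p _ measurableSet_Icc
    (fun v => ENNReal.ofReal (2 * θ / q) * ENNReal.ofReal
      (Real.exp (-((D - p * v) / q) ^ 2 / 2) / Real.sqrt (2 * Real.pi) + ε)) (by fun_prop)
    (fun v => interval_bound (lawN μ r) (γ / r) θ q (p * v) D hq0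
      (lawN_le μ γ k₀ r hconv hk0r))).trans ?_
  have hpt : ∀ v : ℝ, (ENNReal.ofReal (2 * θ / q) * ENNReal.ofReal
      (Real.exp (-((D - p * v) / q) ^ 2 / 2) / Real.sqrt (2 * Real.pi) + ε)) ^ 2
      ≤ ENNReal.ofReal (4 * θ ^ 2 / r) * (ENNReal.ofReal
        ((Real.exp (-((D - p * v) / q) ^ 2 / 2) / Real.sqrt (2 * Real.pi)) ^ 2)
          + ENNReal.ofReal (ε + ε ^ 2)) := by
    intro v
    rw [← ENNReal.ofReal_mul (by positivity), ← ENNReal.ofReal_pow (by positivity),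
      ← ENNReal.ofReal_add (by positivity) (by positivity), ← ENNReal.ofReal_mul (by positivity)]
    apply ENNReal.ofReal_le_ofReal
    have e : (2 * θ / q) ^ 2 = 4 * θ ^ 2 / r := by rw [div_pow, hq2]; ring
    rw [mul_pow, e]
    gcongr
    have := hphi ((D - p * v) / q)
    nlinarith
  refine (lintegral_mono hpt).trans ?_
  rw [lintegral_const_mul _ (by fun_prop), lintegral_add_right _ (by fun_prop), lintegral_const,
    measure_univ, mul_one]
  have hsq := sq_int (lawN μ s) (γ / s) q p D hq0 hp0 (by positivity) (lawN_le μ γ k₀ s hconv hk0s)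
  rw [hp2, hq2] at hsq
  refine (mul_le_mul_right (add_le_add_left hsq _) _).trans ?_
  rw [← ENNReal.ofReal_add (by positivity) (by positivity), ← ENNReal.ofReal_mul (by positivity)]
  apply ENNReal.ofReal_le_ofReal
  have ha2 : Real.sqrt α ^ 2 = α := Real.sq_sqrt hα0.le
  have ha7 : α ^ ((7 : ℝ) / 2) = Real.sqrt α ^ 7 := by
    rw [Real.sqrt_eq_rpow, ← Real.rpow_natCast, ← Real.rpow_mul hα0.le]; norm_num
  rw [ha7] at hk
  have hf := final_num r s (r + s) α (Real.sqrt α) γ ε hrR hsR rfl hα' hα43 (by positivity) ha2 hγ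
    hk hε0 hε
  have := mul_le_mul_of_nonneg_left hf (show 0 ≤ 4 * θ ^ 2 by positivity)
  refine le_trans (le_of_eq ?_) (this.trans (le_of_eq ?_))
  · ring
  · ring
end

section
/- There exists a universal constant k₀ ≥ 1 such that for every ε ∈ [0,1], if U is uniform on [−√3, √3] and Z ∼ N(0,1) is independent of U, then the random variable √ε · U + √(1−ε) · Z is (1/10, k₀)-Gaussian convergent and has maximum density at most 1. -/
open MeasureTheory ProbabilityTheory

/-- The law of `√ε·U + √(1−ε)·Z` where `U` is uniform on `[−√3, √3]` and `Z ∼ N(0,1)`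
is independent of `U`. -/
noncomputable def unifGaussMix (ε : ℝ) : Measure ℝ :=
  Measure.map (fun p : ℝ × ℝ => Real.sqrt ε * p.1 + Real.sqrt (1 - ε) * p.2)
    ((ProbabilityTheory.cond MeasureTheory.volume
        (Set.Icc (-Real.sqrt 3) (Real.sqrt 3))).prod (gaussianReal 0 1))

section Analysis
open Real

lemma aux_nonneg (f f' : ℝ → ℝ) (h0 : f 0 = 0) (hd : ∀ x, HasDerivAt f (f' x) x)
    (hp : ∀ x, 0 ≤ x → 0 ≤ f' x) {x : ℝ} (hx : 0 ≤ x) : 0 ≤ f x := by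
  have hm : MonotoneOn f (Set.Ici 0) := by
    apply monotoneOn_of_hasDerivWithinAt_nonneg (convex_Ici 0) (f' := f')
    · exact fun y _ => (hd y).continuousAt.continuousWithinAt
    · exact fun y _ => (hd y).hasDerivWithinAt
    · intro y hy
      rw [interior_Ici] at hy
      exact hp y (le_of_lt hy)
  have := hm (Set.mem_Ici.2 le_rfl) (Set.mem_Ici.2 hx) hx
  rwa [h0] at this

lemma cos_le4 {x : ℝ} (hx : 0 ≤ x) : cos x ≤ 1 - x^2/2 + x^4/24 := by
  have := aux_nonneg (fun x => 1 - x^2/2 + x^4/24 - cos x) (fun x => sin x - (x - x^3/6)) (by simp)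
    (fun x => by
      have := ((((hasDerivAt_id x).pow 2).div_const 2).const_sub 1).add
        (((hasDerivAt_id x).pow 4).div_const 24) |>.sub (hasDerivAt_cos x)
      refine this.congr_deriv ?_
      simp only [id, Nat.cast_ofNat]
      norm_num
      ring)
    (fun x hx => sub_nonneg.2 (sin_ge_sub_cube hx)) hx
  linarith

lemma sin_le5 {x : ℝ} (hx : 0 ≤ x) : sin x ≤ x - x^3/6 + x^5/120 := by
  have := aux_nonneg (fun x => x - x^3/6 + x^5/120 - sin x)
    (fun x => 1 - x^2/2 + x^4/24 - cos x) (by simp)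
    (fun x => by
      have := ((hasDerivAt_id x).sub (((hasDerivAt_id x).pow 3).div_const 6)).add
        (((hasDerivAt_id x).pow 5).div_const 120) |>.sub (hasDerivAt_sin x)
      refine this.congr_deriv ?_
      simp only [id, Nat.cast_ofNat]
      norm_num
      ring)
    (fun x hx => sub_nonneg.2 (cos_le4 hx)) hx
  linarith

lemma cos_ge6 {x : ℝ} (hx : 0 ≤ x) : 1 - x^2/2 + x^4/24 - x^6/720 ≤ cos x := by
  have := aux_nonneg (fun x => cos x - (1 - x^2/2 + x^4/24 - x^6/720))
    (fun x => x - x^3/6 + x^5/120 - sin x) (by simp)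
    (fun x => by
      have := (hasDerivAt_cos x).sub (((((hasDerivAt_id x).pow 2).div_const 2).const_sub 1).add
        (((hasDerivAt_id x).pow 4).div_const 24) |>.sub (((hasDerivAt_id x).pow 6).div_const 720))
      refine this.congr_deriv ?_
      simp only [id, Nat.cast_ofNat]
      norm_num
      ring)
    (fun x hx => sub_nonneg.2 (sin_le5 hx)) hx
  linarith

lemma sin_ge7 {x : ℝ} (hx : 0 ≤ x) : x - x^3/6 + x^5/120 - x^7/5040 ≤ sin x := by
  have := aux_nonneg (fun x => sin x - (x - x^3/6 + x^5/120 - x^7/5040))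
    (fun x => cos x - (1 - x^2/2 + x^4/24 - x^6/720)) (by simp)
    (fun x => by
      have := (hasDerivAt_sin x).sub (((hasDerivAt_id x).sub
        (((hasDerivAt_id x).pow 3).div_const 6)).add
        (((hasDerivAt_id x).pow 5).div_const 120) |>.sub (((hasDerivAt_id x).pow 7).div_const 5040))
      refine this.congr_deriv ?_
      simp only [id, Nat.cast_ofNat]
      norm_num
      ring)
    (fun x hx => sub_nonneg.2 (cos_ge6 hx)) hx
  linarith

lemma hasDerivAt_exp_neg' (x : ℝ) : HasDerivAt (fun x => exp (-x)) (- exp (-x)) x := by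
  have := (hasDerivAt_neg x).exp
  simpa using this

lemma expneg_le2 {x : ℝ} (hx : 0 ≤ x) : exp (-x) ≤ 1 - x + x^2/2 := by
  have := aux_nonneg (fun x => 1 - x + x^2/2 - exp (-x))
    (fun x => exp (-x) - (1 - x)) (by simp)
    (fun x => by
      have := (((hasDerivAt_id x).const_sub 1).add
        (((hasDerivAt_id x).pow 2).div_const 2)).sub (hasDerivAt_exp_neg' x)
      refine this.congr_deriv ?_
      simp only [id, Nat.cast_ofNat]
      norm_num
      ring)
    (fun x hx => by linarith [add_one_le_exp (-x)]) hx
  linarith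

lemma expneg_ge3 {x : ℝ} (hx : 0 ≤ x) : 1 - x + x^2/2 - x^3/6 ≤ exp (-x) := by
  have := aux_nonneg (fun x => exp (-x) - (1 - x + x^2/2 - x^3/6))
    (fun x => 1 - x + x^2/2 - exp (-x)) (by simp)
    (fun x => by
      have := (hasDerivAt_exp_neg' x).sub ((((hasDerivAt_id x).const_sub 1).add
        (((hasDerivAt_id x).pow 2).div_const 2)).sub (((hasDerivAt_id x).pow 3).div_const 6))
      refine this.congr_deriv ?_
      simp only [id, Nat.cast_ofNat]
      norm_num
      ring)
    (fun x hx => by linarith [expneg_le2 hx]) hx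
  linarith

lemma sinc_abs' (u : ℝ) : sinc |u| = sinc u := by
  rcases abs_choice u with h | h <;> simp [h]

lemma sinc_le5 (u : ℝ) : sinc u ≤ 1 - u^2/6 + u^4/120 := by
  rw [← sinc_abs', ← sq_abs, ← Even.pow_abs (n := 4) (by decide) u]
  rcases eq_or_ne u 0 with rfl | h
  · simp
  have hp : 0 < |u| := abs_pos.2 h
  rw [sinc_of_ne_zero hp.ne', div_le_iff₀ hp]
  have := sin_le5 hp.le
  linarith

lemma sinc_ge7 (u : ℝ) : 1 - u^2/6 + u^4/120 - u^6/5040 ≤ sinc u := by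
  rw [← sinc_abs', ← sq_abs, ← Even.pow_abs (n := 4) (by decide) u,
    ← Even.pow_abs (n := 6) (by decide) u]
  rcases eq_or_ne u 0 with rfl | h
  · simp
  have hp : 0 < |u| := abs_pos.2 h
  rw [sinc_of_ne_zero hp.ne', le_div_iff₀ hp]
  have := sin_ge7 hp.le
  linarith

lemma sinc_le_exp {u : ℝ} (h : u^2 ≤ 3/2) : sinc u ≤ exp (-(u^2/6)) := by
  have h1 := sinc_le5 u
  have h2 := expneg_ge3 (x := u^2/6) (by positivity)
  nlinarith [sq_nonneg u, sq_nonneg (u^2)]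

lemma sinc_nonneg' {u : ℝ} (h : u^2 ≤ 3/2) : 0 ≤ sinc u := by
  have h1 := sinc_ge7 u
  nlinarith [sq_nonneg u, sq_nonneg (u^2), mul_nonneg (sq_nonneg (u^2)) (sub_nonneg.2 h)]

lemma exp_sub_sinc_le {u : ℝ} (h : u^2 ≤ 1) :
    exp (-(u^2/6)) - sinc u ≤ 5/24 * (u^2/6)^2 := by
  have h1 := sinc_ge7 u
  have h2 := expneg_le2 (x := u^2/6) (by positivity)
  nlinarith [sq_nonneg u, sq_nonneg (u^2), mul_nonneg (sq_nonneg (u^2)) (sub_nonneg.2 h)]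

lemma sinc_sq_le (u : ℝ) : sinc u ^ 2 ≤ (1 + u^2/3)⁻¹ := by
  rcases le_total (u^2) (3/2) with h | h
  · have h1 := sinc_le_exp h
    have h0 := sinc_nonneg' h
    calc sinc u ^ 2 ≤ exp (-(u^2/6)) ^ 2 := by gcongr
      _ = (exp (u^2/3))⁻¹ := by rw [← exp_nat_mul, ← exp_neg]; congr 1; push_cast; ring
      _ ≤ _ := by
        gcongr
        linarith [add_one_le_exp (u^2/3)]
  · have hu : u ≠ 0 := by rintro rfl; norm_num at h
    have hp : 0 < u^2 := by positivity
    rw [sinc_of_ne_zero hu, div_pow, ← one_div, div_le_div_iff₀ hp (by positivity)]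
    nlinarith [sin_sq_le_one u, sq_nonneg (sin u)]

lemma sqrt_bound {s e a : ℝ} (h0 : 0 ≤ e) (h1 : e ≤ 1) (ha : a ^ 2 ≤ (1 + e * s^2)⁻¹) :
    |a * exp (-((1 - e) * s^2 / 2))| ≤ √((1 + s^2)⁻¹) := by
  apply abs_le_sqrt
  rw [mul_pow, ← exp_nat_mul]
  have hx : 0 ≤ (1 - e) * s^2 := mul_nonneg (by linarith) (sq_nonneg s)
  have hy : 0 ≤ e * s^2 := by positivity
  have h2 : exp (((2:ℕ):ℝ) * -((1 - e) * s^2 / 2)) ≤ (1 + (1 - e) * s^2)⁻¹ := by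
    have : ((2:ℕ):ℝ) * -((1 - e) * s^2 / 2) = -((1 - e) * s^2) := by push_cast; ring
    rw [this, exp_neg]
    gcongr
    linarith [add_one_le_exp ((1 - e) * s^2)]
  calc a ^ 2 * exp (((2:ℕ):ℝ) * -((1 - e) * s^2 / 2))
      ≤ (1 + e * s^2)⁻¹ * (1 + (1 - e) * s^2)⁻¹ := by gcongr
    _ = ((1 + e * s^2) * (1 + (1 - e) * s^2))⁻¹ := by rw [mul_inv]
    _ ≤ _ := by
      gcongr
      nlinarith [mul_nonneg hx hy]

lemma tail_pow {n : ℕ} (hn : 2 ≤ n) {s q : ℝ} (hs : 1/3 ≤ s^2) (hq : |q| ≤ √((1 + s^2)⁻¹)) :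
    |q ^ n| ≤ √(3/4) ^ (n - 2) * (1 + s^2)⁻¹ := by
  rw [abs_pow]
  obtain ⟨m, rfl⟩ := Nat.exists_eq_add_of_le hn
  have h1 : √((1 + s^2)⁻¹) ≤ √(3/4) := by
    apply sqrt_le_sqrt
    rw [inv_le_comm₀ (by positivity) (by norm_num)]
    norm_num; linarith
  have e : 2 + m - 2 = m := by omega
  rw [e, pow_add, mul_comm]
  have h2 : |q| ^ 2 ≤ (1 + s^2)⁻¹ := by
    calc |q| ^ 2 ≤ √((1 + s^2)⁻¹) ^ 2 := by gcongr
      _ = _ := sq_sqrt (by positivity)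
  gcongr
  exact hq.trans h1

lemma point_bound {n : ℕ} (hn : 2 ≤ n) {e s : ℝ} (h0 : 0 ≤ e) (h1 : e ≤ 1) :
    |(sinc (√3 * (√e * s)) * exp (-((1 - e) * s^2 / 2))) ^ n - exp (-(s^2/2)) ^ n|
      ≤ n / 16 * s^4 * exp (-(s^2/2)) ^ n + 2 * √(3/4) ^ (n - 2) * (1 + s^2)⁻¹ := by
  set u := √3 * (√e * s) with hu
  have hu2 : u^2 = 3 * (e * s^2) := by
    rw [hu, mul_pow, mul_pow, sq_sqrt (by norm_num), sq_sqrt h0]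
  rcases le_total (u^2) 1 with h | h
  · set a := sinc u
    set b := exp (-(u^2/6)) with hb
    set c := exp (-((1 - e) * s^2 / 2)) with hc
    have hbc : exp (-(s^2/2)) = b * c := by
      rw [hb, hc, ← exp_add, hu2]; congr 1; ring
    have ha0 : 0 ≤ a := sinc_nonneg' (by linarith)
    have hab : a ≤ b := sinc_le_exp (by linarith)
    have hd : b - a ≤ 5/24 * (u^2/6)^2 := exp_sub_sinc_le h
    have hb0 : 0 < b := exp_pos _
    have hc0 : 0 < c := exp_pos _
    have hb65 : b⁻¹ ≤ 6/5 := by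
      rw [inv_le_comm₀ hb0 (by norm_num)]
      have := add_one_le_exp (-(u^2/6))
      norm_num; linarith
    have hpow : |a ^ n - b ^ n| ≤ (b - a) * n * b ^ (n - 1) := by
      have := abs_pow_sub_pow_le a b n
      rwa [abs_of_nonneg ha0, abs_of_pos hb0, max_eq_right hab, abs_sub_comm a b,
        abs_of_nonneg (sub_nonneg.2 hab)] at this
    have hbn : b ^ (n - 1) = b ^ n * b⁻¹ := by
      rw [pow_sub₀ b hb0.ne' (by omega), pow_one]
    have hs4 : (u^2/6)^2 ≤ s^4/4 := by
      rw [hu2]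
      have : e^2 ≤ 1 := by nlinarith
      nlinarith [sq_nonneg (s^2), mul_nonneg (sub_nonneg.2 this) (sq_nonneg (s^2))]
    have hmain : |a ^ n - b ^ n| ≤ n / 16 * s^4 * b ^ n := by
      calc |a ^ n - b ^ n| ≤ (b - a) * n * b ^ (n - 1) := hpow
        _ ≤ (5/24 * (s^4/4)) * n * (b ^ n * (6/5)) := by
          rw [hbn]
          have : b - a ≤ 5/24 * (s^4/4) := by linarith
          gcongr
        _ = _ := by ring
    rw [hbc, mul_pow, mul_pow, ← sub_mul, abs_mul, abs_of_pos (pow_pos hc0 n)]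
    calc |a ^ n - b ^ n| * c ^ n ≤ (n / 16 * s^4 * b ^ n) * c ^ n := by gcongr
      _ = n / 16 * s^4 * (b ^ n * c ^ n) := by ring
      _ ≤ _ := by
        have : 0 ≤ 2 * √(3/4) ^ (n - 2) * (1 + s^2)⁻¹ := by positivity
        linarith
  · have hs : 1/3 ≤ s^2 := by nlinarith [sq_nonneg s]
    have t1 := tail_pow hn hs (sqrt_bound (a := sinc u) h0 h1 (by
      have := sinc_sq_le u
      rwa [hu2, mul_div_cancel_left₀ _ (by norm_num)] at this))
    have t2 := tail_pow hn hs (sqrt_bound (a := 1) (e := 0) le_rfl zero_le_one (by simp))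
    have e2 : 1 * exp (-((1 - 0) * s^2 / 2)) = exp (-(s^2/2)) := by simp
    rw [e2] at t2
    have : 0 ≤ n / 16 * s^4 * exp (-(s^2/2)) ^ n := by positivity
    have := abs_sub ((sinc u * exp (-((1 - e) * s^2 / 2))) ^ n) (exp (-(s^2/2)) ^ n)
    linarith

lemma point_bound_t {n : ℕ} (hn : 2 ≤ n) {e t : ℝ} (h0 : 0 ≤ e) (h1 : e ≤ 1) :
    |(sinc (√3 * (√e * ((√n)⁻¹ * t))) * exp (-((1 - e) * ((√n)⁻¹ * t)^2 / 2))) ^ n - exp (-(t^2/2))|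
      ≤ 1 / (16 * n) * (t^4 * exp (-(t^2/2))) + 2 * n * √(3/4) ^ (n - 2) * (1 + t^2)⁻¹ := by
  have hn0 : (0:ℝ) < n := by exact_mod_cast (by omega : 0 < n)
  have hn1 : (1:ℝ) ≤ n := by exact_mod_cast (by omega : 1 ≤ n)
  set s := (√n)⁻¹ * t with hs
  have hs2 : s^2 = t^2 / n := by
    rw [hs, mul_pow, inv_pow, sq_sqrt hn0.le]; field_simp
  have hE : exp (-(s^2/2)) ^ n = exp (-(t^2/2)) := by
    rw [← exp_nat_mul, hs2]; congr 1; field_simp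
  have := point_bound hn h0 h1 (s := s)
  rw [hE] at this
  refine this.trans (add_le_add (le_of_eq ?_) (?_ : 2 * √(3/4) ^ (n - 2) * (1 + s^2)⁻¹ ≤ 2 * n * √(3/4) ^ (n - 2) * (1 + t^2)⁻¹))
  · have : s^4 = (t^2/n)^2 := by rw [← hs2]; ring
    rw [this]; field_simp
  · have : (1 + s^2)⁻¹ ≤ (n:ℝ) * (1 + t^2)⁻¹ := by
      rw [hs2, inv_le_iff_one_le_mul₀ (by positivity)]
      have : (n:ℝ) * (1 + t^2)⁻¹ * (1 + t^2/n) = (n + t^2) / (1 + t^2) := by field_simp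
      rw [this, one_le_div (by positivity)]
      linarith
    calc 2 * √(3/4) ^ (n - 2) * (1 + s^2)⁻¹ ≤ 2 * √(3/4) ^ (n - 2) * (n * (1 + t^2)⁻¹) := by gcongr
      _ = _ := by ring

lemma integral_t4 : MeasureTheory.Integrable (fun t : ℝ => t^4 * exp (-(t^2/2))) ∧
    ∫ t : ℝ, t^4 * exp (-(t^2/2)) = 3 * √(2 * π) := by
  constructor
  · have := integrable_rpow_mul_exp_neg_mul_sq (b := 1/2) (by norm_num) (s := 4) (by norm_num)
    refine this.congr (MeasureTheory.ae_of_all _ fun t => ?_)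
    simp only
    rw [show (4:ℝ) = ((4:ℕ):ℝ) by norm_num, rpow_natCast]
    congr 2; ring
  · have h1 := integral_comp_abs (f := fun t : ℝ => t^4 * exp (-(t^2/2)))
    have h2 := integral_rpow_mul_exp_neg_mul_rpow (p := 2) (q := 4) (b := 1/2) (by norm_num) (by norm_num) (by norm_num)
    have h3 : ∫ t in Set.Ioi (0:ℝ), t^4 * exp (-(t^2/2)) = 
      ∫ x in Set.Ioi (0:ℝ), x ^ (4:ℝ) * rexp (-(1 / 2) * x ^ (2:ℝ)) := by
      congr 1 with x
      rw [show (4:ℝ) = ((4:ℕ):ℝ) by norm_num, rpow_natCast, show (2:ℝ) = ((2:ℕ):ℝ) by norm_num, rpow_natCast]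
      congr 2; push_cast; ring
    have h4 : ∫ t : ℝ, t^4 * exp (-(t^2/2)) = ∫ t : ℝ, |t|^4 * exp (-(|t|^2/2)) := by
      congr 1 with t
      rw [sq_abs, Even.pow_abs (n := 4) (by decide)]
    rw [h4, h1, h3, h2]
    have hG : Gamma ((4 + 1) / 2) = 3/4 * √π := by
      rw [show ((4:ℝ)+1)/2 = (1/2 + 1) + 1 by norm_num, Gamma_add_one (by norm_num),
        Gamma_add_one (by norm_num), Gamma_one_half_eq]
      ring
    rw [hG, show -(4+1:ℝ)/2 = -((2:ℕ):ℝ) + -(1/2) by norm_num, rpow_add (by norm_num), rpow_neg (by norm_num), rpow_natCast, rpow_neg (by norm_num), ← sqrt_eq_rpow,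
      sqrt_mul (by norm_num) π, one_div, sqrt_inv]
    norm_num
    ring

lemma integral_bound {n : ℕ} (hn : 2 ≤ n) (hK : n * √(3/4) ^ (n - 2) ≤ 1 / (40 * (n:ℝ))) {D : ℝ → ℝ}
    (hD : Continuous D)
    (h : ∀ t, |D t| ≤ 1 / (16 * n) * (t^4 * exp (-(t^2/2))) + 2 * n * √(3/4) ^ (n - 2) * (1 + t^2)⁻¹) :
    MeasureTheory.Integrable D ∧ ∫ t, |D t| ≤ 2 * π * (1 / 10 / n) := by
  have hn0 : (0:ℝ) < n := by exact_mod_cast (by omega : 0 < n)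
  have hB : MeasureTheory.Integrable (fun t : ℝ => 1 / (16 * n) * (t^4 * exp (-(t^2/2))) + 2 * n * √(3/4) ^ (n - 2) * (1 + t^2)⁻¹) :=
    (integral_t4.1.const_mul _).add (integrable_inv_one_add_sq.const_mul _)
  refine ⟨hB.mono' hD.aestronglyMeasurable (MeasureTheory.ae_of_all _ h), ?_⟩
  refine (MeasureTheory.integral_mono_of_nonneg (MeasureTheory.ae_of_all _ fun t => abs_nonneg _) hB
    (MeasureTheory.ae_of_all _ h)).trans ?_
  rw [MeasureTheory.integral_add (integral_t4.1.const_mul _) (integrable_inv_one_add_sq.const_mul _),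
    MeasureTheory.integral_const_mul, MeasureTheory.integral_const_mul, integral_t4.2,
    integral_univ_inv_one_add_sq]
  have hpi : √(2*π) ≤ 2 * π / (5/2) := by
    have h1 : √(2*π) * √(2*π) = 2 * π := mul_self_sqrt (by positivity)
    have h2 : 5/2 ≤ √(2*π) := by
      apply le_sqrt_of_sq_le
      nlinarith [pi_gt_d2]
    rw [le_div_iff₀ (by norm_num)]
    nlinarith [sqrt_nonneg (2*π)]
  calc 1 / (16 * (n:ℝ)) * (3 * √(2 * π)) + 2 * n * √(3/4) ^ (n - 2) * π
      ≤ 1 / (16 * (n:ℝ)) * (3 * (2 * π / (5/2))) + 2 * (1 / (40 * (n:ℝ))) * π := by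
        rw [mul_assoc 2 (n:ℝ)]
        gcongr
    _ = 2 * π * (1 / 10 / n) := by field_simp; norm_num

lemma exists_k0 : ∃ k : ℕ, 2 ≤ k ∧ ∀ n : ℕ, k ≤ n → n * √(3/4) ^ (n - 2) ≤ 1 / (40 * (n:ℝ)) := by
  have hr : √(3/4) < 1 := by
    rw [sqrt_lt' one_pos]; norm_num
  have hr0 : 0 < √(3/4) := by positivity
  have := tendsto_pow_const_mul_const_pow_of_lt_one 2 hr0.le hr
  have h2 := (this.eventually_lt_const (u := √(3/4)^2 / 40) (by positivity))
  obtain ⟨k, hk⟩ := Filter.eventually_atTop.1 h2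
  refine ⟨max k 2, le_max_right _ _, fun n hn => ?_⟩
  have hn2 : 2 ≤ n := (le_max_right _ _).trans hn
  have h := hk n ((le_max_left _ _).trans hn)
  have hn0 : (0:ℝ) < n := by exact_mod_cast (by omega : 0 < n)
  rw [pow_sub₀ _ hr0.ne' hn2, le_div_iff₀ (by positivity)]
  have : n * (√(3/4) ^ n * (√(3/4)^2)⁻¹) * (40 * n) = (n^2 * √(3/4)^n) * 40 / √(3/4)^2 := by
    field_simp
  rw [this, div_le_one (by positivity)]
  linarith

end Analysis

section Fourier
open MeasureTheory FourierTransform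
open scoped ContDiff SchwartzMap

lemma fourier_pair {f g : ℝ → ℂ} (hf : Integrable f) (hg : Integrable g) :
    ∫ x, 𝓕 f x * g x = ∫ x, f x * 𝓕 g x := by
  have := VectorFourier.integral_fourierIntegral_smul_eq_flip (L := innerₗ ℝ) (μ := volume) (ν := volume)
    (he := Real.continuous_fourierChar) (hL := by exact continuous_inner) hf hg
  simpa using! this

lemma fourierInv_pair {f g : ℝ → ℂ} (hf : Integrable f) (hg : Integrable g) :
    ∫ x, 𝓕⁻ f x * g x = ∫ x, f x * 𝓕⁻ g x := by
  have := fourier_pair hf hg.comp_neg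
  rw [← integral_neg_eq_self] at this
  simp only [neg_neg] at this
  rw [Real.fourierInv_eq_fourier_comp_neg g, ← this]
  simp only [Real.fourierInv_eq_fourier_neg]

lemma continuous_fourier {f : ℝ → ℂ} (hf : Integrable f) : Continuous (𝓕 f) :=
  VectorFourier.fourierIntegral_continuous Real.continuous_fourierChar
    (by exact continuous_inner) hf

lemma inversion_ae {F : ℝ → ℂ} (hF : Integrable F) (hF' : Integrable (𝓕 F)) :
    ∀ᵐ x, F x = 𝓕⁻ (𝓕 F) x := by
  have hc : Continuous (𝓕⁻ (𝓕 F)) := by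
    rw [Real.fourierInv_eq_fourier_comp_neg]
    exact continuous_fourier hF'.comp_neg
  apply ae_eq_of_integral_contDiff_smul_eq hF.locallyIntegrable hc.locallyIntegrable
  intro g hg hgc
  obtain ⟨G, hG⟩ : ∃ G : 𝓢(ℝ, ℂ), ∀ x, G x = (g x : ℂ) :=
    ⟨HasCompactSupport.toSchwartzMap (f := fun x => (g x : ℂ))
      (hgc.comp_left (g := fun x : ℝ => (x : ℂ)) (by simp))
      (Complex.ofRealCLM.contDiff.comp hg), fun x => rfl⟩
  have hI : 𝓕 (⇑(𝓕⁻ G : 𝓢(ℝ, ℂ))) = ⇑G := by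
    rw [← SchwartzMap.fourier_coe]
    simp
  simp_rw [Complex.real_smul, ← hG]
  calc ∫ x, G x * F x = ∫ x, 𝓕 (⇑(𝓕⁻ G : 𝓢(ℝ, ℂ))) x * F x := by rw [hI]
    _ = ∫ x, (𝓕⁻ G : 𝓢(ℝ, ℂ)) x * 𝓕 F x := fourier_pair (𝓕⁻ G : 𝓢(ℝ, ℂ)).integrable hF
    _ = ∫ x, (𝓕⁻ ⇑G) x * 𝓕 F x := by rw [SchwartzMap.fourierInv_coe]
    _ = ∫ x, G x * 𝓕⁻ (𝓕 F) x := fourierInv_pair G.integrable hF'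

lemma norm_le_ae {F : ℝ → ℂ} (hF : Integrable F) (hF' : Integrable (𝓕 F)) :
    ∀ᵐ x, ‖F x‖ ≤ ∫ w, ‖𝓕 F w‖ := by
  filter_upwards [inversion_ae hF hF'] with x hx
  rw [hx, Real.fourierInv_eq_fourier_neg]
  exact VectorFourier.norm_fourierIntegral_le_integral_norm _ _ _ _ _

/-- Comparison of two probability measures through their characteristic functions. -/
lemma density_compare {μ ν : Measure ℝ} [IsProbabilityMeasure μ] [IsProbabilityMeasure ν]
    {g : ℝ → ℝ} {φ : ℝ → ℝ} {C : ℝ} (hμ : μ = volume.withDensity (fun x => ENNReal.ofReal (g x)))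
    (hν : ν = volume.withDensity (fun x => ENNReal.ofReal (φ x)))
    (hgm : Measurable g) (hφm : Measurable φ) (hg0 : ∀ x, 0 ≤ g x) (hφ0 : ∀ x, 0 ≤ φ x)
    (hi : Integrable (fun t => charFun μ t - charFun ν t))
    (hC : ∫ t, ‖charFun μ t - charFun ν t‖ ≤ 2 * Real.pi * C) :
    ∀ᵐ x, |g x - φ x| ≤ C := by
  have key : ∀ (μ : Measure ℝ) (g : ℝ → ℝ), IsProbabilityMeasure μ → Measurable g →
      (∀ x, 0 ≤ g x) →  μ = volume.withDensity (fun x => ENNReal.ofReal (g x)) →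
      Integrable (fun x => (g x : ℂ)) ∧
        ∀ w, 𝓕 (fun x => (g x : ℂ)) w = charFun μ (-(2 * Real.pi) * w) := by
    intro μ g _ hg h0 h
    have hgint : Integrable g := by
      refine ⟨hg.aestronglyMeasurable, ?_⟩
      rw [hasFiniteIntegral_iff_ofReal (ae_of_all _ h0)]
      have := measure_univ (μ := μ)
      rw [h, withDensity_apply _ MeasurableSet.univ, setLIntegral_univ] at this
      simp [this]
    refine ⟨hgint.ofReal, fun w => ?_⟩
    rw [charFun_apply_real, h, integral_withDensity_eq_integral_toReal_smul (by fun_prop) (by simp),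
      Real.fourier_real_eq_integral_exp_smul]
    congr 1 with x
    rw [ENNReal.toReal_ofReal (h0 x), Complex.real_smul, smul_eq_mul, mul_comm]
    congr 2
    push_cast
    ring
  obtain ⟨ig, hg⟩ := key μ g inferInstance hgm hg0 hμ
  obtain ⟨iφ, hφ⟩ := key ν φ inferInstance hφm hφ0 hν
  set F : ℝ → ℂ := (fun x => (g x : ℂ)) - (fun x => (φ x : ℂ)) with hFdef
  have hF : Integrable F := ig.sub iφ
  have hFw : 𝓕 F = fun w => charFun μ (-(2 * Real.pi) * w) - charFun ν (-(2 * Real.pi) * w) := by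
    ext w
    rw [← hg, ← hφ, Real.fourier_real_eq, Real.fourier_real_eq, Real.fourier_real_eq,
      ← integral_sub]
    · simp [F, smul_sub]
    · simpa [mul_comm] using (Real.fourierIntegral_convergent_iff (V := ℝ) w).2 ig
    · simpa [mul_comm] using (Real.fourierIntegral_convergent_iff (V := ℝ) w).2 iφ
  have hpi : -(2 * Real.pi) ≠ 0 := by simp [Real.pi_ne_zero]
  have hF' : Integrable (𝓕 F) := by
    rw [hFw]
    exact hi.comp_mul_left' hpi
  have := norm_le_ae hF hF'
  have hle : ∫ w, ‖𝓕 F w‖ ≤ C := by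
    rw [hFw]
    rw [Measure.integral_comp_mul_left (fun t => ‖charFun μ t - charFun ν t‖) (-(2 * Real.pi))]
    rw [abs_inv, abs_neg, abs_of_pos Real.two_pi_pos, smul_eq_mul, inv_mul_le_iff₀ Real.two_pi_pos]
    exact hC
  filter_upwards [this] with x hx
  have h2 : ‖F x‖ = |g x - φ x| := by
    rw [← Real.norm_eq_abs, ← Complex.norm_real]; simp [F]
  rw [← h2]; exact hx.trans hle

end Fourier

section Law

noncomputable def unif0 : Measure ℝ := ProbabilityTheory.cond MeasureTheory.volume
        (Set.Icc (-Real.sqrt 3) (Real.sqrt 3))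

lemma vol_unif0 : volume (Set.Icc (-Real.sqrt 3) (Real.sqrt 3)) = ENNReal.ofReal (2 * √3) := by
  rw [Real.volume_Icc]; congr 1; ring

instance : IsProbabilityMeasure unif0 := by
  apply cond_isProbabilityMeasure_of_finite
  · rw [vol_unif0]; simp
  · rw [vol_unif0]; exact ENNReal.ofReal_ne_top

lemma mix_eq (ε : ℝ) : unifGaussMix ε = (unif0.map (√ε * ·)).conv
    ((gaussianReal 0 1).map (√(1 - ε) * ·)) := by
  rw [Measure.conv, Measure.map_prod_map _ _ (by fun_prop) (by fun_prop),
    Measure.map_map (by fun_prop) (by fun_prop)]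
  rfl

instance (ε : ℝ) : IsProbabilityMeasure (unifGaussMix ε) := by
  rw [mix_eq]
  have : IsProbabilityMeasure (unif0.map (√ε * ·)) :=
    Measure.isProbabilityMeasure_map (by fun_prop)
  have : IsProbabilityMeasure ((gaussianReal 0 1).map (√(1 - ε) * ·)) :=
    Measure.isProbabilityMeasure_map (by fun_prop)
  infer_instance

lemma charFun_unif0 (t : ℝ) : charFun unif0 t = (Real.sinc (√3 * t) : ℂ) := by
  have h3 : (0:ℝ) < √3 := by positivity
  rw [charFun_apply_real, unif0, ProbabilityTheory.cond, integral_smul_measure, vol_unif0,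
    integral_Icc_eq_integral_Ioc, ← intervalIntegral.integral_of_le (by linarith),
    ENNReal.toReal_inv, ENNReal.toReal_ofReal (by positivity)]
  rcases eq_or_ne t 0 with rfl | ht
  · simp
    norm_cast
    field_simp
    norm_num
  have := intervalIntegral.integral_comp_mul_left (a := -√3) (b := √3) (fun x : ℝ => Complex.exp (x * Complex.I)) ht
  have h2 := integral_exp_mul_I_eq_sinc (√3 * t)
  rw [show t * -√3 = -(√3 * t) by ring, mul_comm t √3, h2] at this
  push_cast at this
  rw [this]
  simp only [Complex.real_smul]
  have : (t:ℂ) ≠ 0 := by exact_mod_cast ht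
  have : (√3:ℂ) ≠ 0 := by exact_mod_cast h3.ne'
  push_cast
  field_simp

lemma charFun_mix {ε : ℝ} (h1 : ε ≤ 1) (t : ℝ) : charFun (unifGaussMix ε) t =
    ((Real.sinc (√3 * (√ε * t)) * Real.exp (-((1 - ε) * t^2 / 2)) : ℝ) : ℂ) := by
  rw [mix_eq, charFun_conv, charFun_map_mul, charFun_map_mul, charFun_unif0, charFun_gaussianReal]
  push_cast
  congr 2
  have : ((√(1 - ε) : ℝ) : ℂ)^2 = 1 - ε := by
    norm_cast; rw [Real.sq_sqrt (by linarith)]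
  simp
  rw [mul_pow, this]

lemma conv_le {μ ν : Measure ℝ} [IsProbabilityMeasure μ] [SFinite ν] (h : ν ≤ volume) :
    μ.conv ν ≤ volume := by
  rw [Measure.le_iff]
  intro s hs
  rw [Measure.conv, Measure.map_apply (by fun_prop) hs,
    Measure.prod_apply (hs.preimage (by fun_prop))]
  calc _ ≤ ∫⁻ x, volume s ∂μ := by
        refine lintegral_mono fun x => ?_
        refine (h _).trans (le_of_eq ?_)
        exact measure_preimage_add volume x s
    _ = volume s := by simp

lemma map_le {ν : Measure ℝ} {a : ℝ} (ha : 1/2 ≤ a) (h : ν ≤ (2:ENNReal)⁻¹ • volume) :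
    ν.map (a * ·) ≤ volume := by
  rw [Measure.le_iff]
  intro s hs
  rw [Measure.map_apply (by fun_prop) hs]
  refine (h _).trans ?_
  rw [Measure.smul_apply, Real.volume_preimage_mul_left (by linarith), smul_eq_mul, ← mul_assoc]
  conv_rhs => rw [← one_mul (volume s)]
  gcongr
  rw [abs_of_pos (by positivity), ← ENNReal.ofReal_ofNat, ← ENNReal.ofReal_inv_of_pos (by norm_num),
    ← ENNReal.ofReal_mul (by norm_num), ENNReal.ofReal_le_one, ← mul_inv]
  apply inv_le_one_of_one_le₀; linarith

lemma unif0_le : unif0 ≤ (2:ENNReal)⁻¹ • volume := by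
  rw [unif0, ProbabilityTheory.cond, vol_unif0]
  gcongr
  · rw [← ENNReal.ofReal_ofNat]
    apply ENNReal.ofReal_le_ofReal
    have : 1 ≤ √3 := Real.one_le_sqrt.2 (by norm_num)
    linarith
  · exact Measure.restrict_le_self

lemma gauss_le : gaussianReal 0 1 ≤ (2:ENNReal)⁻¹ • volume := by
  rw [gaussianReal_of_var_ne_zero _ one_ne_zero, ← withDensity_const]
  apply withDensity_mono
  refine ae_of_all _ fun x => ?_
  rw [gaussianPDF, ← ENNReal.ofReal_ofNat, ← ENNReal.ofReal_inv_of_pos (by norm_num)]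
  apply ENNReal.ofReal_le_ofReal
  rw [gaussianPDFReal]
  have h2 : 2 ≤ √(2 * Real.pi * (1:NNReal)) := by
    apply Real.le_sqrt_of_sq_le
    simp
    nlinarith [Real.pi_gt_three]
  have h1 : Real.exp (-(x - 0)^2 / (2 * (1:NNReal))) ≤ 1 := by
    rw [Real.exp_le_one_iff]
    have : 0 ≤ (x - 0)^2 / (2 * ((1:NNReal):ℝ)) := by positivity
    rw [neg_div]; linarith
  calc _ ≤ (2:ℝ)⁻¹ * 1 := by gcongr
    _ = _ := by simp

lemma mix_le {ε : ℝ} : unifGaussMix ε ≤ volume := by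
  rw [mix_eq]
  have : IsProbabilityMeasure (unif0.map (√ε * ·)) :=
    Measure.isProbabilityMeasure_map (by fun_prop)
  have : IsProbabilityMeasure ((gaussianReal 0 1).map (√(1 - ε) * ·)) :=
    Measure.isProbabilityMeasure_map (by fun_prop)
  rcases le_total (1/2) ε with h | h
  · rw [Measure.conv_comm]
    apply conv_le (map_le _ unif0_le)
    apply Real.le_sqrt_of_sq_le; linarith
  · apply conv_le (map_le _ gauss_le)
    apply Real.le_sqrt_of_sq_le; linarith

lemma mix_maxdens (ε : ℝ) : ∃ f : ℝ → ℝ, unifGaussMix ε = MeasureTheory.volume.withDensity (fun x => ENNReal.ofReal (f x)) ∧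
    ∀ x, 0 ≤ f x ∧ f x ≤ 1 := by
  have hac : unifGaussMix ε ≪ volume := Measure.absolutelyContinuous_of_le mix_le
  refine ⟨fun x => min ((unifGaussMix ε).rnDeriv volume x).toReal 1, ?_, fun x => 
    ⟨le_min ENNReal.toReal_nonneg zero_le_one, min_le_right _ _⟩⟩
  rw [← Measure.withDensity_rnDeriv_eq _ _ hac]
  conv_rhs => rw [Measure.withDensity_rnDeriv_eq _ _ hac]
  apply withDensity_congr_ae
  filter_upwards [Measure.rnDeriv_le_one_of_le (mix_le (ε := ε))] with x hx
  have hx' : ((unifGaussMix ε).rnDeriv volume x) ≠ ⊤ := ne_top_of_le_ne_top ENNReal.one_ne_top hx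
  rw [min_eq_left, ENNReal.ofReal_toReal hx']
  exact ENNReal.toReal_le_of_le_ofReal zero_le_one (by simpa using hx)

instance (μ : Measure ℝ) [IsProbabilityMeasure μ] (n : ℕ) : IsProbabilityMeasure (lawN μ n) :=
    Measure.isProbabilityMeasure_map (by fun_prop)

lemma lawN_charFun (μ : Measure ℝ) [IsProbabilityMeasure μ] (n : ℕ) (t : ℝ) :
    charFun (lawN μ n) t = charFun μ ((√n)⁻¹ * t) ^ n := by
  have : (fun y : Fin n → ℝ => (∑ i, y i) / Real.sqrt n) = fun y => (√n)⁻¹ * (∑ i, y i) := by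
    ext y; rw [div_eq_inv_mul]
  rw [lawN, this, charFun_map_mul_comp (by fun_prop), charFun_map_sum_pi_eq_prod]
  simp

lemma lawN_ac (μ : Measure ℝ) [IsProbabilityMeasure μ] (hμ : μ ≪ volume) (n : ℕ) (hn : 1 ≤ n) :
    lawN μ n ≪ volume := by
  obtain ⟨m, rfl⟩ : ∃ m, n = m + 1 := ⟨n - 1, by omega⟩
  have hi : iIndepFun (fun (i : Fin (m+1)) (y : Fin (m+1) → ℝ) => y i) (Measure.pi fun _ : Fin (m+1) => μ) :=
    iIndepFun_pi (X := fun _ => id) (fun _ => aemeasurable_id)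
  have h2 := hi.indepFun_finsetSum_of_notMem (fun i => by fun_prop) (s := Finset.univ.erase 0) (i := 0) (by simp)
  have h3 := h2.map_add_eq_map_conv_map (by fun_prop) (by fun_prop)
  have h4 : (∑ j ∈ Finset.univ.erase 0, (fun (y : Fin (m+1) → ℝ) => y j)) + (fun y => y 0) = fun y => ∑ i, y i := by
    ext y
    rw [← Finset.sum_erase_add _ _ (Finset.mem_univ (0 : Fin (m+1)))]
    simp only [Pi.add_apply, Finset.sum_apply]
  rw [h4] at h3
  have hs : (Measure.pi fun _ : Fin (m+1) => μ).map (fun y => ∑ i, y i) ≪ volume := by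
    rw [h3]
    apply Measure.conv_absolutelyContinuous
    rw [(measurePreserving_eval (fun _ : Fin (m+1) => μ) 0).map_eq]
    exact hμ
  have hc : (fun y : Fin (m+1) → ℝ => (∑ i, y i) / Real.sqrt (m+1:ℕ)) = (fun x => (√(m+1:ℕ))⁻¹ * x) ∘ (fun y => ∑ i, y i) := by
    ext y; simp [div_eq_inv_mul]
  rw [lawN, hc, ← Measure.map_map (by fun_prop) (by fun_prop)]
  refine Measure.AbsolutelyContinuous.mk fun s hs' h0 => ?_
  rw [Measure.map_apply (by fun_prop) hs']
  apply hs
  rw [Real.volume_preimage_mul_left (by positivity), h0, mul_zero]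

lemma gauss_density : gaussianReal 0 1 = volume.withDensity
    (fun x => ENNReal.ofReal (Real.exp (-x ^ 2 / 2) / Real.sqrt (2 * Real.pi))) := by
  rw [gaussianReal_of_var_ne_zero _ one_ne_zero]
  congr 1
  ext x
  rw [gaussianPDF, gaussianPDFReal]
  congr 1
  simp
  ring

lemma mix_conv {ε : ℝ} (h0 : 0 ≤ ε) (h1 : ε ≤ 1) {n : ℕ} (hn : 2 ≤ n)
    (hK : n * √(3/4) ^ (n - 2) ≤ 1 / (40 * (n:ℝ))) :
    ∃ f : ℝ → ℝ, lawN (unifGaussMix ε) n = volume.withDensity (fun x => ENNReal.ofReal (f x)) ∧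
    ∀ x : ℝ, |f x - Real.exp (-x ^ 2 / 2) / Real.sqrt (2 * Real.pi)| ≤ 1 / 10 / n := by
  have hac : unifGaussMix ε ≪ volume := Measure.absolutelyContinuous_of_le mix_le
  have hacn := lawN_ac (unifGaussMix ε) hac n (by omega)
  set μ := lawN (unifGaussMix ε) n with hμdef
  set φ : ℝ → ℝ := fun x => Real.exp (-x ^ 2 / 2) / Real.sqrt (2 * Real.pi) with hφ
  set g : ℝ → ℝ := fun x => (μ.rnDeriv volume x).toReal with hg
  have hgd : μ = volume.withDensity (fun x => ENNReal.ofReal (g x)) := by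
    conv_lhs => rw [← Measure.withDensity_rnDeriv_eq _ _ hacn]
    apply withDensity_congr_ae
    filter_upwards [Measure.rnDeriv_lt_top μ volume] with x hx
    rw [ENNReal.ofReal_toReal hx.ne]
  set D : ℝ → ℝ := fun t => (Real.sinc (√3 * (√ε * ((√n)⁻¹ * t))) *
    Real.exp (-((1 - ε) * ((√n)⁻¹ * t)^2 / 2))) ^ n - Real.exp (-(t^2/2)) with hD
  have hDc : Continuous D := by
    have := Real.continuous_sinc
    fun_prop
  have hchar : (fun t => charFun μ t - charFun (gaussianReal 0 1) t) = fun t => (D t : ℂ) := by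
    ext t
    rw [hμdef, lawN_charFun, charFun_mix h1, charFun_gaussianReal, hD]
    push_cast
    simp
  obtain ⟨hi, hle⟩ := integral_bound hn hK hDc (fun t => point_bound_t hn h0 h1)
  have hae : ∀ᵐ x, |g x - φ x| ≤ 1 / 10 / n := by
    apply density_compare (μ := μ) (ν := gaussianReal 0 1) hgd gauss_density
    · exact (Measure.measurable_rnDeriv _ _).ennreal_toReal
    · fun_prop
    · exact fun x => ENNReal.toReal_nonneg
    · intro x; positivity
    · rw [hchar]; exact hi.ofReal
    · have : ∀ t, ‖charFun μ t - charFun (gaussianReal 0 1) t‖ = |D t| := fun t => by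
        rw [congrFun hchar t, Complex.norm_real, Real.norm_eq_abs]
      simp_rw [this]
      exact hle
  classical
  refine ⟨fun x => if |g x - φ x| ≤ 1 / 10 / n then g x else φ x, ?_, fun x => ?_⟩
  · rw [hgd]
    apply withDensity_congr_ae
    filter_upwards [hae] with x hx
    rw [if_pos hx]
  · change |(if |g x - φ x| ≤ 1 / 10 / n then g x else φ x) - φ x| ≤ 1 / 10 / n
    split_ifs with h
    · exact h
    · rw [sub_self, abs_zero]; positivity

end Law

/-- there is a universal constant `k₀ ≥ 1` such that for every `ε ∈ [0,1]`,
the random variable `√ε·U + √(1−ε)·Z` (with `U` uniform on `[−√3,√3]` and `Z ∼ N(0,1)`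
independent) is `(1/10, k₀)`-Gaussian convergent and has maximum density at most `1`. -/
theorem stmt_3 :
    ∃ k₀ : ℕ, 1 ≤ k₀ ∧ ∀ ε : ℝ, ε ∈ Set.Icc (0 : ℝ) 1 →
      IsGaussianConvergent (unifGaussMix ε) (1 / 10) k₀ ∧
      HasMaxDensityLE (unifGaussMix ε) 1 := by
  obtain ⟨k, hk2, hk⟩ := exists_k0
  refine ⟨k, by omega, fun ε hε => ⟨fun n hn => ?_, mix_maxdens ε⟩⟩
  exact mix_conv hε.1 hε.2 (hk2.trans hn) (hk n hn)
end

section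
/- Let G ∈ ℝ^{n×d} be a random matrix with i.i.d. standard Gaussian N(0,1) entries. Then for every ε ∈ (0,1): P[ ∃ v ∈ ℝ^d with ‖v‖₂ = 1 such that ‖(Gv)⁺‖₁ ∉ [ (1−3ε)/(1−ε), (1+ε)/(1−ε) ] · n/√(2π) ] ≤ 2·(1 + 2/ε)^d · e^{−ε²n/(8π)}. -/
open MeasureTheory ProbabilityTheory

lemma gauss_mean : ∫ x, max x 0 ∂(gaussianReal 0 1) = 1 / Real.sqrt (2 * Real.pi) := by
  rw [integral_gaussianReal_eq_integral_smul (by norm_num)]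
  have h1 : (fun x : ℝ => gaussianPDFReal 0 1 x • max x 0)
      = (Set.Ioi (0:ℝ)).indicator
        (fun x => (Real.sqrt (2 * Real.pi))⁻¹ * (x * Real.exp (-(x ^ 2 / 2)))) := by
    ext x
    by_cases hx : 0 < x
    · rw [Set.indicator_of_mem (by exact hx), max_eq_left hx.le]
      simp [gaussianPDFReal, neg_div]
      ring
    · rw [Set.indicator_of_notMem (by exact hx), max_eq_right (not_lt.1 hx)]
      simp
  rw [h1, integral_indicator measurableSet_Ioi, integral_const_mul]
  have h2 : ∫ x in Set.Ioi (0:ℝ), x * Real.exp (-(x ^ 2 / 2)) = 0 - (-Real.exp (-((0:ℝ) ^ 2 / 2))) := by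
    apply integral_Ioi_of_hasDerivAt_of_nonneg' (g := fun x : ℝ => -Real.exp (-(x ^ 2 / 2)))
    · intro x _
      have h := (((hasDerivAt_pow 2 x).div_const 2).neg.exp).neg
      refine h.congr_deriv ?_
      simp
      ring
    · intro x hx
      have : (0:ℝ) < x := hx
      positivity
    · rw [← neg_zero]
      apply Filter.Tendsto.neg
      apply Real.tendsto_exp_neg_atTop_nhds_zero.comp
      exact (Filter.tendsto_pow_atTop (by norm_num)).atTop_div_const (by norm_num)
  rw [h2]; simp

lemma int_gexp (t : ℝ) : Integrable (fun x => Real.exp (t * x)) (gaussianReal 0 1) :=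
  integrable_exp_mul_gaussianReal t

lemma int_gexp_max (t : ℝ) : Integrable (fun x => Real.exp (t * max x 0)) (gaussianReal 0 1) := by
  refine ((int_gexp t).add (integrable_const 1)).mono' (by fun_prop) ?_
  refine Filter.Eventually.of_forall fun x => ?_
  rw [Real.norm_eq_abs, abs_of_pos (Real.exp_pos _)]
  have := Real.exp_pos (t * x)
  rcases le_total 0 x with h | h
  · simp [max_eq_left h]
  · simp [max_eq_right h]; exact this.le

lemma gexp_val (t : ℝ) : ∫ x, Real.exp (t * x) ∂(gaussianReal 0 1) = Real.exp (t ^ 2 / 2) := by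
  have := mgf_gaussianReal (p := gaussianReal 0 1) (X := id) (μ := 0) (v := 1) (by simp) t
  simpa [mgf] using this

lemma int_max : Integrable (fun x : ℝ => max x 0) (gaussianReal 0 1) := by
  have h : Integrable (fun x : ℝ => x) (gaussianReal 0 1) :=
    (memLp_id_gaussianReal (μ := 0) (v := 1) 1).integrable (by simp)
  exact h.pos_part

lemma prod_bound_s9 (t : ℝ) :
    (∫ x, Real.exp (t * max x 0) ∂(gaussianReal 0 1)) *
      (∫ x, Real.exp (-t * max x 0) ∂(gaussianReal 0 1)) ≤ Real.exp (t ^ 2) := by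
  have e1 : ∀ s : ℝ, ∫ z, Real.exp (s * max z.1 0) * Real.exp (-s * max z.2 0)
      ∂((gaussianReal 0 1).prod (gaussianReal 0 1)) =
      (∫ x, Real.exp (s * max x 0) ∂(gaussianReal 0 1)) *
      (∫ x, Real.exp (-s * max x 0) ∂(gaussianReal 0 1)) := fun s =>
    integral_prod_mul (fun x => Real.exp (s * max x 0)) (fun x => Real.exp (-s * max x 0))
  have e2 : ∀ s : ℝ, ∫ z, Real.exp (s * z.1) * Real.exp (-s * z.2)
      ∂((gaussianReal 0 1).prod (gaussianReal 0 1)) = Real.exp (s ^ 2) := fun s => by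
    rw [integral_prod_mul (fun x => Real.exp (s * x)) (fun x => Real.exp (-s * x)),
      gexp_val, gexp_val, ← Real.exp_add]
    ring_nf
  have i1 : ∀ s : ℝ, Integrable (fun z : ℝ × ℝ => Real.exp (s * max z.1 0) * Real.exp (-s * max z.2 0))
      ((gaussianReal 0 1).prod (gaussianReal 0 1)) := fun s =>
    (int_gexp_max s).mul_prod (int_gexp_max (-s))
  have i2 : ∀ s : ℝ, Integrable (fun z : ℝ × ℝ => Real.exp (s * z.1) * Real.exp (-s * z.2))
      ((gaussianReal 0 1).prod (gaussianReal 0 1)) := fun s =>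
    (int_gexp s).mul_prod (int_gexp (-s))
  have key := integral_mono ((i1 t).add (i1 (-t))) ((i2 t).add (i2 (-t))) (fun z => by
    have hc : Real.cosh (t * (max z.1 0 - max z.2 0)) ≤ Real.cosh (t * (z.1 - z.2)) := by
      rw [Real.cosh_le_cosh, abs_mul, abs_mul]
      exact mul_le_mul_of_nonneg_left (abs_max_sub_max_le_abs _ _ _) (abs_nonneg _)
    simp only [Pi.add_apply, ← Real.exp_add]
    rw [Real.cosh_eq, Real.cosh_eq] at hc
    ring_nf at hc ⊢
    linarith)
  simp only [Pi.add_apply] at key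
  rw [integral_add (i1 t) (i1 (-t)), integral_add (i2 t) (i2 (-t)), e1, e1, e2, e2] at key
  rw [neg_neg, neg_sq] at key
  linarith

lemma subG : HasSubgaussianMGF (fun x : ℝ => max x 0 - 1 / Real.sqrt (2 * Real.pi)) 2
    (gaussianReal 0 1) := by
  set m := 1 / Real.sqrt (2 * Real.pi) with hm
  have hs : ∀ t x : ℝ, Real.exp (t * (max x 0 - m)) = Real.exp (-t * m) * Real.exp (t * max x 0) := by
    intro t x; rw [← Real.exp_add]; ring_nf
  constructor
  · intro t
    simp_rw [hs]
    exact (int_gexp_max t).const_mul _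
  · intro t
    simp only [mgf]
    simp_rw [hs]
    rw [integral_const_mul]
    have jen : Real.exp (-t * m) ≤ ∫ x, Real.exp (-t * max x 0) ∂(gaussianReal 0 1) := by
      have := convexOn_exp.map_integral_le (μ := gaussianReal 0 1) (f := fun x : ℝ => -t * max x 0)
        Real.continuous_exp.continuousOn isClosed_univ (by simp) (int_max.const_mul _)
        (int_gexp_max (-t))
      rwa [integral_const_mul, gauss_mean] at this
    have h0 : 0 ≤ ∫ x, Real.exp (t * max x 0) ∂(gaussianReal 0 1) :=
      integral_nonneg fun x => (Real.exp_pos _).le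
    calc _ ≤ (∫ x, Real.exp (-t * max x 0) ∂(gaussianReal 0 1)) * _ :=
          mul_le_mul_of_nonneg_right jen h0
      _ ≤ Real.exp (t ^ 2) := by rw [mul_comm]; exact prod_bound_s9 t
      _ = _ := by congr 1; push_cast; ring

lemma row_law {d : ℕ} (v : Fin d → ℝ) (hv : ∑ j, v j ^ 2 = 1) :
    (Measure.pi fun _ : Fin d => gaussianReal 0 1).map (fun x => ∑ j, x j * v j)
      = gaussianReal 0 1 := by
  have hind : iIndepFun (fun (j : Fin d) (x : Fin d → ℝ) => x j * v j)
      (Measure.pi fun _ : Fin d => gaussianReal 0 1) :=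
    iIndepFun_pi (X := fun j x => x * v j) (fun j => by fun_prop)
  have h1 : ∀ j, (Measure.pi fun _ : Fin d => gaussianReal 0 1).map (fun x => x j * v j)
      = gaussianReal 0 (‖v j‖₊ ^ 2) := by
    intro j
    have := (measurePreserving_eval (fun _ : Fin d => gaussianReal 0 1) j).map_eq
    have h2 := Measure.map_map (μ := Measure.pi fun _ : Fin d => gaussianReal 0 1)
      (g := fun x => x * v j) (f := Function.eval j) (by fun_prop) (by fun_prop)
    rw [this, gaussianReal_map_mul_const] at h2
    rw [show (fun x : Fin d → ℝ => x j * v j) = (fun x => x * v j) ∘ Function.eval j from rfl, ← h2]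
    congr 1
    · simp
    · ext; simp
  have key : ∀ s : Finset (Fin d), (Measure.pi fun _ : Fin d => gaussianReal 0 1).map
      (∑ j ∈ s, fun x : Fin d → ℝ => x j * v j) = gaussianReal 0 (∑ j ∈ s, ‖v j‖₊ ^ 2) := by
    intro s
    induction s using Finset.induction_on with
    | empty =>
      simp only [Finset.sum_empty, gaussianReal_zero_var]
      have h := Measure.map_const (Measure.pi fun _ : Fin d => gaussianReal 0 1) (0 : ℝ)
      rw [measure_univ, one_smul] at h
      exact h
    | insert a s ha ih =>
      rw [Finset.sum_insert ha, Finset.sum_insert ha]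
      have := gaussianReal_add_gaussianReal_of_indepFun
        (hind.indepFun_finsetSum_of_notMem (fun i => by fun_prop) ha).symm (h1 a) ih
      rwa [add_zero] at this
  have := key Finset.univ
  have hs : ∑ j, ‖v j‖₊ ^ 2 = 1 := by
    ext; push_cast; simpa using hv
  rw [hs] at this
  convert this using 2
  ext x
  simp

lemma tail {n d : ℕ} (v : Fin d → ℝ) (hv : ∑ j, v j ^ 2 = 1) (ε : ℝ) (hε : 0 < ε) :
    (Measure.pi fun _ : Fin n × Fin d => gaussianReal 0 1)
      {ω | (∑ i : Fin n, max (∑ j : Fin d, ω (i, j) * v j) 0) ∉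
          Set.Icc ((1 - ε) * (n / Real.sqrt (2 * Real.pi)))
            ((1 + ε) * (n / Real.sqrt (2 * Real.pi)))}
      ≤ ENNReal.ofReal (2 * Real.exp (-ε ^ 2 * n / (8 * Real.pi))) := by
  set m := 1 / Real.sqrt (2 * Real.pi) with hm
  set P := Measure.pi fun _ : Fin n × Fin d => gaussianReal 0 1 with hP
  let Q := Measure.pi fun _ : Fin n => Measure.pi fun _ : Fin d => gaussianReal 0 1
  have hmp : MeasurePreserving (MeasurableEquiv.curry (Fin n) (Fin d) ℝ) P Q := by
    refine ⟨by fun_prop, ?_⟩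
    have := Measure.infinitePi_map_curry (fun (_ : Fin n) (_ : Fin d) => gaussianReal 0 1)
    simpa only [Measure.infinitePi_eq_pi] using this
  let Y : Fin n → (Fin n × Fin d → ℝ) → ℝ := fun i ω => max (∑ j : Fin d, ω (i, j) * v j) 0 - m
  have hrow : HasSubgaussianMGF (fun x : Fin d → ℝ => max (∑ j, x j * v j) 0 - m) 2
      (Measure.pi fun _ : Fin d => gaussianReal 0 1) := by
    have := subG
    rw [← row_law v hv] at this
    exact this.of_map (by fun_prop : Measurable _).aemeasurable
  have hsub : ∀ i, HasSubgaussianMGF (Y i) 2 P := by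
    intro i
    rw [← (measurePreserving_eval (fun _ : Fin n => Measure.pi fun _ : Fin d => gaussianReal 0 1) i).map_eq]
      at hrow
    have hY : AEMeasurable (Function.eval i : (Fin n → Fin d → ℝ) → (Fin d → ℝ))
        (Measure.pi fun _ : Fin n => Measure.pi fun _ : Fin d => gaussianReal 0 1) :=
      (measurable_pi_apply i).aemeasurable
    have h2 := HasSubgaussianMGF.of_map hY hrow
    rw [show (Measure.pi fun _ : Fin n => Measure.pi fun _ : Fin d => gaussianReal 0 1) = _
      from hmp.map_eq.symm] at h2
    exact h2.of_map (by fun_prop)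
  have hind : iIndepFun Y P := by
    have h1 : iIndepFun (fun (i : Fin n) (x : Fin n → Fin d → ℝ) => max (∑ j, x i j * v j) 0 - m) Q :=
      iIndepFun_pi (X := fun i (x : Fin d → ℝ) => max (∑ j, x j * v j) 0 - m)
        (fun j => (by fun_prop : Measurable _).aemeasurable)
    rw [iIndepFun_iff_measure_inter_preimage_eq_mul] at h1 ⊢
    intro S sets hsets
    have hm1 : ∀ i ∈ S, MeasurableSet
        ((fun x : Fin n → Fin d → ℝ => max (∑ j, x i j * v j) 0 - m) ⁻¹' sets i) :=
      fun i hi => (by fun_prop : Measurable _) (hsets i hi)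
    have h2 := h1 S hsets
    rw [← hmp.measure_preimage (Finset.measurableSet_biInter S hm1).nullMeasurableSet,
      Finset.prod_congr rfl fun i hi =>
        (hmp.measure_preimage (hm1 i hi).nullMeasurableSet).symm] at h2
    simp only [Set.preimage_iInter] at h2
    exact h2
  have hneg : iIndepFun (fun i => -(Y i)) P :=
    hind.comp (fun _ x => -x) (fun _ => measurable_neg)
  set r := ε * (n * m) with hr
  have hr0 : 0 ≤ r := by positivity
  have hexp : Real.exp (-r ^ 2 / (2 * ((∑ i : Fin n, (2 : NNReal) : NNReal) : ℝ)))
      = Real.exp (-ε ^ 2 * n / (8 * Real.pi)) := by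
    congr 1
    simp only [Finset.sum_const, Finset.card_univ, Fintype.card_fin, nsmul_eq_mul,
      NNReal.coe_mul, NNReal.coe_natCast, NNReal.coe_ofNat]
    rw [hr, hm]
    have hsq : Real.sqrt (2 * Real.pi) ^ 2 = 2 * Real.pi := Real.sq_sqrt (by positivity)
    have : (ε * (n * (1 / Real.sqrt (2 * Real.pi)))) ^ 2 = ε ^ 2 * n ^ 2 / (2 * Real.pi) := by
      rw [mul_pow, mul_pow, div_pow, hsq]; ring
    rw [this]
    rcases Nat.eq_zero_or_pos n with h | h
    · subst h; simp
    · have : (0:ℝ) < n := by exact_mod_cast h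
      field_simp
      norm_num
  have t1 := HasSubgaussianMGF.measure_sum_ge_le_of_iIndepFun hind (s := Finset.univ)
    (c := fun _ => 2) (fun i _ => hsub i) hr0
  have t2 := HasSubgaussianMGF.measure_sum_ge_le_of_iIndepFun hneg (s := Finset.univ)
    (c := fun _ => 2) (fun i _ => (hsub i).neg) hr0
  rw [hexp] at t1 t2
  have hincl : {ω : Fin n × Fin d → ℝ | (∑ i : Fin n, max (∑ j : Fin d, ω (i, j) * v j) 0) ∉
          Set.Icc ((1 - ε) * (n / Real.sqrt (2 * Real.pi)))
            ((1 + ε) * (n / Real.sqrt (2 * Real.pi)))} ⊆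
      {ω | r ≤ ∑ i, Y i ω} ∪ {ω | r ≤ ∑ i, (-(Y i)) ω} := by
    intro ω hω
    have e : (n : ℝ) / Real.sqrt (2 * Real.pi) = n * m := by rw [hm]; ring
    simp only [Set.mem_ofPred_eq, Set.mem_Icc, not_and_or, not_le, e] at hω
    simp only [Set.mem_union, Set.mem_ofPred_eq, Y, Pi.neg_apply, Finset.sum_neg_distrib,
      Finset.sum_sub_distrib, Finset.sum_const, Finset.card_univ, Fintype.card_fin, nsmul_eq_mul]
    rcases hω with h | h
    · right; rw [hr]; linarith
    · left; rw [hr]; linarith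
  calc P _ ≤ P _ + P _ := (measure_mono hincl).trans (measure_union_le _ _)
    _ = ENNReal.ofReal (P.real {ω | r ≤ ∑ i, Y i ω} + P.real {ω | r ≤ ∑ i, (-(Y i)) ω}) := by
      rw [ENNReal.ofReal_add measureReal_nonneg measureReal_nonneg]
      simp [measureReal_def]
    _ ≤ _ := ENNReal.ofReal_le_ofReal (by linarith)

lemma sep_card {d : ℕ} {ε : ℝ} (hε : 0 < ε) (s : Finset (EuclideanSpace ℝ (Fin d)))
    (hs : ∀ c ∈ s, ‖c‖ = 1) (h : ∀ c ∈ s, ∀ e ∈ s, c ≠ e → ε ≤ ‖c - e‖) :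
    (s.card : ℝ) ≤ (1 + 2 / ε) ^ d := by
  let μ : Measure (EuclideanSpace ℝ (Fin d)) := volume
  have D : Set.Pairwise (s : Set (EuclideanSpace ℝ (Fin d)))
      (Function.onFun Disjoint fun c => Metric.ball c (ε / 2)) := by
    rintro c hc e he hce
    apply Metric.ball_disjoint_ball
    rw [dist_eq_norm]
    linarith [h c hc e he hce]
  have hsub : (⋃ c ∈ s, Metric.ball c (ε / 2)) ⊆ Metric.ball 0 (1 + ε / 2) := by
    refine Set.iUnion₂_subset fun x hx => Metric.ball_subset_ball' ?_
    rw [dist_zero_right, hs x hx]; linarith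
  have I := measure_mono (μ := μ) hsub
  rw [measure_biUnion_finset D fun c _ => measurableSet_ball] at I
  simp only [μ.addHaar_ball_of_pos _ (half_pos hε),
    μ.addHaar_ball_of_pos _ (show 0 < 1 + ε / 2 by positivity), Finset.sum_const, nsmul_eq_mul,
    ← mul_assoc, finrank_euclideanSpace, Fintype.card_fin] at I
  have J := (ENNReal.mul_le_mul_iff_left (Metric.measure_ball_pos _ _ zero_lt_one).ne'
    measure_ball_lt_top.ne).1 I
  have K := ENNReal.toReal_le_of_le_ofReal (by positivity) J
  rw [ENNReal.toReal_mul, ENNReal.toReal_ofReal (by positivity), ENNReal.toReal_natCast,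
    ← le_div_iff₀ (by positivity), ← div_pow] at K
  have e : (1 + ε / 2) / (ε / 2) = 1 + 2 / ε := by field_simp; ring
  rwa [e] at K

lemma exists_net (d : ℕ) {ε : ℝ} (hε : 0 < ε) : ∃ s : Finset (EuclideanSpace ℝ (Fin d)),
    (∀ c ∈ s, ‖c‖ = 1) ∧ (∀ v, ‖v‖ = 1 → ∃ c ∈ s, ‖v - c‖ ≤ ε) ∧
    (s.card : ℝ) ≤ (1 + 2 / ε) ^ d := by
  classical
  let good : Finset (EuclideanSpace ℝ (Fin d)) → Prop := fun s =>
    (∀ c ∈ s, ‖c‖ = 1) ∧ (∀ c ∈ s, ∀ e ∈ s, c ≠ e → ε ≤ ‖c - e‖)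
  let p : ℕ → Prop := fun k => ∃ s, good s ∧ s.card = k
  have hb : ∀ k, p k → k ≤ ⌊(1 + 2 / ε) ^ d⌋₊ := by
    rintro k ⟨s, hs, rfl⟩
    exact Nat.le_floor (sep_card hε s hs.1 hs.2)
  have h0 : p 0 := ⟨∅, ⟨by simp, by simp⟩, rfl⟩
  obtain ⟨s, hs, hcard⟩ := Nat.findGreatest_spec (P := p) (Nat.zero_le ⌊(1 + 2 / ε) ^ d⌋₊) h0
  refine ⟨s, hs.1, ?_, sep_card hε s hs.1 hs.2⟩
  intro v hv
  by_contra! hc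
  have hvs : v ∉ s := fun hm => by
    have := hc v hm
    simp at this; linarith
  have hp : p (s.card + 1) := by
    refine ⟨insert v s, ⟨?_, ?_⟩, Finset.card_insert_of_notMem hvs⟩
    · intro c hcm
      rcases Finset.mem_insert.1 hcm with rfl | h
      · exact hv
      · exact hs.1 c h
    · intro c hcm e hem hne
      rcases Finset.mem_insert.1 hcm with rfl | h <;> rcases Finset.mem_insert.1 hem with rfl | h'
      · exact absurd rfl hne
      · exact (hc e h').le
      · rw [norm_sub_rev]; exact (hc c h).le
      · exact hs.2 c h e h' hne
  have := Nat.le_findGreatest (hb _ hp) hp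
  omega

/-- The positive part functional. -/
noncomputable def posF {n d : ℕ} (ω : Fin n × Fin d → ℝ) (v : EuclideanSpace ℝ (Fin d)) : ℝ :=
  ∑ i : Fin n, max (∑ j : Fin d, ω (i, j) * v j) 0

lemma posF_add {n d : ℕ} (ω : Fin n × Fin d → ℝ) (u v : EuclideanSpace ℝ (Fin d)) :
    posF ω (u + v) ≤ posF ω u + posF ω v := by
  simp only [posF, ← Finset.sum_add_distrib]
  refine Finset.sum_le_sum fun i _ => ?_
  simp only [PiLp.add_apply, mul_add, Finset.sum_add_distrib]
  exact max_le (add_le_add (le_max_left _ _) (le_max_left _ _))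
    (add_nonneg (le_max_right _ _) (le_max_right _ _))

lemma posF_smul {n d : ℕ} (ω : Fin n × Fin d → ℝ) (v : EuclideanSpace ℝ (Fin d)) {a : ℝ}
    (ha : 0 ≤ a) : posF ω (a • v) = a * posF ω v := by
  simp only [posF, Finset.mul_sum]
  refine Finset.sum_congr rfl fun i _ => ?_
  rw [mul_max_of_nonneg _ _ ha, mul_zero, Finset.mul_sum]
  congr 1
  refine Finset.sum_congr rfl fun j _ => ?_
  simp; ring

lemma net_arg {n d : ℕ} (ω : Fin n × Fin d → ℝ) {ε M : ℝ} (hε : ε ∈ Set.Ioo (0 : ℝ) 1)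
    (s : Finset (EuclideanSpace ℝ (Fin d)))
    (hcov : ∀ v, ‖v‖ = 1 → ∃ c ∈ s, ‖v - c‖ ≤ ε)
    (hs : ∀ c ∈ s, posF ω c ∈ Set.Icc ((1 - ε) * M) ((1 + ε) * M))
    (v : EuclideanSpace ℝ (Fin d)) (hv : ‖v‖ = 1) :
    posF ω v ∈ Set.Icc ((1 - 3 * ε) / (1 - ε) * M) ((1 + ε) / (1 - ε) * M) := by
  obtain ⟨h0, h1⟩ := hε
  have hcont : Continuous (posF ω) := by unfold posF; fun_prop
  obtain ⟨w, hw, hmax⟩ := (isCompact_sphere (0 : EuclideanSpace ℝ (Fin d)) 1).exists_isMaxOn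
    ⟨v, by simpa using hv⟩ hcont.continuousOn
  have hw1 : ‖w‖ = 1 := by simpa using hw
  set S := posF ω w
  have hSv : ∀ u, ‖u‖ = 1 → posF ω u ≤ S := fun u hu => hmax (by simpa using hu)
  have hS0 : 0 ≤ S := Finset.sum_nonneg fun i _ => le_max_right _ _
  have hsmall : ∀ u, ‖u‖ ≤ ε → posF ω u ≤ ε * S := by
    intro u hu
    by_cases hz : u = 0
    · subst hz
      have : posF ω (0 : EuclideanSpace ℝ (Fin d)) = 0 := by simp [posF]
      rw [this]; positivity
    · have hn : ‖u‖ ≠ 0 := by simpa using hz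
      have e : u = ‖u‖ • (‖u‖⁻¹ • u) := by rw [smul_smul, mul_inv_cancel₀ hn, one_smul]
      rw [e, posF_smul _ _ (norm_nonneg _)]
      have := hSv (‖u‖⁻¹ • u) (by rw [norm_smul, norm_inv, norm_norm, inv_mul_cancel₀ hn])
      calc _ ≤ ‖u‖ * S := mul_le_mul_of_nonneg_left this (norm_nonneg _)
        _ ≤ _ := mul_le_mul_of_nonneg_right hu hS0
  have h1e : 0 < 1 - ε := by linarith
  have hSM : S ≤ (1 + ε) / (1 - ε) * M := by
    obtain ⟨c, hc, hwc⟩ := hcov w hw1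
    have a := posF_add ω c (w - c)
    rw [add_sub_cancel] at a
    have b := hsmall _ hwc
    have := (hs c hc).2
    rw [div_mul_eq_mul_div, le_div_iff₀ h1e]
    change S ≤ _ at a
    linarith
  refine ⟨?_, (hSv v hv).trans hSM⟩
  obtain ⟨c, hc, hvc⟩ := hcov v hv
  have a := posF_add ω v (c - v)
  rw [add_sub_cancel] at a
  have b := hsmall (c - v) (by rwa [norm_sub_rev])
  have := (hs c hc).1
  have h3 : (1 - 3 * ε) / (1 - ε) * M = (1 - ε) * M - ε * ((1 + ε) / (1 - ε) * M) := by
    field_simp; ring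
  have := mul_le_mul_of_nonneg_left hSM h0.le
  rw [h3]; linarith

/-- For a random `n × d` matrix `G` with i.i.d. standard Gaussian entries and
`ε ∈ (0,1)`, the probability that some unit vector `v` has `‖(Gv)⁺‖₁` outside
`[(1−3ε)/(1−ε), (1+ε)/(1−ε)]·n/√(2π)` is at most `2(1 + 2/ε)^d e^{−ε²n/(8π)}`. -/
theorem stmt_9 (n d : ℕ) (ε : ℝ) (hε : ε ∈ Set.Ioo (0 : ℝ) 1) :
    (Measure.pi fun _ : Fin n × Fin d => gaussianReal 0 1)
      {ω | ∃ v : Fin d → ℝ, (∑ j, v j ^ 2) = 1 ∧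
        (∑ i : Fin n, max (∑ j : Fin d, ω (i, j) * v j) 0) ∉
          Set.Icc ((1 - 3 * ε) / (1 - ε) * n / Real.sqrt (2 * Real.pi))
            ((1 + ε) / (1 - ε) * n / Real.sqrt (2 * Real.pi))}
      ≤ ENNReal.ofReal (2 * (1 + 2 / ε) ^ d * Real.exp (-ε ^ 2 * n / (8 * Real.pi))) := by
  obtain ⟨s, hs1, hcov, hcard⟩ := exists_net d hε.1
  set P := Measure.pi fun _ : Fin n × Fin d => gaussianReal 0 1
  set M : ℝ := n / Real.sqrt (2 * Real.pi) with hM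
  have hM0 : 0 ≤ M := by positivity
  set B : EuclideanSpace ℝ (Fin d) → Set (Fin n × Fin d → ℝ) := fun c =>
    {ω | (∑ i : Fin n, max (∑ j : Fin d, ω (i, j) * c j) 0) ∉
          Set.Icc ((1 - ε) * M) ((1 + ε) * M)} with hB
  have hnorm : ∀ v : EuclideanSpace ℝ (Fin d), ‖v‖ = 1 ↔ ∑ j, v j ^ 2 = 1 := by
    intro v
    rw [EuclideanSpace.norm_eq, Real.sqrt_eq_one]
    simp
  calc P _ ≤ P (⋃ c ∈ s, B c) := by
        refine measure_mono ?_
        rintro ω ⟨v, hv, hout⟩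
        by_contra hno
        simp only [Set.mem_iUnion, not_exists, hB, Set.mem_ofPred_eq, not_not] at hno
        apply hout
        have := net_arg ω hε s hcov (fun c hc => hno c hc) (WithLp.toLp 2 v)
          ((hnorm _).2 (by simpa using hv))
        rw [mul_div_assoc, mul_div_assoc]
        exact this
    _ ≤ ∑ c ∈ s, P (B c) := measure_biUnion_finset_le _ _
    _ ≤ ∑ c ∈ s, ENNReal.ofReal (2 * Real.exp (-ε ^ 2 * n / (8 * Real.pi))) :=
        Finset.sum_le_sum fun c hc => tail c ((hnorm c).1 (hs1 c hc)) ε hε.1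
    _ = ENNReal.ofReal (s.card * (2 * Real.exp (-ε ^ 2 * n / (8 * Real.pi)))) := by
        rw [Finset.sum_const, nsmul_eq_mul, 
          ENNReal.ofReal_mul (Nat.cast_nonneg s.card), ENNReal.ofReal_natCast]
    _ ≤ _ := by
        apply ENNReal.ofReal_le_ofReal
        have := mul_le_mul_of_nonneg_right hcard
          (show 0 ≤ 2 * Real.exp (-ε ^ 2 * n / (8 * Real.pi)) by positivity)
        linarith
end
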